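/- arXiv:2104.07137 — 2 statements merged into one kernel-verified Lean document; each statement's English description precedes it below -/
import Mathlib

section
/- Uniformly for x ≥ y ≥ 2, with u = log x / log y, one has S(x,y) = x log(x y²) ∏_{p ≤ y, p prime} (1 − 1/p)² · (1 + O(1/log x + u^{−u})); that is, there is an absolute constant C such that the relative error is at most C(1/log x + u^{−u}). -/
open Real MeasureTheory

/-- `S x y = ∑_{n ≤ x, P⁻(n) > y} τ(n)`, where `n = 1` is included since `P⁻(1) = ∞`. -/
noncomputable def S (x y : ℝ) : ℝ :=
  ∑ n ∈ (Finset.Icc 1 ⌊x⌋₊).filter (fun n => n = 1 ∨ y < (n.minFac : ℝ)),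
    (n.divisors.card : ℝ)

/-- `∏_{p ≤ y, p prime} (1 - 1/p)`. -/
noncomputable def primeProd (y : ℝ) : ℝ :=
  ∏ p ∈ (Finset.range (⌊y⌋₊ + 1)).filter Nat.Prime, (1 - 1 / (p : ℝ))

def Rough (n k : ℕ) : Prop := ∀ p, p.Prime → p ∣ k → n < p

open Classical in
noncomputable def ft (n k : ℕ) : ℝ := if Rough n k then (k.divisors.card : ℝ) else 0

noncomputable def TT (n N : ℕ) : ℝ := ∑ k ∈ Finset.Icc 1 N, ft n k

noncomputable def VV (n : ℕ) : ℝ :=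
  ∏ p ∈ (Finset.range (n + 1)).filter Nat.Prime, (1 - 1 / (p : ℝ))

noncomputable def LL (n : ℕ) : ℝ :=
  ∑ p ∈ (Finset.range (n + 1)).filter Nat.Prime, Real.log p / ((p : ℝ) - 1)

noncomputable def MM (n : ℕ) (x : ℝ) : ℝ :=
  x * VV n ^ 2 * (Real.log x + (2 * Real.eulerMascheroniConstant - 1) + 2 * LL n)

noncomputable def EE (n : ℕ) (x : ℝ) : ℝ := TT n ⌊x⌋₊ - MM n x

lemma rough_pow_mul {p m : ℕ} (n j : ℕ) (hp : p.Prime) (hpn : p = n + 1) :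
    Rough n (p ^ j * m) ↔ Rough n m := by
  constructor
  · intro h q hq hqm
    exact h q hq (Dvd.dvd.mul_left hqm _)
  · intro h q hq hqm
    rcases (Nat.Prime.dvd_mul hq).1 hqm with h1 | h1
    · have := (Nat.prime_dvd_prime_iff_eq hq hp).1 (hq.dvd_of_dvd_pow h1)
      omega
    · exact h q hq h1

lemma rough_succ_of_not_dvd {p m n : ℕ} (hpn : p = n + 1) (hm : ¬ p ∣ m) :
    Rough (n + 1) m ↔ Rough n m := by
  constructor
  · intro h q hq hqm
    have := h q hq hqm
    omega
  · intro h q hq hqm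
    have := h q hq hqm
    have : q ≠ p := by rintro rfl; exact hm hqm
    omega

lemma card_div_pow_mul {p m : ℕ} (j : ℕ) (hp : p.Prime) (hm : ¬ p ∣ m) :
    ((p ^ j * m).divisors.card : ℝ) = (j + 1) * m.divisors.card := by
  have hc : Nat.Coprime (p ^ j) m := Nat.Coprime.pow_left _ ((Nat.Prime.coprime_iff_not_dvd hp).2 hm)
  rw [hc.card_divisors_mul, Nat.divisors_prime_pow hp]
  simp

lemma ft_pow_mul {p m : ℕ} (n j : ℕ) (hp : p.Prime) (hpn : p = n + 1) (hm : ¬ p ∣ m) :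
    ft n (p ^ j * m) = (j + 1) * ft n m := by
  unfold ft
  rw [rough_pow_mul n j hp hpn, card_div_pow_mul j hp hm]
  split_ifs <;> simp

lemma ft_succ {p : ℕ} (n k : ℕ) (hp : p.Prime) (hpn : p = n + 1) (hk : k ≠ 0) :
    ft (n + 1) k = ft n k - 2 * (if p ∣ k then ft n (k / p) else 0)
      + (if p ^ 2 ∣ k then ft n (k / p ^ 2) else 0) := by
  obtain ⟨j, m, hm, rfl⟩ := Nat.exists_eq_pow_mul_and_not_dvd hk p hp.ne_one
  have hp0 := hp.pos
  match j with
  | 0 =>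
    have h2 : ¬ p ^ 2 ∣ m := fun h => hm (dvd_trans (dvd_pow_self p two_ne_zero) h)
    simp only [pow_zero, one_mul, hm, h2, if_false]
    unfold ft
    rw [rough_succ_of_not_dvd hpn hm]; simp
  | 1 =>
    have h2 : ¬ p ^ 2 ∣ p ^ 1 * m := by
      rw [pow_one, pow_two]; intro h; exact hm (Nat.dvd_of_mul_dvd_mul_left hp0 h)
    have h1 : p ∣ p ^ 1 * m := by simp
    have h3 : ¬ Rough (n+1) (p ^ 1 * m) := fun h => by
      have := h p hp h1; omega
    have h4 : p ^ 1 * m / p = m := by rw [pow_one]; exact Nat.mul_div_cancel_left _ hp0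
    rw [if_pos h1, if_neg h2, ft_pow_mul n 1 hp hpn hm, h4]
    unfold ft; rw [if_neg h3]; push_cast; ring
  | (i + 2) =>
    have h1 : p ∣ p ^ (i + 2) * m := Dvd.dvd.mul_right (dvd_pow_self p (by omega)) _
    have h2 : p ^ 2 ∣ p ^ (i + 2) * m := Dvd.dvd.mul_right (pow_dvd_pow p (by omega)) _
    have h3 : ¬ Rough (n+1) (p ^ (i + 2) * m) := fun h => by
      have := h p hp h1; omega
    have h4 : p ^ (i + 2) * m / p = p ^ (i + 1) * m :=
      Nat.div_eq_of_eq_mul_left hp0 (by ring)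
    have h5 : p ^ (i + 2) * m / p ^ 2 = p ^ i * m :=
      Nat.div_eq_of_eq_mul_left (by positivity) (by ring)
    rw [if_pos h1, if_pos h2, h4, h5, ft_pow_mul n _ hp hpn hm, ft_pow_mul n _ hp hpn hm,
      ft_pow_mul n _ hp hpn hm]
    unfold ft; rw [if_neg h3]; push_cast; ring

lemma sum_dvd_div (g : ℕ → ℝ) (N d : ℕ) (hd : 0 < d) :
    ∑ k ∈ Finset.Icc 1 N, (if d ∣ k then g (k / d) else 0) = ∑ m ∈ Finset.Icc 1 (N / d), g m := by
  rw [← Finset.sum_filter]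
  refine Finset.sum_nbij' (fun k => k / d) (fun m => m * d) ?_ ?_ ?_ ?_ ?_
  · intro k hk
    simp only [Finset.mem_filter, Finset.mem_Icc] at hk ⊢
    exact ⟨Nat.div_pos (Nat.le_of_dvd (by omega) hk.2) hd, Nat.div_le_div_right hk.1.2⟩
  · intro m hm
    simp only [Finset.mem_filter, Finset.mem_Icc] at hm ⊢
    exact ⟨⟨Nat.mul_pos (by omega) hd, (Nat.le_div_iff_mul_le hd).1 hm.2⟩, Dvd.intro_left m rfl⟩
  · intro k hk
    simp only [Finset.mem_filter] at hk
    exact Nat.div_mul_cancel hk.2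
  · intro m hm
    exact Nat.mul_div_cancel _ hd
  · intro k hk; rfl

lemma TT_succ {p : ℕ} (n N : ℕ) (hp : p.Prime) (hpn : p = n + 1) :
    TT (n + 1) N = TT n N - 2 * TT n (N / p) + TT n (N / p ^ 2) := by
  unfold TT
  rw [← sum_dvd_div (ft n) N p hp.pos, ← sum_dvd_div (ft n) N (p ^ 2) (pow_pos hp.pos 2),
    Finset.mul_sum, ← Finset.sum_sub_distrib, ← Finset.sum_add_distrib]
  refine Finset.sum_congr rfl fun k hk => ?_
  exact ft_succ n k hp hpn (by simp at hk; omega)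

lemma filter_succ_prime {n : ℕ} (hp : (n + 1).Prime) :
    (Finset.range (n + 1 + 1)).filter Nat.Prime
      = insert (n + 1) ((Finset.range (n + 1)).filter Nat.Prime) := by
  rw [Finset.range_add_one, Finset.filter_insert, if_pos hp]

lemma filter_succ_not_prime {n : ℕ} (hp : ¬ (n + 1).Prime) :
    (Finset.range (n + 1 + 1)).filter Nat.Prime = ((Finset.range (n + 1)).filter Nat.Prime) := by
  rw [Finset.range_add_one, Finset.filter_insert, if_neg hp]

lemma VV_succ {n : ℕ} (hp : (n + 1).Prime) : VV (n + 1) = (1 - 1 / ((n + 1 : ℕ) : ℝ)) * VV n := by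
  unfold VV; rw [filter_succ_prime hp, Finset.prod_insert (by simp)]

lemma LL_succ {n : ℕ} (hp : (n + 1).Prime) :
    LL (n + 1) = Real.log ((n + 1 : ℕ) : ℝ) / (((n + 1 : ℕ) : ℝ) - 1) + LL n := by
  unfold LL; rw [filter_succ_prime hp, Finset.sum_insert (by simp)]

lemma EE_succ {n : ℕ} (hp : (n + 1).Prime) {x : ℝ} (hx : 0 < x) :
    EE (n + 1) x = EE n x - 2 * EE n (x / ((n + 1 : ℕ) : ℝ))
      + EE n (x / ((n + 1 : ℕ) : ℝ) ^ 2) := by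
  have h1 := TT_succ n ⌊x⌋₊ hp rfl
  unfold EE
  have e1 : ⌊x / ((n + 1 : ℕ) : ℝ)⌋₊ = ⌊x⌋₊ / (n + 1) := Nat.floor_div_natCast x (n + 1)
  have e2 : ⌊x / ((n + 1 : ℕ) : ℝ) ^ 2⌋₊ = ⌊x⌋₊ / (n + 1) ^ 2 := by
    have := Nat.floor_div_natCast x ((n + 1) ^ 2)
    push_cast at this ⊢
    exact this
  rw [e1, e2, h1]
  unfold MM
  rw [VV_succ hp, LL_succ hp]
  have hp1 : (1 : ℝ) < ((n + 1 : ℕ) : ℝ) := by exact_mod_cast hp.one_lt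
  set P : ℝ := ((n + 1 : ℕ) : ℝ) with hP
  have hP0 : P ≠ 0 := by linarith
  have hP1 : P - 1 ≠ 0 := by linarith
  rw [Real.log_div hx.ne' hP0, Real.log_div hx.ne' (pow_ne_zero 2 hP0), Real.log_pow]
  field_simp
  push_cast
  ring

lemma ft_succ_not_prime {n : ℕ} (hp : ¬ (n + 1).Prime) (k : ℕ) : ft (n + 1) k = ft n k := by
  have : Rough (n + 1) k ↔ Rough n k := by
    constructor
    · intro h q hq hqm
      have := h q hq hqm
      omega
    · intro h q hq hqm
      have := h q hq hqm
      have : q ≠ n + 1 := by rintro rfl; exact hp hq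
      omega
  unfold ft; rw [this]

lemma EE_succ' {n : ℕ} (hp : ¬ (n + 1).Prime) (x : ℝ) : EE (n + 1) x = EE n x := by
  unfold EE TT MM VV LL
  rw [filter_succ_not_prime hp]
  simp only [ft_succ_not_prime hp]

/-- telescoped version -/
lemma EE_telescope {m n : ℕ} (h : m ≤ n) {x : ℝ} (hx : 0 < x) :
    EE n x = EE m x - ∑ p ∈ (Finset.Ioc m n).filter Nat.Prime,
      (2 * EE (p - 1) (x / (p : ℝ)) - EE (p - 1) (x / (p : ℝ) ^ 2)) := by
  induction n, h using Nat.le_induction with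
  | base => simp
  | succ n hmn ih =>
    have : Finset.Ioc m (n + 1) = insert (n + 1) (Finset.Ioc m n) := by
      ext a; simp; omega
    rw [this, Finset.filter_insert]
    by_cases hp : (n + 1).Prime
    · rw [if_pos hp, Finset.sum_insert (by simp), EE_succ hp hx, ih]
      simp only [Nat.add_sub_cancel]
      ring
    · rw [if_neg hp, EE_succ' hp, ih]

lemma VV_pos (n : ℕ) : 0 < VV n := by
  unfold VV
  refine Finset.prod_pos fun p hp => ?_
  simp only [Finset.mem_filter] at hp
  have : (1 : ℝ) < p := by exact_mod_cast hp.2.one_lt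
  have : 1 / (p : ℝ) < 1 := by rw [div_lt_one (by linarith)]; exact this
  linarith

lemma VV_zero : VV 0 = 1 := by
  unfold VV; simp [Finset.filter_singleton, Nat.not_prime_zero]

lemma LL_zero : LL 0 = 0 := by
  unfold LL; simp [Finset.filter_singleton, Nat.not_prime_zero]

abbrev PR (n : ℕ) : Finset ℕ := (Finset.range (n + 1)).filter Nat.Prime

noncomputable def PP (n : ℕ) : ℝ := ∑ p ∈ PR n, Real.log p / (p : ℝ)

lemma log_fact_eq (N : ℕ) :
    Real.log (N.factorial : ℝ) = ∑ p ∈ PR N, (N.factorial.factorization p : ℝ) * Real.log p := by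
  rw [Real.log_nat_eq_sum_factorization, Finsupp.sum]
  refine Finset.sum_subset ?_ ?_
  · intro p hp
    have h1 : p.Prime := Nat.prime_of_mem_primeFactors hp
    have h2 : p ∣ N.factorial := Nat.dvd_of_mem_primeFactors hp
    simp only [PR, Finset.mem_filter, Finset.mem_range]
    exact ⟨Nat.lt_succ_of_le ((h1.dvd_factorial).1 h2), h1⟩
  · intro p _ hp
    rw [Finsupp.notMem_support_iff] at hp
    simp [hp]

lemma log_fact_lower (N : ℕ) : (N : ℝ) * Real.log N - N ≤ Real.log (N.factorial : ℝ) := by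
  rcases Nat.eq_zero_or_pos N with rfl | hN
  · simp
  have h := Real.pow_div_factorial_le_exp (N : ℝ) (Nat.cast_nonneg N) N
  have hf : (0 : ℝ) < N.factorial := by exact_mod_cast N.factorial_pos
  have hN' : (0 : ℝ) < N := by exact_mod_cast hN
  have h2 := Real.log_le_log (by positivity) h
  rw [Real.log_div (by positivity) hf.ne', Real.log_pow, Real.log_exp] at h2
  linarith

lemma log_fact_upper (N : ℕ) : Real.log (N.factorial : ℝ) ≤ (N : ℝ) * Real.log N := by
  rcases Nat.eq_zero_or_pos N with rfl | hN
  · simp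
  have hf : (0 : ℝ) < N.factorial := by exact_mod_cast N.factorial_pos
  rw [← Real.log_pow]
  exact Real.log_le_log hf (by exact_mod_cast Nat.factorial_le_pow N)

lemma prime_gt_one {p n : ℕ} (hp : p ∈ PR n) : (2 : ℝ) ≤ p := by
  simp only [PR, Finset.mem_filter] at hp
  exact_mod_cast hp.2.two_le

lemma LL_lower {N : ℕ} (hN : 1 ≤ N) : Real.log N - 1 ≤ LL N := by
  have hN' : (0 : ℝ) < N := by exact_mod_cast hN
  have h : Real.log (N.factorial : ℝ) ≤ N * LL N := by
    rw [log_fact_eq, LL, Finset.mul_sum]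
    refine Finset.sum_le_sum fun p hp => ?_
    have hp2 := prime_gt_one hp
    have hpp : p.Prime := (Finset.mem_filter.1 hp).2
    have := Fact.mk hpp
    have h1 := sub_one_mul_padicValNat_factorial (p := p) N
    rw [Nat.factorization_def _ hpp]
    have h2 : (p - 1) * padicValNat p N.factorial ≤ N := by omega
    have h3 : ((p : ℝ) - 1) * (padicValNat p N.factorial : ℝ) ≤ N := by
      have : (((p - 1) * padicValNat p N.factorial : ℕ) : ℝ) ≤ N := by exact_mod_cast h2
      rw [Nat.cast_mul, Nat.cast_sub hpp.one_lt.le] at this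
      simpa using this
    have hl : 0 ≤ Real.log p := Real.log_nonneg (by linarith)
    rw [mul_div_assoc', le_div_iff₀ (by linarith)]
    nlinarith
  have h2 := log_fact_lower N
  have : N * (Real.log N - 1) ≤ N * LL N := by linarith
  exact le_of_mul_le_mul_left this hN'

lemma PP_upper {N : ℕ} (hN : 1 ≤ N) : PP N ≤ Real.log N + Real.log 4 := by
  have hN' : (0 : ℝ) < N := by exact_mod_cast hN
  have h : N * PP N - Real.log 4 * N ≤ Real.log (N.factorial : ℝ) := by
    have ht := Chebyshev.theta_le_log4_mul_x hN'.le
    rw [Chebyshev.theta_eq_sum_Icc] at ht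
    have e : (Finset.Icc 0 ⌊(N : ℝ)⌋₊).filter Nat.Prime = PR N := by
      rw [Nat.floor_natCast]; ext a; simp [PR, Nat.lt_succ_iff]
    rw [e] at ht
    suffices h : N * PP N - ∑ p ∈ PR N, Real.log p ≤ Real.log (N.factorial : ℝ) by linarith
    rw [log_fact_eq, PP, Finset.mul_sum, ← Finset.sum_sub_distrib]
    refine Finset.sum_le_sum fun p hp => ?_
    have hp2 := prime_gt_one hp
    have hpp : p.Prime := (Finset.mem_filter.1 hp).2
    have hl : 0 ≤ Real.log p := Real.log_nonneg (by linarith)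
    have h1 : N / p ≤ N.factorial.factorization p := by
      rw [Nat.factorization_factorial hpp (b := Nat.log p N + 2) (by omega)]
      have := Finset.single_le_sum (f := fun i => N / p ^ i) (s := Finset.Ico 1 (Nat.log p N + 2))
        (fun i _ => Nat.zero_le _) (a := 1) (by simp)
      simpa using this
    have h2 : (N : ℝ) / p - 1 ≤ (N / p : ℕ) := by
      have := Nat.lt_floor_add_one ((N : ℝ) / p)
      rw [Nat.floor_div_eq_div] at this
      linarith
    have h3 : (N : ℝ) / p - 1 ≤ (N.factorial.factorization p : ℝ) :=
      h2.trans (by exact_mod_cast h1)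
    calc (N : ℝ) * (Real.log p / p) - Real.log p = ((N : ℝ) / p - 1) * Real.log p := by ring
      _ ≤ _ := mul_le_mul_of_nonneg_right h3 hl
  have h2 := log_fact_upper N
  have : N * PP N ≤ N * (Real.log N + Real.log 4) := by linarith
  exact le_of_mul_le_mul_left this hN'

lemma LL_sub_PP : ∃ C : ℝ, 0 ≤ C ∧ ∀ n, LL n ≤ PP n + C := by
  have hs : Summable (fun k : ℕ => 4 * (1 / (k : ℝ) ^ (3 / 2 : ℝ))) :=
    (Real.summable_one_div_nat_rpow.2 (by norm_num)).mul_left 4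
  refine ⟨∑' k : ℕ, 4 * (1 / (k : ℝ) ^ (3 / 2 : ℝ)), tsum_nonneg fun k => by positivity, fun n => ?_⟩
  have h1 : LL n - PP n ≤ ∑ k ∈ PR n, 4 * (1 / (k : ℝ) ^ (3 / 2 : ℝ)) := by
    rw [LL, PP, ← Finset.sum_sub_distrib]
    refine Finset.sum_le_sum fun p hp => ?_
    have hp2 := prime_gt_one hp
    have hp0 : (0 : ℝ) < p := by linarith
    have hlog : Real.log p ≤ 2 * (p : ℝ) ^ (1 / 2 : ℝ) := by
      have := Real.log_le_rpow_div hp0.le (ε := 1 / 2) (by norm_num)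
      linarith
    have e : (p : ℝ) ^ (3 / 2 : ℝ) * (p : ℝ) ^ (1 / 2 : ℝ) = p * p := by
      rw [← Real.rpow_add hp0]; norm_num [sq]
    set a := (p : ℝ) ^ (3 / 2 : ℝ)
    set b := (p : ℝ) ^ (1 / 2 : ℝ)
    have ha : 0 < a := Real.rpow_pos_of_pos hp0 _
    have e1 : Real.log p / ((p : ℝ) - 1) - Real.log p / p = Real.log p / (((p : ℝ) - 1) * p) := by
      have : (p : ℝ) - 1 ≠ 0 := by linarith
      field_simp; ring
    rw [e1, mul_one_div, div_le_div_iff₀ (by nlinarith) ha]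
    calc Real.log p * a ≤ 2 * b * a := mul_le_mul_of_nonneg_right hlog ha.le
      _ = 2 * (p * p) := by rw [← e]; ring
      _ ≤ 4 * (((p : ℝ) - 1) * p) := by nlinarith
  have h2 := hs.sum_le_tsum (PR n) (fun k _ => by positivity)
  linarith

noncomputable def RP (n : ℕ) : ℝ := ∑ p ∈ PR n, 1 / (p : ℝ)

lemma RP_upper : ∃ C : ℝ, 0 ≤ C ∧ ∀ n : ℕ, 2 ≤ n → RP n ≤ Real.log (Real.log n) + C := by
  set c := Real.log 4
  have hc : 0 ≤ c := Real.log_nonneg (by norm_num)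
  have hl2 : 0 < Real.log 2 := Real.log_pos (by norm_num)
  -- Q n = RP n - PP n / log n
  have key : ∀ n : ℕ, 2 ≤ n → RP n - PP n / Real.log n ≤
      Real.log (Real.log n) - c / Real.log n + (c / Real.log 2 - Real.log (Real.log 2)) := by
    intro n hn
    induction n, hn using Nat.le_induction with
    | base =>
      have e : PR 2 = {2} := by decide
      simp only [RP, PP, e, Finset.sum_singleton, Nat.cast_ofNat]
      have : Real.log 2 / 2 / Real.log 2 = 1 / 2 := by field_simp
      rw [this]; linarith
    | succ n hn ih =>
      have hn2 : (2 : ℝ) ≤ n := by exact_mod_cast hn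
      have hl : 0 < Real.log n := Real.log_pos (by linarith)
      have hll : Real.log n < Real.log ((n + 1 : ℕ) : ℝ) := by
        apply Real.log_lt_log (by linarith); push_cast; linarith
      set a := Real.log n
      set b := Real.log ((n + 1 : ℕ) : ℝ)
      have hb : 0 < b := hl.trans hll
      have step : RP (n + 1) - PP (n + 1) / b = RP n - PP n / a + PP n * (1 / a - 1 / b) := by
        unfold RP PP
        by_cases hp : (n + 1).Prime
        · simp only [PR]
          rw [filter_succ_prime hp, Finset.sum_insert (by simp), Finset.sum_insert (by simp)]
          have : ((n + 1 : ℕ) : ℝ) ≠ 0 := by positivity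
          field_simp
          simp only [b]
          ring
        · simp only [PR]
          rw [filter_succ_not_prime hp]; ring
      have hP : PP n ≤ a + c := PP_upper (by omega)
      have hab : 0 ≤ 1 / a - 1 / b := by
        rw [sub_nonneg]; exact one_div_le_one_div_of_le hl hll.le
      have h1 : PP n * (1 / a - 1 / b) ≤ (a + c) * (1 / a - 1 / b) :=
        mul_le_mul_of_nonneg_right hP hab
      have h2 : 1 - a / b ≤ Real.log b - Real.log a := by
        have := Real.one_sub_inv_le_log_of_pos (x := b / a) (by positivity)
        rw [Real.log_div hb.ne' hl.ne', inv_div] at this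
        exact this
      have h3 : (a + c) * (1 / a - 1 / b) = (1 - a / b) + c / a - c / b := by
        field_simp; ring
      rw [step]
      linarith
  refine ⟨1 + c / Real.log 2 + |(c / Real.log 2 - Real.log (Real.log 2))|, by positivity, fun n hn => ?_⟩
  have hn2 : (2 : ℝ) ≤ n := by exact_mod_cast hn
  have hl : 0 < Real.log n := Real.log_pos (by linarith)
  have h1 := key n hn
  have h2 : PP n / Real.log n ≤ 1 + c / Real.log n := by
    rw [div_le_iff₀ hl, add_mul, div_mul_cancel₀ _ hl.ne', one_mul]
    exact PP_upper (by omega)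
  have h3 := le_abs_self (c / Real.log 2 - Real.log (Real.log 2))
  have h4 : 0 ≤ c / Real.log 2 := by positivity
  linarith

lemma sum_inv_le_prod (s : Finset ℕ) (hs : ∀ p ∈ s, p.Prime) (A : Finset ℕ)
    (hA : ∀ k ∈ A, k ∈ Nat.factoredNumbers s) :
    ∑ k ∈ A, 1 / (k : ℝ) ≤ ∏ p ∈ s, (1 - 1 / (p : ℝ))⁻¹ := by
  let f : ℕ →* ℝ := ⟨⟨fun k => 1 / (k : ℝ), by simp⟩, fun a b => by simp [mul_comm]⟩
  have h := EulerProduct.summable_and_hasSum_factoredNumbers_prod_filter_prime_geometric (f := f)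
    (fun {p} hp => by
      have : (1 : ℝ) < p := by exact_mod_cast hp.one_lt
      simp only [f, MonoidHom.coe_mk, OneHom.coe_mk, one_div, norm_inv, Real.norm_natCast]
      exact inv_lt_one_of_one_lt₀ this) s
  have e : s.filter Nat.Prime = s := Finset.filter_true_of_mem hs
  rw [e] at h
  have h2 := sum_le_hasSum (A.subtype (· ∈ Nat.factoredNumbers s))
    (fun m _ => by simp [f]) h.2
  refine le_trans (le_of_eq ?_) h2
  rw [Finset.sum_subtype_of_mem (f := fun k => f k) hA]
  rfl

lemma VV_upper {n : ℕ} (hn : 1 ≤ n) : VV n * Real.log n ≤ 1 := by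
  have h := sum_inv_le_prod (PR n) (fun p hp => (Finset.mem_filter.1 hp).2) (Finset.Icc 1 n) (by
    intro k hk
    simp only [Finset.mem_Icc] at hk
    rw [Nat.mem_factoredNumbers']
    intro p hp hpk
    simp only [PR, Finset.mem_filter, Finset.mem_range]
    exact ⟨Nat.lt_succ_of_le ((Nat.le_of_dvd (by omega) hpk).trans hk.2), hp⟩)
  rw [Finset.prod_inv_distrib] at h
  have h1 : Real.log n ≤ ∑ k ∈ Finset.Icc 1 n, 1 / (k : ℝ) := by
    have := log_le_harmonic_floor n (Nat.cast_nonneg n)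
    rw [Nat.floor_natCast, harmonic_eq_sum_Icc] at this
    push_cast at this
    simpa using this
  have hV := VV_pos n
  have h2 : Real.log n ≤ (VV n)⁻¹ := h1.trans h
  calc VV n * Real.log n ≤ VV n * (VV n)⁻¹ := by gcongr
    _ = 1 := mul_inv_cancel₀ hV.ne'

lemma exp_RP_upper : ∃ C : ℝ, 0 < C ∧ ∀ n : ℕ, 2 ≤ n → Real.exp (RP n) ≤ C * Real.log n := by
  obtain ⟨C, _, h⟩ := RP_upper
  refine ⟨Real.exp C, Real.exp_pos _, fun n hn => ?_⟩
  have hn2 : (2 : ℝ) ≤ n := by exact_mod_cast hn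
  have hl : 0 < Real.log n := Real.log_pos (by linarith)
  calc Real.exp (RP n) ≤ Real.exp (Real.log (Real.log n) + C) := Real.exp_le_exp.2 (h n hn)
    _ = _ := by rw [Real.exp_add, Real.exp_log hl, mul_comm]

lemma VV_lower : ∃ C : ℝ, 0 < C ∧ ∀ n : ℕ, 2 ≤ n → (VV n)⁻¹ ≤ C * Real.log n := by
  obtain ⟨C, hC, h⟩ := exp_RP_upper
  have hs : Summable (fun k : ℕ => 2 * (1 / (k : ℝ) ^ 2)) :=
    (Real.summable_one_div_nat_pow.2 (by norm_num)).mul_left 2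
  refine ⟨Real.exp (∑' k : ℕ, 2 * (1 / (k : ℝ) ^ 2)) * C, by positivity, fun n hn => ?_⟩
  have h2 := hs.sum_le_tsum (PR n) (fun k _ => by positivity)
  have h1 : (VV n)⁻¹ ≤ Real.exp (∑ k ∈ PR n, 2 * (1 / (k : ℝ) ^ 2)) * Real.exp (RP n) := by
    rw [VV, ← Finset.prod_inv_distrib, RP, ← Real.exp_add, ← Finset.sum_add_distrib, Real.exp_sum]
    refine Finset.prod_le_prod ?_ ?_
    · intro p hp
      have hp2 := prime_gt_one hp
      rw [inv_nonneg, sub_nonneg, div_le_one (by linarith)]; linarith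
    · intro p hp
      have hp2 := prime_gt_one hp
      have e : (1 - 1 / (p : ℝ))⁻¹ = 1 / ((p : ℝ) - 1) + 1 := by
        have : (p : ℝ) - 1 ≠ 0 := by linarith
        have : (p : ℝ) ≠ 0 := by linarith
        field_simp; ring
      rw [e]
      refine (Real.add_one_le_exp _).trans (Real.exp_le_exp.2 ?_)
      have e2 : 2 * (1 / (p : ℝ) ^ 2) + 1 / p = (2 + p) / (p : ℝ) ^ 2 := by
        have : (p : ℝ) ≠ 0 := by linarith
        field_simp
      rw [e2, div_le_div_iff₀ (by linarith) (by positivity)]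
      nlinarith
  calc (VV n)⁻¹ ≤ _ := h1
    _ ≤ Real.exp (∑' k : ℕ, 2 * (1 / (k : ℝ) ^ 2)) * (C * Real.log n) := by
        gcongr
        exact h n hn
    _ = _ := by ring

lemma LL_abs : ∃ C : ℝ, 0 ≤ C ∧ ∀ n : ℕ, 1 ≤ n → |LL n - Real.log n| ≤ C := by
  obtain ⟨C, hC, h⟩ := LL_sub_PP
  refine ⟨1 + C + Real.log 4, by have := Real.log_nonneg (show (1:ℝ) ≤ 4 by norm_num); linarith, fun n hn => ?_⟩
  have h1 := h n
  have h2 := PP_upper hn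
  have h3 := LL_lower hn
  have := Real.log_nonneg (show (1:ℝ) ≤ 4 by norm_num)
  rw [abs_le]; constructor <;> linarith

lemma PP_lower : ∃ C : ℝ, 0 ≤ C ∧ ∀ n : ℕ, 1 ≤ n → Real.log n - C ≤ PP n := by
  obtain ⟨C, hC, h⟩ := LL_sub_PP
  refine ⟨1 + C, by linarith, fun n hn => ?_⟩
  have h1 := h n
  have h3 := LL_lower hn
  linarith

/-- short prime sums -/
lemma short_prime_sum : ∃ C : ℝ, 0 ≤ C ∧ ∀ (z : ℝ) (n : ℕ), 2 ≤ z → z ≤ n →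
    ∑ p ∈ (Finset.Ioc ⌊z⌋₊ n).filter Nat.Prime, 1 / (p : ℝ) ≤
      (Real.log n - Real.log z + C) / Real.log z := by
  obtain ⟨C, hC, h⟩ := PP_lower
  have h4 := Real.log_nonneg (show (1:ℝ) ≤ 4 by norm_num)
  have hl2 : 0 ≤ Real.log 2 := Real.log_nonneg (by norm_num)
  refine ⟨C + Real.log 4 + Real.log 2, by linarith, fun z n hz hzn => ?_⟩
  have hlz : 0 < Real.log z := Real.log_pos (by linarith)
  have hm : 1 ≤ ⌊z⌋₊ := Nat.one_le_floor_iff _ |>.2 (by linarith)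
  have hmn : ⌊z⌋₊ ≤ n := by
    have := Nat.floor_le_floor hzn
    rwa [Nat.floor_natCast] at this
  have h1 : ∑ p ∈ (Finset.Ioc ⌊z⌋₊ n).filter Nat.Prime, Real.log p / (p : ℝ) = PP n - PP ⌊z⌋₊ := by
    rw [eq_sub_iff_add_eq', PP, PP, ← Finset.sum_union]
    · refine Finset.sum_congr ?_ fun _ _ => rfl
      rw [← Finset.filter_union]
      congr 1
      ext a; simp; omega
    · rw [Finset.disjoint_left]
      intro a ha hb
      simp at ha hb; omega
  have h2 : Real.log z - Real.log 2 ≤ Real.log ⌊z⌋₊ := by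
    rw [← Real.log_div (by linarith) (by norm_num)]
    apply Real.log_le_log (by linarith)
    have := Nat.lt_floor_add_one z
    have : (1 : ℝ) ≤ ⌊z⌋₊ := by exact_mod_cast hm
    linarith
  rw [le_div_iff₀ hlz, Finset.sum_mul]
  calc _ ≤ ∑ p ∈ (Finset.Ioc ⌊z⌋₊ n).filter Nat.Prime, Real.log p / (p : ℝ) := by
        refine Finset.sum_le_sum fun p hp => ?_
        simp only [Finset.mem_filter, Finset.mem_Ioc] at hp
        have hzp : z < p := (Nat.floor_lt (by linarith)).1 hp.1.1
        have : Real.log z ≤ Real.log p := Real.log_le_log (by linarith) hzp.le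
        rw [one_div, inv_mul_eq_div]
        gcongr
    _ = PP n - PP ⌊z⌋₊ := h1
    _ ≤ _ := by
      have := h _ hm
      have := PP_upper (N := n) (by omega)
      linarith

lemma TT_zero (N : ℕ) : TT 0 N = ∑ a ∈ Finset.Icc 1 N, ((N / a : ℕ) : ℝ) := by
  have h1 : ∀ k ∈ Finset.Icc 1 N, ft 0 k = ∑ a ∈ Finset.Icc 1 N, (if a ∣ k then (1 : ℝ) else 0) := by
    intro k hk
    simp only [Finset.mem_Icc] at hk
    have hr : Rough 0 k := fun p hp _ => hp.pos
    unfold ft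
    rw [if_pos hr, Finset.sum_boole]
    congr 2
    ext a
    simp only [Nat.mem_divisors, Finset.mem_filter, Finset.mem_Icc]
    constructor
    · rintro ⟨h, h0⟩
      exact ⟨⟨Nat.pos_of_dvd_of_pos h (by omega), (Nat.le_of_dvd (by omega) h).trans hk.2⟩, h⟩
    · rintro ⟨_, h⟩
      exact ⟨h, by omega⟩
  rw [TT, Finset.sum_congr rfl h1, Finset.sum_comm]
  refine Finset.sum_congr rfl fun a ha => ?_
  rw [sum_dvd_div (fun _ => 1) N a (by simp at ha; omega)]
  simp

lemma hyperbola (N s : ℕ) (h1 : s * s ≤ N) (h2 : N < (s + 1) * (s + 1)) :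
    ∑ a ∈ Finset.Icc 1 N, (N / a) + s * s = 2 * ∑ a ∈ Finset.Icc 1 s, (N / a) := by
  classical
  have hsN : s ≤ N := by nlinarith
  have count : ∀ a, 1 ≤ a → ((Finset.Icc 1 N).filter (fun b => a * b ≤ N)).card = N / a := by
    intro a ha
    have : (Finset.Icc 1 N).filter (fun b => a * b ≤ N) = Finset.Icc 1 (N / a) := by
      ext b
      simp only [Finset.mem_filter, Finset.mem_Icc, Nat.le_div_iff_mul_le ha]
      constructor
      · rintro ⟨⟨h1, h2⟩, h3⟩; exact ⟨h1, by rwa [mul_comm]⟩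
      · rintro ⟨h1, h3⟩; refine ⟨⟨h1, by nlinarith⟩, by rwa [mul_comm]⟩
    rw [this]; simp
  let D := ((Finset.Icc 1 N) ×ˢ (Finset.Icc 1 N)).filter (fun q => q.1 * q.2 ≤ N)
  let A := ((Finset.Icc 1 s) ×ˢ (Finset.Icc 1 N)).filter (fun q => q.1 * q.2 ≤ N)
  let B := ((Finset.Icc 1 N) ×ˢ (Finset.Icc 1 s)).filter (fun q => q.1 * q.2 ≤ N)
  have hD : D.card = ∑ a ∈ Finset.Icc 1 N, (N / a) := by
    simp only [D, Finset.card_filter, Finset.sum_product]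
    refine Finset.sum_congr rfl fun a ha => ?_
    rw [← Finset.card_filter]
    exact count a (by simp at ha; omega)
  have hA : A.card = ∑ a ∈ Finset.Icc 1 s, (N / a) := by
    simp only [A, Finset.card_filter, Finset.sum_product]
    refine Finset.sum_congr rfl fun a ha => ?_
    rw [← Finset.card_filter]
    exact count a (by simp at ha; omega)
  have hB : B.card = ∑ a ∈ Finset.Icc 1 s, (N / a) := by
    simp only [B, Finset.card_filter, Finset.sum_product_right]
    refine Finset.sum_congr rfl fun a ha => ?_
    rw [← Finset.card_filter]
    rw [← count a (by simp at ha; omega)]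
    simp only [mul_comm]
  have hU : A ∪ B = D := by
    ext ⟨a, b⟩
    simp only [A, B, D, Finset.mem_union, Finset.mem_filter, Finset.mem_product, Finset.mem_Icc]
    constructor
    · rintro (h | h) <;> refine ⟨⟨⟨?_, ?_⟩, ?_, ?_⟩, ?_⟩ <;> omega
    · rintro ⟨h, h'⟩
      by_cases hs : a ≤ s
      · left; exact ⟨⟨⟨h.1.1, hs⟩, h.2⟩, h'⟩
      · right
        refine ⟨⟨h.1, h.2.1, ?_⟩, h'⟩
        by_contra hb
        have : (s + 1) * (s + 1) ≤ a * b := Nat.mul_le_mul (by omega) (by omega)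
        omega
  have hI : A ∩ B = (Finset.Icc 1 s) ×ˢ (Finset.Icc 1 s) := by
    ext ⟨a, b⟩
    simp only [A, B, Finset.mem_inter, Finset.mem_filter, Finset.mem_product, Finset.mem_Icc]
    constructor
    · rintro ⟨h, h'⟩; omega
    · rintro ⟨h, h'⟩
      have : a * b ≤ s * s := Nat.mul_le_mul h.2 h'.2
      refine ⟨⟨⟨?_, ?_⟩, ?_⟩, ⟨?_, ?_⟩, ?_⟩ <;> omega
  have := Finset.card_union_add_card_inter A B
  rw [hU, hI, hD, hA, hB, Finset.card_product] at this
  simp at this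
  omega

lemma harmonic_bd {s : ℕ} (hs : 1 ≤ s) :
    |∑ a ∈ Finset.Icc 1 s, 1 / (a : ℝ) - Real.log s - Real.eulerMascheroniConstant| ≤ 1 / s := by
  have h1 := Real.eulerMascheroniSeq_lt_eulerMascheroniConstant s
  have h2 := Real.eulerMascheroniConstant_lt_eulerMascheroniSeq' s
  have e : ∑ a ∈ Finset.Icc 1 s, 1 / (a : ℝ) = (harmonic s : ℝ) := by
    rw [harmonic_eq_sum_Icc]; push_cast; simp
  have hs0 : (0 : ℝ) < s := by exact_mod_cast hs
  unfold Real.eulerMascheroniSeq at h1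
  unfold Real.eulerMascheroniSeq' at h2
  rw [if_neg (by omega)] at h2
  have h3 : Real.log (s + 1) ≤ Real.log s + 1 / s := by
    have : Real.log ((s + 1) / s) ≤ (s + 1) / s - 1 := Real.log_le_sub_one_of_pos (by positivity)
    rw [Real.log_div (by positivity) hs0.ne'] at this
    have e : ((s : ℝ) + 1) / s - 1 = 1 / s := by field_simp; ring
    linarith
  rw [e, abs_le]
  have : 0 < 1 / (s : ℝ) := by positivity
  constructor <;> linarith

lemma EE_zero_bd_ge {x : ℝ} (hx : 1 ≤ x) : |EE 0 x| ≤ 40 * x ^ (1 / 2 : ℝ) := by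
  set N := ⌊x⌋₊ with hN
  set s := Nat.sqrt N with hs
  have hN1 : 1 ≤ N := Nat.one_le_floor_iff _ |>.2 hx
  have hs1 : 1 ≤ s := by
    rw [hs, Nat.le_sqrt]; omega
  have h1 : s * s ≤ N := Nat.sqrt_le N
  have h2 : N < (s + 1) * (s + 1) := Nat.lt_succ_sqrt N
  have hh := hyperbola N s h1 h2
  have hT : TT 0 N = 2 * ∑ a ∈ Finset.Icc 1 s, ((N / a : ℕ) : ℝ) - s * s := by
    rw [TT_zero]
    have : ((∑ a ∈ Finset.Icc 1 N, (N / a) + s * s : ℕ) : ℝ)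
        = ((2 * ∑ a ∈ Finset.Icc 1 s, (N / a) : ℕ) : ℝ) := by rw [hh]
    push_cast at this
    linarith
  have hs1' : (1 : ℝ) ≤ s := by exact_mod_cast hs1
  have hsx : (s : ℝ) * s ≤ x := by
    have : ((s * s : ℕ) : ℝ) ≤ N := by exact_mod_cast h1
    push_cast at this
    exact this.trans (Nat.floor_le (by linarith))
  have hxs : x < ((s : ℝ) + 1) * (s + 1) := by
    have := (Nat.floor_lt (by linarith : (0:ℝ) ≤ x)).1 h2
    push_cast at this
    exact this
  have hssq : (s : ℝ) ≤ x ^ (1 / 2 : ℝ) := by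
    rw [← Real.sqrt_eq_rpow]
    exact Real.le_sqrt_of_sq_le (by nlinarith)
  -- sum of floors
  have hsum1 : ∑ a ∈ Finset.Icc 1 s, ((N / a : ℕ) : ℝ) ≤ x * ∑ a ∈ Finset.Icc 1 s, 1 / (a : ℝ) := by
    rw [Finset.mul_sum]
    refine Finset.sum_le_sum fun a ha => ?_
    rw [← Nat.floor_div_natCast, mul_one_div]
    exact Nat.floor_le (by positivity)
  have hsum2 : x * ∑ a ∈ Finset.Icc 1 s, 1 / (a : ℝ) - s ≤ ∑ a ∈ Finset.Icc 1 s, ((N / a : ℕ) : ℝ) := by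
    have : (s : ℝ) = ∑ a ∈ Finset.Icc 1 s, (1 : ℝ) := by simp
    rw [Finset.mul_sum]
    conv_lhs => rw [this]
    rw [← Finset.sum_sub_distrib]
    refine Finset.sum_le_sum fun a ha => ?_
    rw [← Nat.floor_div_natCast, mul_one_div]
    have := Nat.lt_floor_add_one (x / a)
    linarith
  have hH := harmonic_bd hs1
  set H := ∑ a ∈ Finset.Icc 1 s, 1 / (a : ℝ)
  set F := ∑ a ∈ Finset.Icc 1 s, ((N / a : ℕ) : ℝ)
  have hl1 : 2 * Real.log s ≤ Real.log x := by
    have := Real.log_le_log (by positivity) hsx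
    rw [Real.log_mul (by positivity) (by positivity)] at this
    linarith
  have hl2 : Real.log x ≤ 2 * Real.log s + 2 / s := by
    have h := Real.log_le_log (by linarith) hxs.le
    rw [Real.log_mul (by positivity) (by positivity)] at h
    have h3 : Real.log (s + 1) ≤ Real.log s + 1 / s := by
      have : Real.log ((s + 1) / s) ≤ (s + 1) / s - 1 := Real.log_le_sub_one_of_pos (by positivity)
      rw [Real.log_div (by positivity) (by positivity)] at this
      have e : ((s : ℝ) + 1) / s - 1 = 1 / s := by field_simp; ring
      linarith
    have e2 : (2 : ℝ) / s = 1 / s + 1 / s := by ring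
    linarith
  have hEE : EE 0 x = 2 * F - s * s - x * (Real.log x + (2 * Real.eulerMascheroniConstant - 1)) := by
    unfold EE MM
    rw [← hN, hT, VV_zero, LL_zero]; ring
  rw [hEE]
  rw [abs_le] at hH
  obtain ⟨hHa, hHb⟩ := hH
  set g := Real.eulerMascheroniConstant
  have hxd : x * (1 / s) ≤ 4 * s := by
    rw [mul_one_div, div_le_iff₀ (by positivity)]; nlinarith
  have hx0 : 0 < x := by linarith
  have i1 : x * H ≤ x * (Real.log x / 2 + g) + x * (1 / s) := by
    have : H ≤ Real.log x / 2 + g + 1 / s := by linarith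
    nlinarith
  have i2 : x * (Real.log x / 2 + g) - 2 * (x * (1 / s)) ≤ x * H := by
    have e2 : (2 : ℝ) / s = 1 / s + 1 / s := by ring
    have : Real.log x / 2 + g - 2 * (1 / s) ≤ H := by linarith
    nlinarith
  have : |2 * F - s * s - x * (Real.log x + (2 * g - 1))| ≤ 40 * s := by
    rw [abs_le]
    constructor <;> nlinarith
  linarith

lemma EE_zero_bd {x β : ℝ} (hx : 0 < x) (hβ : 0 < β) (hβ2 : β ≤ 1 / 2) :
    |EE 0 x| ≤ 40 / β * x ^ (1 - β) := by
  rcases le_or_gt 1 x with h | h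
  · refine (EE_zero_bd_ge h).trans ?_
    have h1 : x ^ (1 / 2 : ℝ) ≤ x ^ (1 - β) := Real.rpow_le_rpow_of_exponent_le h (by linarith)
    have h2 : 40 ≤ 40 / β := by rw [le_div_iff₀ hβ]; linarith
    gcongr
  · have hf : ⌊x⌋₊ = 0 := Nat.floor_eq_zero.2 h
    unfold EE MM
    rw [hf, VV_zero, LL_zero]
    have hT : TT 0 0 = 0 := by unfold TT; simp
    rw [hT]
    set g := Real.eulerMascheroniConstant
    have g1 : 1 / 2 < g := Real.one_half_lt_eulerMascheroniConstant
    have g2 : g < 2 / 3 := Real.eulerMascheroniConstant_lt_two_thirds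
    have hl : Real.log x < 0 := Real.log_neg hx h
    have h1 : - Real.log x ≤ x ^ (-β) / β := by
      have := Real.log_le_rpow_div (x := x⁻¹) (by positivity) hβ
      rwa [Real.log_inv, Real.inv_rpow hx.le, ← Real.rpow_neg hx.le] at this
    have e : x ^ (1 - β) = x * x ^ (-β) := by
      rw [sub_eq_add_neg, Real.rpow_add hx, Real.rpow_one]
    have h3 : 1 ≤ x ^ (-β) := Real.one_le_rpow_of_pos_of_le_one_of_nonpos hx h.le (by linarith)
    have h4 : x ^ (-β) ≤ x ^ (-β) / β := by
      rw [le_div_iff₀ hβ]; nlinarith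
    have e2 : 40 / β * (x * x ^ (-β)) = x * (40 * (x ^ (-β) / β)) := by ring
    rw [e, e2]
    have : 0 - x * 1 ^ 2 * (Real.log x + (2 * g - 1) + 2 * 0) = x * (-Real.log x - (2 * g - 1)) := by ring
    rw [this, abs_mul, abs_of_pos hx]
    apply mul_le_mul_of_nonneg_left _ hx.le
    rw [abs_le]; constructor <;> linarith

lemma EE_rankin {β : ℝ} (hβ : 0 < β) (hβ2 : β ≤ 1 / 2) (n : ℕ) : ∀ x : ℝ, 0 < x →
    |EE n x| ≤ 40 / β * x ^ (1 - β) * (∏ p ∈ PR n, (1 + (p : ℝ) ^ (-(1 - β)))) ^ 2 := by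
  induction n with
  | zero =>
    intro x hx
    have : PR 0 = ∅ := by decide
    rw [this]; simpa using EE_zero_bd hx hβ hβ2
  | succ n ih =>
    intro x hx
    by_cases hp : (n + 1).Prime
    · rw [EE_succ hp hx]
      simp only [PR]
      rw [filter_succ_prime hp, Finset.prod_insert (by simp)]
      set P : ℝ := ((n + 1 : ℕ) : ℝ) with hP
      have hP0 : 0 < P := by positivity
      set W := (∏ p ∈ (Finset.range (n + 1)).filter Nat.Prime, (1 + (p : ℝ) ^ (-(1 - β))))
      have a1 := ih x hx
      have a2 := ih (x / P) (by positivity)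
      have a3 := ih (x / P ^ 2) (by positivity)
      have e1 : (x / P) ^ (1 - β) = x ^ (1 - β) * P ^ (-(1 - β)) := by
        rw [Real.div_rpow hx.le hP0.le, Real.rpow_neg hP0.le]; rfl
      have e2 : (x / P ^ 2) ^ (1 - β) = x ^ (1 - β) * P ^ (-(1 - β)) * P ^ (-(1 - β)) := by
        rw [Real.div_rpow hx.le (by positivity), Real.rpow_neg hP0.le, sq,
          Real.mul_rpow hP0.le hP0.le, div_eq_mul_inv, mul_inv, mul_assoc]
      rw [e1] at a2
      rw [e2] at a3
      set X := x ^ (1 - β)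
      set t := P ^ (-(1 - β))
      calc |EE n x - 2 * EE n (x / P) + EE n (x / P ^ 2)|
          ≤ |EE n x| + 2 * |EE n (x / P)| + |EE n (x / P ^ 2)| := by
            have h1 := abs_add_le (EE n x - 2 * EE n (x / P)) (EE n (x / P ^ 2))
            have h2 := abs_sub (EE n x) (2 * EE n (x / P))
            rw [abs_mul, abs_two] at h2
            linarith
        _ ≤ 40 / β * X * W ^ 2 + 2 * (40 / β * (X * t) * W ^ 2)
            + 40 / β * (X * t * t) * W ^ 2 := by linarith
        _ = 40 / β * X * ((1 + t) * W) ^ 2 := by ring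
    · rw [EE_succ' hp]
      simp only [PR]
      rw [filter_succ_not_prime hp]
      exact ih x hx

lemma rankin {c : ℝ} (hc : 0 < c) : ∃ C : ℝ, 0 < C ∧ ∀ n : ℕ, 2 ≤ n → 2 * c ≤ Real.log n →
    ∀ x : ℝ, 0 < x →
    |EE n x| ≤ C * x * Real.exp (-c * (Real.log x / Real.log n)) * Real.log n ^ 3 := by
  obtain ⟨C, hC, h⟩ := exp_RP_upper
  refine ⟨40 / c * C ^ 2 * Real.exp (2 * (Real.exp c * (3 * c))), by positivity, fun n hn hcn x hx => ?_⟩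
  have hn2 : (2 : ℝ) ≤ n := by exact_mod_cast hn
  have hl : 0 < Real.log n := Real.log_pos (by linarith)
  set l := Real.log n with hldef
  set β := c / l with hβdef
  have hβ : 0 < β := by positivity
  have hβl : β * l = c := by rw [hβdef]; field_simp
  have hβ2 : β ≤ 1 / 2 := by rw [hβdef, div_le_iff₀ hl]; linarith
  have h1 := EE_rankin hβ hβ2 n x hx
  have hprod : ∏ p ∈ PR n, (1 + (p : ℝ) ^ (-(1 - β))) ≤
      Real.exp (RP n) * Real.exp (Real.exp c * (3 * c)) := by
    calc ∏ p ∈ PR n, (1 + (p : ℝ) ^ (-(1 - β)))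
        ≤ ∏ p ∈ PR n, Real.exp (1 / (p : ℝ) + Real.exp c * β * (Real.log p / p)) := by
          refine Finset.prod_le_prod (fun p _ => by positivity) fun p hp => ?_
          have hp2 := prime_gt_one hp
          have hp0 : (0 : ℝ) < p := by linarith
          rw [add_comm]
          refine (Real.add_one_le_exp _).trans (Real.exp_le_exp.2 ?_)
          have hpn : (p : ℝ) ≤ n := by
            have := (Finset.mem_range.1 (Finset.mem_filter.1 hp).1)
            exact_mod_cast Nat.lt_succ_iff.1 this
          have hlp : Real.log p ≤ l := Real.log_le_log hp0 hpn
          have hlp0 : 0 ≤ Real.log p := Real.log_nonneg (by linarith)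
          set t := β * Real.log p with ht
          have ht0 : 0 ≤ t := by positivity
          have htc : t ≤ c := by rw [ht, ← hβl]; gcongr
          have e1 : (p : ℝ) ^ (-(1 - β)) = 1 / p * Real.exp t := by
            rw [show -(1 - β) = -1 + β by ring, Real.rpow_add hp0, Real.rpow_neg_one,
              Real.rpow_def_of_pos hp0, one_div, ht, mul_comm (Real.log p)]
          have e2 : Real.exp t ≤ 1 + t * Real.exp c := by
            have i1 := Real.add_one_le_exp (-t)
            have i2 : Real.exp t * Real.exp (-t) = 1 := by rw [← Real.exp_add]; simp
            have i3 : Real.exp t ≤ Real.exp c := Real.exp_le_exp.2 htc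
            have i4 := Real.exp_pos t
            nlinarith
          rw [e1]
          calc 1 / (p : ℝ) * Real.exp t ≤ 1 / (p : ℝ) * (1 + t * Real.exp c) := by gcongr
            _ = _ := by rw [ht]; ring
      _ = Real.exp (RP n + Real.exp c * β * PP n) := by
          rw [← Real.exp_sum, Finset.sum_add_distrib, ← Finset.mul_sum, RP, PP]
      _ ≤ Real.exp (RP n + Real.exp c * (3 * c)) := by
          apply Real.exp_le_exp.2
          have hPP := PP_upper (N := n) (by omega)
          have h4 : Real.log 4 ≤ 2 * l := by
            rw [show (4 : ℝ) = 2 ^ 2 by norm_num, Real.log_pow]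
            have := Real.log_le_log (by norm_num) hn2
            push_cast; linarith
          have : β * PP n ≤ 3 * c := by
            calc β * PP n ≤ β * (3 * l) := by gcongr; linarith
              _ = 3 * (β * l) := by ring
              _ = _ := by rw [hβl]
          have := mul_le_mul_of_nonneg_left this (Real.exp_pos c).le
          linarith
      _ = _ := by rw [Real.exp_add]
  have hx1 : x ^ (1 - β) = x * Real.exp (-c * (Real.log x / l)) := by
    rw [sub_eq_add_neg, Real.rpow_add hx, Real.rpow_one, Real.rpow_def_of_pos hx, hβdef]
    congr 2; ring
  have hb : 40 / β = 40 / c * l := by rw [hβdef]; field_simp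
  rw [hx1, hb] at h1
  have hprod0 : 0 ≤ ∏ p ∈ PR n, (1 + (p : ℝ) ^ (-(1 - β))) :=
    Finset.prod_nonneg fun p _ => by positivity
  calc |EE n x| ≤ _ := h1
    _ ≤ 40 / c * l * (x * Real.exp (-c * (Real.log x / l))) *
        (C * l * Real.exp (Real.exp c * (3 * c))) ^ 2 := by
        gcongr
        refine hprod.trans ?_
        gcongr
        exact h n hn
    _ = _ := by
      rw [mul_pow, ← Real.exp_nat_mul]; push_cast; ring

lemma card_div_le_two_pow {k : ℕ} (hk : k ≠ 0) :
    k.divisors.card ≤ 2 ^ (∑ p ∈ k.primeFactors, k.factorization p) := by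
  rw [Nat.card_divisors hk, ← Finset.prod_pow_eq_pow_sum]
  refine Finset.prod_le_prod' fun p _ => ?_
  exact Nat.lt_two_pow_self

lemma rough_pow_le {n k : ℕ} (hk : k ≠ 0) (h : Rough n k) :
    n ^ (∑ p ∈ k.primeFactors, k.factorization p) ≤ k := by
  conv_rhs => rw [← Nat.prod_factorization_pow_eq_self hk]
  rw [← Finset.prod_pow_eq_pow_sum, Finsupp.prod, Nat.support_factorization]
  refine Finset.prod_le_prod' fun p hp => ?_
  exact Nat.pow_le_pow_left (h p (Nat.prime_of_mem_primeFactors hp) (Nat.dvd_of_mem_primeFactors hp)).le _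

lemma card_div_rough_le {n k : ℕ} (hn : 2 ≤ n) (hk : k ≠ 0) (h : Rough n k) {B : ℕ}
    (hB : Real.log k ≤ B * Real.log n) : (k.divisors.card : ℝ) ≤ 2 ^ B := by
  have h1 := card_div_le_two_pow hk
  have h2 := rough_pow_le hk h
  set w := ∑ p ∈ k.primeFactors, k.factorization p
  have hl : 0 < Real.log n := Real.log_pos (by exact_mod_cast hn)
  have h3 : (w : ℝ) * Real.log n ≤ Real.log k := by
    rw [← Real.log_pow]
    exact Real.log_le_log (by positivity) (by exact_mod_cast h2)
  have h4 : (w : ℝ) ≤ B := le_of_mul_le_mul_right (h3.trans hB) hl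
  have h5 : w ≤ B := by exact_mod_cast h4
  calc (k.divisors.card : ℝ) ≤ (2 : ℝ) ^ w := by exact_mod_cast h1
    _ ≤ 2 ^ B := pow_le_pow_right₀ (by norm_num) h5

open Classical in
noncomputable def RS (n N : ℕ) : Finset ℕ := (Finset.Icc 1 N).filter (fun k => Rough n k)

lemma mem_RS {n N k : ℕ} : k ∈ RS n N ↔ (1 ≤ k ∧ k ≤ N) ∧ Rough n k := by
  simp [RS]

lemma rough_of_dvd {n k d : ℕ} (h : Rough n k) (hd : d ∣ k) : Rough n d :=
  fun p hp hpd => h p hp (hpd.trans hd)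

open Classical in
lemma rough_log_sum (n N : ℕ) :
    ∑ k ∈ RS n N, Real.log k ≤ (Real.log 4 + 4) * N * ∑ m ∈ RS n N, 1 / (m : ℝ) := by
  have h1 : ∑ k ∈ RS n N, Real.log k ≤
      ∑ k ∈ Finset.Icc 1 N, ∑ m ∈ Finset.Icc 1 N,
        (if m ∣ k then (if Rough n m then ArithmeticFunction.vonMangoldt (k / m) else 0) else 0) := by
    unfold RS
    rw [Finset.sum_filter]
    refine Finset.sum_le_sum fun k hk => ?_
    rw [Finset.mem_Icc] at hk
    have hnn : ∀ m, 0 ≤ (if m ∣ k then (if Rough n m then ArithmeticFunction.vonMangoldt (k / m) else 0) else (0:ℝ)) := by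
      intro m; split_ifs <;> first | exact ArithmeticFunction.vonMangoldt_nonneg | exact le_rfl
    split_ifs with h
    · rw [← ArithmeticFunction.vonMangoldt_sum, ← Nat.sum_div_divisors]
      rw [← Finset.sum_filter]
      have hsub : k.divisors ⊆ (Finset.Icc 1 N).filter (fun m => m ∣ k) := by
        intro m hm
        rw [Nat.mem_divisors] at hm
        simp only [Finset.mem_filter, Finset.mem_Icc]
        have := Nat.le_of_dvd (by omega) hm.1
        have := Nat.pos_of_dvd_of_pos hm.1 (by omega)
        exact ⟨⟨by omega, by omega⟩, hm.1⟩
      refine le_trans (le_of_eq ?_) (Finset.sum_le_sum_of_subset_of_nonneg hsub ?_)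
      · refine Finset.sum_congr rfl fun m hm => ?_
        rw [if_pos (rough_of_dvd h (Nat.dvd_of_mem_divisors hm))]
      · intro m _ _
        split_ifs <;> first | exact ArithmeticFunction.vonMangoldt_nonneg | exact le_rfl
    · exact Finset.sum_nonneg fun m _ => hnn m
  refine h1.trans ?_
  rw [Finset.sum_comm]
  unfold RS
  rw [Finset.sum_filter, Finset.mul_sum]
  refine Finset.sum_le_sum fun m hm => ?_
  rw [Finset.mem_Icc] at hm
  by_cases h : Rough n m
  · simp only [if_pos h]
    rw [sum_dvd_div (fun j => ArithmeticFunction.vonMangoldt j) N m (by omega)]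
    have := Chebyshev.psi_le_const_mul_self (x := (N : ℝ) / m) (by positivity)
    unfold Chebyshev.psi at this
    rw [Nat.floor_div_natCast, Nat.floor_natCast] at this
    have e : Finset.Ioc 0 (N / m) = Finset.Icc 1 (N / m) := by ext; simp [Nat.succ_le_iff]
    rw [e] at this
    refine this.trans (le_of_eq ?_)
    ring
  · simp [if_neg h]

lemma rough_inv_sum {n N : ℕ} (h : n ≤ N) : ∑ m ∈ RS n N, 1 / (m : ℝ) ≤ VV n * (VV N)⁻¹ := by
  have h1 := sum_inv_le_prod ((Finset.Ioc n N).filter Nat.Prime)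
    (fun p hp => (Finset.mem_filter.1 hp).2) (RS n N) (by
      intro k hk
      rw [mem_RS] at hk
      rw [Nat.mem_factoredNumbers']
      intro p hp hpk
      simp only [Finset.mem_filter, Finset.mem_Ioc]
      exact ⟨⟨hk.2 p hp hpk, (Nat.le_of_dvd (by omega) hpk).trans hk.1.2⟩, hp⟩)
  refine h1.trans (le_of_eq ?_)
  have h2 : VV N = VV n * ∏ p ∈ (Finset.Ioc n N).filter Nat.Prime, (1 - 1 / (p : ℝ)) := by
    unfold VV
    rw [← Finset.prod_union]
    · refine Finset.prod_congr ?_ fun _ _ => rfl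
      ext p
      simp only [Finset.mem_filter, Finset.mem_union, Finset.mem_range, Finset.mem_Ioc]
      constructor
      · rintro ⟨h1, h2⟩
        by_cases hp : p < n + 1
        · exact Or.inl ⟨hp, h2⟩
        · exact Or.inr ⟨⟨by omega, by omega⟩, h2⟩
      · rintro (⟨h1, h2⟩ | ⟨h1, h2⟩)
        · exact ⟨by omega, h2⟩
        · exact ⟨by omega, h2⟩
    · rw [Finset.disjoint_left]
      intro p hp hp'
      simp only [Finset.mem_filter, Finset.mem_range, Finset.mem_Ioc] at hp hp'
      omega
  have h3 := (VV_pos n).ne'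
  rw [Finset.prod_inv_distrib, h2, mul_inv, ← mul_assoc, mul_inv_cancel₀ h3, one_mul]

lemma rough_card : ∃ C : ℝ, 0 < C ∧ ∀ n N : ℕ, 2 ≤ n → n ≤ N →
    ((RS n N).card : ℝ) * Real.log n ≤ Real.log n + C * N * (Real.log N / Real.log n) := by
  obtain ⟨C, hC, hV⟩ := VV_lower
  refine ⟨(Real.log 4 + 4) * C, by have := Real.log_nonneg (show (1:ℝ) ≤ 4 by norm_num); positivity,
    fun n N hn hN => ?_⟩
  have hl : 0 < Real.log n := Real.log_pos (by exact_mod_cast hn)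
  have h4 := Real.log_nonneg (show (1:ℝ) ≤ 4 by norm_num)
  have h1 := rough_log_sum n N
  have h2 := rough_inv_sum hN
  have h3 := hV N (by omega)
  have h5 : VV n ≤ 1 / Real.log n := by
    rw [le_div_iff₀ hl]; exact VV_upper (by omega)
  have hm1 : 1 ∈ RS n N := by
    rw [mem_RS]; refine ⟨⟨le_rfl, by omega⟩, fun p hp h => ?_⟩
    exact absurd (Nat.dvd_one.1 h) hp.ne_one
  have h6 : (((RS n N).card : ℝ) - 1) * Real.log n ≤ ∑ k ∈ RS n N, Real.log k := by
    rw [← Finset.add_sum_erase _ _ hm1]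
    have hc : (((RS n N).erase 1).card : ℝ) = (RS n N).card - 1 := by
      rw [Finset.card_erase_of_mem hm1, Nat.cast_sub (Finset.card_pos.2 ⟨1, hm1⟩)]; simp
    rw [← hc, ← nsmul_eq_mul]
    simp only [Nat.cast_one, Real.log_one, zero_add]
    refine Finset.card_nsmul_le_sum _ _ _ fun k hk => ?_
    rw [Finset.mem_erase, mem_RS] at hk
    obtain ⟨p, hp, hpk⟩ := Nat.exists_prime_and_dvd hk.1
    have := hk.2.2 p hp hpk
    have := Nat.le_of_dvd (by omega) hpk
    exact Real.log_le_log (by positivity) (by exact_mod_cast (by omega : n ≤ k))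
  have h7 : VV n * (VV N)⁻¹ ≤ 1 / Real.log n * (C * Real.log N) :=
    mul_le_mul h5 h3 (inv_nonneg.2 (VV_pos N).le) (by positivity)
  have h8 : (Real.log 4 + 4) * N * ∑ m ∈ RS n N, 1 / (m : ℝ) ≤
      (Real.log 4 + 4) * N * (1 / Real.log n * (C * Real.log N)) :=
    mul_le_mul_of_nonneg_left (h2.trans h7) (by positivity)
  have e : (Real.log 4 + 4) * N * (1 / Real.log n * (C * Real.log N)) =
    (Real.log 4 + 4) * C * N * (Real.log N / Real.log n) := by ring
  linarith

lemma TT_le_card {n N B : ℕ} (hn : 2 ≤ n) (hB : Real.log N ≤ B * Real.log n) :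
    TT n N ≤ 2 ^ B * (RS n N).card := by
  classical
  unfold TT ft
  have e : RS n N = (Finset.Icc 1 N).filter (fun k => Rough n k) := by unfold RS; congr
  rw [← Finset.sum_filter, e, mul_comm, ← nsmul_eq_mul]
  refine Finset.sum_le_card_nsmul _ _ _ fun k hk => ?_
  simp only [Finset.mem_filter, Finset.mem_Icc] at hk
  refine card_div_rough_le hn (by omega) hk.2 (le_trans ?_ hB)
  exact Real.log_le_log (by exact_mod_cast hk.1.1) (by exact_mod_cast hk.1.2)

lemma TT_nonneg (n N : ℕ) : 0 ≤ TT n N := by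
  unfold TT ft
  exact Finset.sum_nonneg fun k _ => by split_ifs <;> positivity

lemma MM_abs : ∃ C : ℝ, 0 < C ∧ ∀ n : ℕ, 2 ≤ n → ∀ x : ℝ, (n : ℝ) ≤ x →
    |MM n x| ≤ C * x * Real.log x / Real.log n ^ 2 := by
  obtain ⟨C, hC, hL⟩ := LL_abs
  have hl2 : 0 < Real.log 2 := Real.log_pos (by norm_num)
  set D := |2 * Real.eulerMascheroniConstant - 1| + 2 * C with hD
  refine ⟨3 + D / Real.log 2, by positivity, fun n hn x hx => ?_⟩
  have hn' : (2 : ℝ) ≤ n := by exact_mod_cast hn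
  have hl : 0 < Real.log n := Real.log_pos (by linarith)
  have hln : Real.log 2 ≤ Real.log n := Real.log_le_log (by norm_num) hn'
  have hlx : Real.log n ≤ Real.log x := Real.log_le_log (by linarith) hx
  have h5 : VV n ≤ 1 / Real.log n := by
    rw [le_div_iff₀ hl]; exact VV_upper (by omega)
  have h6 : VV n ^ 2 ≤ 1 / Real.log n ^ 2 := by
    have := pow_le_pow_left₀ (VV_pos n).le h5 2
    rwa [div_pow, one_pow] at this
  have h7 : |Real.log x + (2 * Real.eulerMascheroniConstant - 1) + 2 * LL n| ≤ (3 + D / Real.log 2) * Real.log x := by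
    have a1 := hL n (by omega)
    have a2 : D ≤ D / Real.log 2 * Real.log x := by
      rw [div_mul_eq_mul_div, le_div_iff₀ hl2]
      exact mul_le_mul_of_nonneg_left (hln.trans hlx) (by positivity)
    have a3 := abs_le.1 a1
    have a4 := neg_abs_le (2 * Real.eulerMascheroniConstant - 1)
    have a5 := le_abs_self (2 * Real.eulerMascheroniConstant - 1)
    rw [abs_le]
    constructor <;> linarith
  unfold MM
  have hx0 : 0 < x := by linarith
  rw [abs_mul, abs_of_nonneg (by positivity : 0 ≤ x * VV n ^ 2)]
  calc x * VV n ^ 2 * |Real.log x + (2 * Real.eulerMascheroniConstant - 1) + 2 * LL n|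
      ≤ x * (1 / Real.log n ^ 2) * ((3 + D / Real.log 2) * Real.log x) := by gcongr
    _ = _ := by ring

lemma base_bound (B : ℕ) : ∃ C : ℝ, 0 < C ∧ ∀ n : ℕ, 2 ≤ n → ∀ x : ℝ, (n : ℝ) ≤ x →
    Real.log x ≤ B * Real.log n → |EE n x| ≤ C * x / Real.log x := by
  obtain ⟨C₁, hC₁, hM⟩ := MM_abs
  obtain ⟨C₂, hC₂, hR⟩ := rough_card
  refine ⟨C₁ * B ^ 2 + 2 ^ B * (1 + C₂ * B ^ 2), by positivity, fun n hn x hx hB => ?_⟩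
  have hn' : (2 : ℝ) ≤ n := by exact_mod_cast hn
  have hx0 : 0 < x := by linarith
  have hl : 0 < Real.log n := Real.log_pos (by linarith)
  have hlx : Real.log n ≤ Real.log x := Real.log_le_log (by linarith) hx
  have hlx0 : 0 < Real.log x := by linarith
  set N := ⌊x⌋₊ with hN
  have hNx : (N : ℝ) ≤ x := Nat.floor_le hx0.le
  have hnN : n ≤ N := Nat.le_floor hx
  have hN0 : (0 : ℝ) < N := by exact_mod_cast (by omega : 0 < N)
  have hlN : Real.log N ≤ Real.log x := Real.log_le_log hN0 hNx
  have h1 := hM n hn x hx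
  have h2 := hR n N hn hnN
  have h3 := TT_le_card (B := B) hn (hlN.trans hB)
  have h4 := TT_nonneg n N
  have hinv : 1 / Real.log n ≤ B / Real.log x := by
    rw [div_le_div_iff₀ hl hlx0]; linarith
  have h5 : |MM n x| ≤ C₁ * B ^ 2 * x / Real.log x := by
    refine h1.trans ?_
    calc C₁ * x * Real.log x / Real.log n ^ 2 = C₁ * x * Real.log x * (1 / Real.log n) ^ 2 := by ring
      _ ≤ C₁ * x * Real.log x * (B / Real.log x) ^ 2 := by gcongr
      _ = _ := by field_simp
  have h6 : ((RS n N).card : ℝ) ≤ 1 + C₂ * x * (B / Real.log x) * B := by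
    have a1 : ((RS n N).card : ℝ) ≤ 1 + C₂ * N * (Real.log N / Real.log n) * (1 / Real.log n) := by
      have : 1 + C₂ * N * (Real.log N / Real.log n) * (1 / Real.log n) =
        (Real.log n + C₂ * N * (Real.log N / Real.log n)) / Real.log n := by field_simp
      rw [this, le_div_iff₀ hl]; exact h2
    have a2 : Real.log N / Real.log n ≤ B := by
      rw [div_le_iff₀ hl]; linarith
    refine a1.trans ?_
    calc 1 + C₂ * N * (Real.log N / Real.log n) * (1 / Real.log n)
        ≤ 1 + C₂ * x * B * (B / Real.log x) := by
          have : 0 ≤ Real.log N / Real.log n := by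
            apply div_nonneg (Real.log_natCast_nonneg N) hl.le
          gcongr
      _ = _ := by ring
  have h7 : 1 ≤ x / Real.log x := by
    rw [le_div_iff₀ hlx0]; have := Real.log_le_sub_one_of_pos hx0; linarith
  have h8 : TT n N ≤ 2 ^ B * (1 + C₂ * B ^ 2) * x / Real.log x := by
    calc TT n N ≤ 2 ^ B * (x / Real.log x + C₂ * x * (B / Real.log x) * B) := by
          refine h3.trans ?_
          gcongr
          linarith
      _ = _ := by ring
  unfold EE
  have : (C₁ * B ^ 2 + 2 ^ B * (1 + C₂ * B ^ 2)) * x / Real.log x =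
    C₁ * B ^ 2 * x / Real.log x + 2 ^ B * (1 + C₂ * B ^ 2) * x / Real.log x := by ring
  rw [this]
  have h9 := abs_le.1 h5
  rw [abs_le]
  constructor <;> linarith [abs_nonneg (MM n x)]

noncomputable def hh (u : ℝ) : ℝ := Real.exp (-(u * Real.log u))
noncomputable def HH (a l u : ℝ) : ℝ := hh u + Real.exp (-(a * u)) / l

lemma hh_pos (u : ℝ) : 0 < hh u := Real.exp_pos _

lemma HH_pos (a u : ℝ) {l : ℝ} (hl : 0 < l) : 0 < HH a l u := by
  unfold HH; have := hh_pos u; positivity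

lemma hh_anti {a b : ℝ} (ha : 1 ≤ a) (hab : a ≤ b) : hh b ≤ hh a := by
  unfold hh
  rw [Real.exp_le_exp, neg_le_neg_iff]
  exact mul_le_mul hab (Real.log_le_log (by linarith) hab) (Real.log_nonneg ha) (by linarith)

lemma hh_sub {u t : ℝ} (ht : 0 ≤ t) (hu : t + 1 ≤ u) :
    hh (u - t) ≤ Real.exp (t * (1 + Real.log u)) * hh u := by
  unfold hh
  rw [← Real.exp_add, Real.exp_le_exp]
  have h0 : 0 < u - t := by linarith
  have h1 : Real.log u - Real.log (u - t) ≤ t / (u - t) := by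
    rw [← Real.log_div (by linarith) h0.ne']
    have := Real.log_le_sub_one_of_pos (show 0 < u / (u - t) by apply div_pos <;> linarith)
    have e : u / (u - t) - 1 = t / (u - t) := by field_simp; ring
    linarith
  have h2 : (u - t) * (Real.log u - Real.log (u - t)) ≤ t := by
    calc (u - t) * (Real.log u - Real.log (u - t)) ≤ (u - t) * (t / (u - t)) := by gcongr
      _ = t := by field_simp
  nlinarith

lemma HH_shift {a l l' u u' t : ℝ} (ha : 0 ≤ a) (hl : 0 < l) (hl' : l / 2 ≤ l') (ht : 1 ≤ t)
    (hu : t + 1 ≤ u) (hu' : u - t ≤ u') (hA : 2 * Real.exp a ≤ u) :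
    HH a l' u' ≤ Real.exp (t * (1 + Real.log u)) * HH a l u := by
  unfold HH
  rw [mul_add]
  refine add_le_add ((hh_anti (by linarith) hu').trans (hh_sub (by linarith) hu)) ?_
  have h1 : Real.log 2 + a ≤ Real.log u := by
    have := Real.log_le_log (by positivity) hA
    rwa [Real.log_mul (by norm_num) (by positivity), Real.log_exp] at this
  have h2 : 2 * Real.exp (-(a * u')) ≤ Real.exp (t * (1 + Real.log u)) * Real.exp (-(a * u)) := by
    have e2 : (2 : ℝ) = Real.exp (Real.log 2) := (Real.exp_log (by norm_num)).symm
    conv_lhs => rw [e2]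
    rw [← Real.exp_add, ← Real.exp_add, Real.exp_le_exp]
    have hl2 : 0 < Real.log 2 := Real.log_pos (by norm_num)
    nlinarith
  calc Real.exp (-(a * u')) / l' ≤ Real.exp (-(a * u')) / (l / 2) := by gcongr
    _ = 2 * Real.exp (-(a * u')) / l := by field_simp
    _ ≤ Real.exp (t * (1 + Real.log u)) * Real.exp (-(a * u)) / l := by gcongr
    _ = _ := by ring

lemma HH_half {l u v : ℝ} (hl : 0 < l) (hu : 1 ≤ u) (huv : u + 1 / 80 ≤ v)
    (hA : 80 * Real.log 2 ≤ Real.log u) :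
    HH (80 * Real.log 2) l v ≤ HH (80 * Real.log 2) l u / 2 := by
  unfold HH
  rw [add_div]
  have e2 : ∀ y : ℝ, Real.exp y / 2 = Real.exp (y - Real.log 2) := fun y => by
    rw [Real.exp_sub, Real.exp_log (by norm_num)]
  have hl2 : 0 < Real.log 2 := Real.log_pos (by norm_num)
  refine add_le_add ?_ ?_
  · unfold hh
    rw [e2, Real.exp_le_exp]
    have h1 : Real.log u ≤ Real.log v := Real.log_le_log (by linarith) (by linarith)
    have h2 : (u + 1 / 80) * Real.log u ≤ v * Real.log v :=
      mul_le_mul huv h1 (by linarith) (by linarith)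
    linarith
  · rw [div_right_comm, e2]
    gcongr
    nlinarith

lemma HH_shift_nat {a l l' u u' : ℝ} {j : ℕ} (ha : 0 ≤ a) (hl : 0 < l) (hl' : l / 2 ≤ l') (hj : 1 ≤ j)
    (hu : (j : ℝ) + 1 ≤ u) (hu' : u - j ≤ u') (hA : 2 * Real.exp a ≤ u) :
    HH a l' u' ≤ (3 * u) ^ j * HH a l u := by
  have hj' : (1 : ℝ) ≤ j := by exact_mod_cast hj
  have h := HH_shift ha hl hl' hj' hu hu' hA
  refine h.trans (mul_le_mul_of_nonneg_right ?_ (HH_pos _ _ hl).le)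
  rw [Real.exp_nat_mul, Real.exp_add, Real.exp_log (by linarith)]
  have : Real.exp 1 ≤ 3 := by have := Real.exp_one_lt_d9; linarith
  have : 0 ≤ u := by linarith
  gcongr

def IH (a U K : ℝ) (n : ℕ) : Prop :=
  ∀ x : ℝ, 0 < x → U - 2 ≤ Real.log x / Real.log n →
    (Real.log x / Real.log n) ^ 4 ≤ Real.log x →
    |EE n x| ≤ K * (x / Real.log x) * HH a (Real.log x) (Real.log x / Real.log n)

lemma pow4_aux {u l : ℝ} (hu : 10 ≤ u) (h : u ^ 8 ≤ l) : 32 * u ^ 4 ≤ l := by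
  have b2 : (10 : ℝ) ^ 4 ≤ u ^ 4 := pow_le_pow_left₀ (by norm_num) hu 4
  have b3 : u ^ 8 = u ^ 4 * u ^ 4 := by ring
  nlinarith

lemma term_bound {a U K x l u : ℝ} {m n p j : ℕ} (ha : 0 ≤ a) (hK : 0 < K) (hU : 10 ≤ U) (hA : 2 * Real.exp a ≤ U)
    (hx : 0 < x) (hl : l = Real.log x) (hm : 2 ≤ m) (hmp : m < p) (hpn : p ≤ n)
    (hu : u = l / Real.log n) (huU : U ≤ u) (hu8 : u ^ 8 ≤ l) (hum : l / Real.log m ≤ 2 * u)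
    (hj : 1 ≤ j) (hj2 : j ≤ 2) (ih : IH a U K (p - 1)) :
    |EE (p - 1) (x / (p : ℝ) ^ j)| ≤ K * (2 * x / l * HH a l u) * ((3 * u) ^ j / (p : ℝ) ^ j) := by
  have hp0 : (0 : ℝ) < p := by exact_mod_cast (by omega : 0 < p)
  have hu0 : 10 ≤ u := by linarith
  have hl0 : 0 < l := by
    have : 0 < u ^ 8 := by positivity
    linarith
  have hm' : (2 : ℝ) ≤ m := by exact_mod_cast hm
  have hlm : 0 < Real.log m := Real.log_pos (by linarith)
  have hpc : ((p - 1 : ℕ) : ℝ) = p - 1 := by rw [Nat.cast_sub (by omega)]; simp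
  have hmp1 : Real.log m ≤ Real.log ((p - 1 : ℕ) : ℝ) :=
    Real.log_le_log (by linarith) (by exact_mod_cast (by omega : m ≤ p - 1))
  set q := Real.log ((p - 1 : ℕ) : ℝ) with hq
  have hq0 : 0 < q := by linarith
  have hqp : q ≤ Real.log p := by
    apply Real.log_le_log
    · rw [hpc]; have : (2 : ℝ) < p := by exact_mod_cast (by omega : 2 < p)
      linarith
    · rw [hpc]; linarith
  have hpln : Real.log p ≤ Real.log n := Real.log_le_log hp0 (by exact_mod_cast hpn)
  have hln : 0 < Real.log n := by linarith
  have hlu : u * Real.log n = l := by rw [hu]; field_simp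
  have hjR : (1 : ℝ) ≤ j := by exact_mod_cast hj
  have hjR2 : (j : ℝ) ≤ 2 := by exact_mod_cast hj2
  have hlx' : Real.log (x / (p : ℝ) ^ j) = l - j * Real.log p := by
    rw [Real.log_div hx.ne' (by positivity), Real.log_pow, hl]
  set l' := Real.log (x / (p : ℝ) ^ j) with hl'
  have hjp : j * Real.log p ≤ 2 * Real.log n := by
    have : (0 : ℝ) ≤ Real.log p := by linarith
    nlinarith
  have hl2 : l / 2 ≤ l' := by nlinarith
  have hll : l' ≤ l := by
    rw [hlx']; have : 0 ≤ (j : ℝ) * Real.log p := by apply mul_nonneg <;> linarith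
    linarith
  have hl'0 : 0 < l' := by linarith
  have hu1 : u - j ≤ l' / q := by
    have b0 : 0 < Real.log p := by linarith
    calc u - j ≤ l / Real.log p - j := by
          rw [hu]; gcongr
      _ = l' / Real.log p := by rw [hlx']; field_simp
      _ ≤ l' / q := by gcongr
  have hu2 : l' / q ≤ 2 * u := by
    calc l' / q ≤ l / Real.log m := by gcongr
      _ ≤ 2 * u := hum
  have hu4 : (l' / q) ^ 4 ≤ l' := by
    have b1 : (l' / q) ^ 4 ≤ (2 * u) ^ 4 := by
      apply pow_le_pow_left₀ (by positivity) hu2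
    have b2 := pow4_aux hu0 hu8
    have b4 : (2 * u) ^ 4 = 16 * u ^ 4 := by ring
    linarith
  have key := ih (x / (p : ℝ) ^ j) (by positivity) (by rw [← hl', ← hq]; linarith) (by rw [← hl', ← hq]; exact hu4)
  rw [← hl', ← hq] at key
  refine key.trans ?_
  have hs := HH_shift_nat (a := a) (l := l) (l' := l') (u := u) (u' := l' / q) (j := j) ha hl0 hl2 hj
    (by linarith) hu1 (by linarith)
  have hH := HH_pos a u hl0
  have hH' := HH_pos a (l' / q) hl'0
  calc K * (x / (p : ℝ) ^ j / l') * HH a l' (l' / q)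
      ≤ K * (x / (p : ℝ) ^ j / (l / 2)) * ((3 * u) ^ j * HH a l u) := by gcongr
    _ = _ := by field_simp

set_option maxHeartbeats 1600000 in
lemma step {a U K x l u C : ℝ} {n : ℕ} (ha : a = 80 * Real.log 2) (hK : 0 < K) (hU : 10 ≤ U)
    (hA : 2 * Real.exp a ≤ U) (hC : 0 ≤ C) (hUC : 160 * C ≤ U)
    (hps : ∀ (z : ℝ) (n : ℕ), 2 ≤ z → z ≤ n → ∑ p ∈ (Finset.Ioc ⌊z⌋₊ n).filter Nat.Prime, 1 / (p : ℝ)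
      ≤ (Real.log n - Real.log z + C) / Real.log z)
    (hx : 0 < x) (hl : l = Real.log x) (hn : 2 ≤ n)
    (hu : u = l / Real.log n) (huU : U ≤ u) (hu8 : u ^ 8 ≤ l)
    (ih : ∀ m, 2 ≤ m → m < n → IH a U K m) :
    |EE n x| ≤ K * (x / l) * HH a l u := by
  have hl2 : 0 < Real.log 2 := Real.log_pos (by norm_num)
  have hl21 : Real.log 2 ≤ 1 := by have := Real.log_two_lt_d9; linarith
  have ha0 : 0 ≤ a := by rw [ha]; positivity
  have hu0 : 10 ≤ u := by linarith
  have hl0 : 0 < l := by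
    have : 0 < u ^ 8 := by positivity
    linarith
  have hn' : (2 : ℝ) ≤ n := by exact_mod_cast hn
  have hln : 0 < Real.log n := Real.log_pos (by linarith)
  have hlu : u * Real.log n = l := by rw [hu]; field_simp
  set w := l / (u + 1 / 80) with hw
  have hw0 : 0 < w := by positivity
  have hwu : w * (u + 1 / 80) = l := by rw [hw]; field_simp
  have hwn : w < Real.log n := by
    by_contra h
    push Not at h
    have b1 : u * Real.log n ≤ u * w := mul_le_mul_of_nonneg_left h (by linarith)
    have b2 : w * (u + 1 / 80) = u * w + w * (1 / 80) := by ring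
    linarith
  have hu7 : u ^ 7 / 2 ≤ w := by
    rw [hw, div_le_div_iff₀ (by norm_num) (by linarith)]
    have : (0:ℝ) < u ^ 7 := by positivity
    nlinarith [show u ^ 8 = u ^ 7 * u by ring]
  have hu6 : (10 : ℝ) ^ 6 ≤ u ^ 6 := pow_le_pow_left₀ (by norm_num) hu0 6
  have hu7' : (10 : ℝ) ^ 6 * u ≤ u ^ 7 := by
    have : u ^ 7 = u ^ 6 * u := by ring
    rw [this]; gcongr
  have hw3 : 100 * u ≤ w := by norm_num at hu7'; linarith
  set z := Real.exp w with hz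
  have hzw : w + 1 ≤ z := Real.add_one_le_exp w
  have hz2 : 2 ≤ z := by linarith
  have hlz : Real.log z = w := Real.log_exp w
  have hzn : z < n := by
    rw [hz, ← Real.lt_log_iff_exp_lt (by linarith)]; exact hwn
  set m := ⌊z⌋₊ with hm
  have hm2 : 2 ≤ m := Nat.le_floor (by exact_mod_cast hz2)
  have hmz : (m : ℝ) ≤ z := Nat.floor_le (by linarith)
  have hmn : m < n := by
    have : (m : ℝ) < n := by linarith
    exact_mod_cast this
  have hm2' : (2 : ℝ) ≤ m := by exact_mod_cast hm2
  have hzm : z < m + 1 := Nat.lt_floor_add_one z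
  have hlm0 : 0 < Real.log m := Real.log_pos (by linarith)
  have hlmw : Real.log m ≤ w := by rw [← hlz]; exact Real.log_le_log (by linarith) hmz
  have hlm : w - Real.log 2 ≤ Real.log m := by
    rw [← hlz, ← Real.log_div (by linarith) (by norm_num)]
    exact Real.log_le_log (by linarith) (by linarith)
  have hum1 : u + 1 / 80 ≤ l / Real.log m := by
    rw [le_div_iff₀ hlm0, ← hwu, mul_comm w]
    exact mul_le_mul_of_nonneg_left hlmw (by linarith)
  have hum2 : l / Real.log m ≤ 2 * u := by
    rw [div_le_iff₀ hlm0]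
    have b1 : 2 * u * (w - Real.log 2) ≤ 2 * u * Real.log m :=
      mul_le_mul_of_nonneg_left hlm (by linarith)
    have b2 : u * Real.log 2 ≤ u * 1 := mul_le_mul_of_nonneg_left hl21 (by linarith)
    have b3 : 10 * w ≤ u * w := mul_le_mul_of_nonneg_right hu0 hw0.le
    have b4 : w * (u + 1 / 80) = u * w + w * (1 / 80) := by ring
    have b5 : 2 * u * (w - Real.log 2) = 2 * (u * w) - 2 * (u * Real.log 2) := by ring
    linarith
  -- main term
  have hH := HH_pos a u hl0
  have hmain : |EE m x| ≤ K * (x / l) * HH a l u * (1 / 2) := by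
    have hum4 : (l / Real.log m) ^ 4 ≤ l := by
      have b1 : (l / Real.log m) ^ 4 ≤ (2 * u) ^ 4 := by
        apply pow_le_pow_left₀ (by positivity) hum2
      have b2 := pow4_aux hu0 hu8
      have b4 : (2 * u) ^ 4 = 16 * u ^ 4 := by ring
      linarith
    have key := ih m hm2 hmn x hx (by rw [← hl]; linarith) (by rw [← hl]; exact hum4)
    rw [← hl] at key
    refine key.trans ?_
    have hlogu : 80 * Real.log 2 ≤ Real.log u := by
      have h1 : Real.exp a ≤ u := by have := Real.exp_pos a; linarith
      have := Real.log_le_log (Real.exp_pos a) h1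
      rwa [Real.log_exp, ha] at this
    have hs := HH_half (l := l) (u := u) (v := l / Real.log m) hl0 (by linarith) hum1 hlogu
    rw [← ha] at hs
    calc K * (x / l) * HH a l (l / Real.log m) ≤ K * (x / l) * (HH a l u / 2) := by gcongr
      _ = _ := by ring
  -- prime sum
  have hS1 : u * ∑ p ∈ (Finset.Ioc m n).filter Nat.Prime, 1 / (p : ℝ) ≤ 1 / 40 := by
    have h1 := hps z n hz2 hzn.le
    rw [hlz] at h1
    have e1 : Real.log n - w = w * (1 / 80) / u := by
      rw [eq_div_iff (by linarith)]
      have : w * u + w * (1 / 80) = l := by rw [← hwu]; ring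
      linarith [this, hlu, mul_comm u (Real.log n), mul_comm w u, sub_mul (Real.log n) w u]
    have e2 : (Real.log n - w + C) / w = 1 / 80 / u + C / w := by
      rw [e1]; field_simp
    rw [e2] at h1
    have h2 : C / w ≤ 1 / 80 / u := by
      rw [div_div, div_le_div_iff₀ hw0 (by linarith)]
      have : u ^ 2 ≤ w := by
        have : u ^ 2 * 2 ≤ u ^ 7 := by
          have b5 : (10 : ℝ) ^ 5 ≤ u ^ 5 := pow_le_pow_left₀ (by norm_num) hu0 5
          have : u ^ 7 = u ^ 2 * u ^ 5 := by ring
          rw [this]; gcongr; linarith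
        linarith
      have b1 : 160 * C * u ≤ u * u := mul_le_mul_of_nonneg_right (by linarith) (by linarith)
      have b2 : 0 ≤ C * u := mul_nonneg hC (by linarith)
      have b3 : C * (80 * u) = 80 * (C * u) := by ring
      have b4 : 160 * C * u = 160 * (C * u) := by ring
      linarith [sq u]
    calc u * ∑ p ∈ (Finset.Ioc m n).filter Nat.Prime, 1 / (p : ℝ)
        ≤ u * (1 / 80 / u + 1 / 80 / u) := by
          apply mul_le_mul_of_nonneg_left _ (by linarith)
          linarith
      _ = 1 / 40 := by field_simp; norm_num
  set W := K * (2 * x / l * HH a l u) with hW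
  have hW0 : 0 < W := by positivity
  have hterm : ∀ p ∈ (Finset.Ioc m n).filter Nat.Prime,
      |2 * EE (p - 1) (x / (p : ℝ)) - EE (p - 1) (x / (p : ℝ) ^ 2)| ≤ W * (9 * (u * (1 / (p : ℝ)))) := by
    intro p hp
    simp only [Finset.mem_filter, Finset.mem_Ioc] at hp
    have ihp := ih (p - 1) (by omega) (by omega)
    have t1 := term_bound (a := a) (U := U) (K := K) (x := x) (l := l) (u := u) (m := m) (n := n) (p := p) (j := 1)
      ha0 hK hU hA hx hl hm2 hp.1.1 hp.1.2 hu huU hu8 hum2 le_rfl (by norm_num) ihp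
    have t2 := term_bound (a := a) (U := U) (K := K) (x := x) (l := l) (u := u) (m := m) (n := n) (p := p) (j := 2)
      ha0 hK hU hA hx hl hm2 hp.1.1 hp.1.2 hu huU hu8 hum2 (by norm_num) le_rfl ihp
    rw [pow_one, pow_one, ← hW] at t1
    rw [← hW] at t2
    have hpz : z < p := by
      have : (m : ℝ) + 1 ≤ p := by exact_mod_cast hp.1.1
      linarith
    have hp0 : (0 : ℝ) < p := by linarith
    have h3 : (3 * u) ^ 2 / (p : ℝ) ^ 2 ≤ 3 * (u * (1 / (p : ℝ))) := by
      rw [mul_one_div, mul_div_assoc', div_le_div_iff₀ (by positivity) hp0]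
      have : 3 * u ≤ p := by linarith
      have h4 : 0 ≤ 3 * u * p := by positivity
      calc (3 * u) ^ 2 * (p : ℝ) = 3 * u * p * (3 * u) := by ring
        _ ≤ 3 * u * p * p := mul_le_mul_of_nonneg_left this h4
        _ = _ := by ring
    calc |2 * EE (p - 1) (x / (p : ℝ)) - EE (p - 1) (x / (p : ℝ) ^ 2)|
        ≤ 2 * |EE (p - 1) (x / (p : ℝ))| + |EE (p - 1) (x / (p : ℝ) ^ 2)| := by
          refine (abs_sub _ _).trans ?_
          rw [abs_mul, abs_two]
      _ ≤ 2 * (W * (3 * u / p)) + W * (3 * (u * (1 / (p : ℝ)))) := by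
          have := mul_le_mul_of_nonneg_left h3 hW0.le
          linarith
      _ = _ := by ring
  rw [EE_telescope hmn.le hx]
  have hsum : |∑ p ∈ (Finset.Ioc m n).filter Nat.Prime,
      (2 * EE (p - 1) (x / (p : ℝ)) - EE (p - 1) (x / (p : ℝ) ^ 2))| ≤ W * (9 * (1 / 40)) := by
    refine (Finset.abs_sum_le_sum_abs _ _).trans ((Finset.sum_le_sum hterm).trans ?_)
    rw [← Finset.mul_sum, ← Finset.mul_sum, ← Finset.mul_sum]
    gcongr
  refine (abs_sub _ _).trans ?_
  have hWe : W = 2 * (K * (x / l) * HH a l u) := by rw [hW]; ring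
  have hpos : 0 < K * (x / l) * HH a l u := by positivity
  rw [hWe] at hsum
  linarith

lemma induction_main : ∃ U : ℕ, 10 ≤ U ∧ ∃ K : ℝ, 0 < K ∧ ∀ n : ℕ, 2 ≤ n → IH (80 * Real.log 2) U K n := by
  obtain ⟨C, hC, hps⟩ := short_prime_sum
  set a := 80 * Real.log 2 with ha
  have hl2 : 0 < Real.log 2 := Real.log_pos (by norm_num)
  have ha0 : 0 < a := by positivity
  obtain ⟨U, hU⟩ := exists_nat_ge (10 + 2 * Real.exp a + 160 * C + 2 * (a + 1))
  have hea := Real.exp_pos a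
  have hU10 : (10 : ℝ) ≤ U := by linarith
  obtain ⟨C₁, hC₁, hb⟩ := base_bound U
  obtain ⟨C₂, hC₂, hr⟩ := rankin (c := a + 1) (by linarith)
  have hhU := hh_pos U
  refine ⟨U, by exact_mod_cast hU10, C₁ / hh U + C₂ * (Nat.factorial 40 : ℕ), by positivity, fun n hn => ?_⟩
  set K := C₁ / hh U + C₂ * (Nat.factorial 40 : ℕ) with hK
  have hKpos : 0 < K := by positivity
  induction n using Nat.strong_induction_on with
  | _ n IHn =>
  intro x hx hxu hx4
  set l := Real.log x with hl
  set u := l / Real.log n with hu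
  have hn' : (2 : ℝ) ≤ n := by exact_mod_cast hn
  have hln : 0 < Real.log n := Real.log_pos (by linarith)
  have hlu : u * Real.log n = l := by rw [hu]; field_simp
  have hu0 : 8 ≤ u := by linarith
  have hl0 : 0 < l := by
    have : 0 < u ^ 4 := by positivity
    linarith
  by_cases h1 : u ≤ U
  · have hnx : (n : ℝ) ≤ x := by
      rw [← Real.log_le_log_iff (by linarith) hx, ← hl]
      nlinarith
    have h2 := hb n hn x hnx (by rw [← hl]; nlinarith)
    refine h2.trans ?_
    rw [← hl]
    have h3 : hh U ≤ HH a l u := by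
      have := hh_anti (by linarith) h1
      unfold HH
      have : 0 < Real.exp (-(a * u)) / l := by positivity
      linarith
    have h4 : C₁ ≤ K * HH a l u := by
      calc C₁ = C₁ / hh U * hh U := by field_simp
        _ ≤ K * HH a l u := by
          apply mul_le_mul _ h3 hhU.le hKpos.le
          rw [hK]; have : 0 ≤ C₂ * ((Nat.factorial 40 : ℕ) : ℝ) := by positivity
          linarith
    calc C₁ * x / l ≤ (K * HH a l u) * x / l := by gcongr
      _ = _ := by ring
  push Not at h1
  by_cases h2 : u ^ 8 ≤ l
  · exact step ha hKpos hU10 (by linarith) hC (by linarith) hps hx hl hn hu h1.le h2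
      (fun m hm hmn => IHn m hmn hm)
  push Not at h2
  have hln3 : 2 * (a + 1) ≤ Real.log n := by
    have b1 : u ^ 3 ≤ Real.log n := by
      have : u ^ 4 = u * u ^ 3 := by ring
      rw [this] at hx4
      nlinarith
    have b2 : u ≤ u ^ 3 := by
      have : (1:ℝ) ≤ u := by linarith
      exact le_self_pow₀ this (by norm_num)
    linarith
  have h3 := hr n hn hln3 x hx
  rw [← hl, ← hu] at h3
  refine h3.trans ?_
  have h4 : Real.log n ^ 3 ≤ l ^ 3 := by
    apply pow_le_pow_left₀ hln.le; nlinarith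
  have h5 : l ^ 5 ≤ u ^ 40 := by
    have := pow_le_pow_left₀ hl0.le h2.le 5
    rwa [← pow_mul] at this
  have h6 : u ^ 40 ≤ (Nat.factorial 40 : ℕ) * Real.exp u := by
    have := Real.pow_div_factorial_le_exp u (by linarith) 40
    rwa [div_le_iff₀ (by positivity), mul_comm] at this
  have e1 : Real.exp (-(a + 1) * u) = Real.exp (-(a * u)) * (Real.exp u)⁻¹ := by
    rw [← Real.exp_neg, ← Real.exp_add]; congr 1; ring
  have hel := Real.exp_pos (-(a * u))
  have heu := Real.exp_pos u
  calc C₂ * x * Real.exp (-(a + 1) * u) * Real.log n ^ 3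
      ≤ C₂ * x * Real.exp (-(a + 1) * u) * l ^ 3 := by gcongr
    _ = C₂ * x * Real.exp (-(a * u)) * (Real.exp u)⁻¹ * l ^ 5 / l ^ 2 := by rw [e1]; field_simp
    _ ≤ C₂ * x * Real.exp (-(a * u)) * (Real.exp u)⁻¹ * ((Nat.factorial 40 : ℕ) * Real.exp u) / l ^ 2 := by
        gcongr; exact h5.trans h6
    _ = (C₂ * (Nat.factorial 40 : ℕ)) * (x / l) * (Real.exp (-(a * u)) / l) := by field_simp
    _ ≤ K * (x / l) * HH a l u := by
        have b1 : C₂ * ((Nat.factorial 40 : ℕ) : ℝ) ≤ K := by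
          rw [hK]; have : 0 < C₁ / hh U := by positivity
          linarith
        have b2 : Real.exp (-(a * u)) / l ≤ HH a l u := by
          unfold HH; have := hh_pos u; linarith
        gcongr

lemma EE_final : ∃ C : ℝ, 0 < C ∧ ∀ n : ℕ, 2 ≤ n → ∀ x L : ℝ, (n : ℝ) ≤ x → Real.log n ≤ L → L ≤ 2 * Real.log n →
    L ≤ Real.log x → |EE n x| ≤ C * (x * Real.log x / L ^ 2) * (1 / Real.log x + hh (Real.log x / L)) := by
  obtain ⟨U, hU, K, hK, hI⟩ := induction_main
  obtain ⟨C₁, hC₁, hb⟩ := base_bound U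
  obtain ⟨C₂, hC₂, hr⟩ := rankin (c := 1 / 8) (by norm_num)
  have hhU := hh_pos U
  set D := C₁ / hh U + K + C₂ * (4 * 8 ^ 20 * (Nat.factorial 20 : ℕ)) with hD
  refine ⟨D, by positivity, fun n hn x L hnx hnL hLn hLx => ?_⟩
  have hD1 : C₁ / hh U ≤ D := by
    have : 0 ≤ C₂ * (4 * 8 ^ 20 * ((Nat.factorial 20 : ℕ) : ℝ)) := by positivity
    linarith
  have hD2 : K ≤ D := by
    have : 0 ≤ C₂ * (4 * 8 ^ 20 * ((Nat.factorial 20 : ℕ) : ℝ)) := by positivity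
    have : 0 < C₁ / hh U := by positivity
    linarith
  have hD3 : C₂ * (4 * 8 ^ 20 * (Nat.factorial 20 : ℕ)) ≤ D := by
    have : 0 < C₁ / hh U := by positivity
    linarith
  have hD0 : 0 < D := by linarith
  set l := Real.log x with hl
  have hn' : (2 : ℝ) ≤ n := by exact_mod_cast hn
  have hx0 : 0 < x := by linarith
  set v := Real.log n with hv
  have hv2 : Real.log 2 ≤ v := Real.log_le_log (by norm_num) hn'
  have hl2 := Real.log_two_gt_d9
  have hv0 : 0 < v := by linarith
  have hL0 : 0 < L := by linarith
  have hl0 : 0 < l := by linarith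
  have hu1 : 1 ≤ l / L := by rw [le_div_iff₀ hL0]; linarith
  have huv : l / L ≤ l / v := by gcongr
  have hhp := hh_pos (l / L)
  have hxl : x / l ≤ x * l / L ^ 2 := by
    rw [div_le_div_iff₀ hl0 (by positivity)]
    have : L ^ 2 ≤ l ^ 2 := pow_le_pow_left₀ hL0.le hLx 2
    calc x * L ^ 2 ≤ x * l ^ 2 := by gcongr
      _ = _ := by ring
  by_cases h1 : l / v ≤ U
  · have h2 := hb n hn x hnx (by rwa [← hl, ← hv, ← div_le_iff₀ hv0])
    rw [← hl] at h2
    have h3 : hh U ≤ hh (l / L) := hh_anti hu1 (huv.trans h1)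
    have h4 : hh U ≤ 1 / l + hh (l / L) := by
      have : 0 < 1 / l := by positivity
      linarith
    calc |EE n x| ≤ C₁ * x / l := h2
      _ = C₁ / hh U * (x / l) * hh U := by field_simp
      _ ≤ D * (x * l / L ^ 2) * (1 / l + hh (l / L)) := by gcongr
  push Not at h1
  have hU' : (10 : ℝ) ≤ U := by exact_mod_cast hU
  by_cases h2 : (l / v) ^ 4 ≤ l
  · have h3 := hI n hn x hx0 (by rw [← hl, ← hv]; linarith) h2
    rw [← hl, ← hv] at h3
    refine h3.trans ?_
    have h4 : HH (80 * Real.log 2) l (l / v) ≤ 1 / l + hh (l / L) := by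
      unfold HH
      have b1 := hh_anti hu1 huv
      have b2 : Real.exp (-(80 * Real.log 2 * (l / v))) ≤ 1 := by
        rw [Real.exp_le_one_iff, neg_nonpos]
        have : 0 < Real.log 2 := by linarith
        positivity
      have b3 : Real.exp (-(80 * Real.log 2 * (l / v))) / l ≤ 1 / l := by gcongr
      linarith
    have h5 := HH_pos (80 * Real.log 2) (l / v) hl0
    gcongr
  push Not at h2
  have h3 := hr n hn (by rw [← hv]; linarith) x hx0
  rw [← hl, ← hv] at h3
  set w := l / v with hw
  have hw0 : 0 < w := by linarith
  have hvl : v ≤ l := by linarith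
  have b1 : v ^ 3 * L ^ 2 ≤ 4 * l ^ 5 := by
    calc v ^ 3 * L ^ 2 ≤ l ^ 3 * (2 * l) ^ 2 := by
          gcongr; linarith
      _ = _ := by ring
  have b2 : l ^ 5 ≤ w ^ 20 := by
    have := pow_le_pow_left₀ hl0.le h2.le 5
    rwa [← pow_mul] at this
  have b3 : w ^ 20 ≤ 8 ^ 20 * (Nat.factorial 20 : ℕ) * Real.exp (w / 8) := by
    have := Real.pow_div_factorial_le_exp (w / 8) (by positivity) 20
    rw [div_le_iff₀ (by positivity), div_pow, div_le_iff₀ (by positivity)] at this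
    refine this.trans (le_of_eq ?_)
    ring
  have e1 : Real.exp (-(1 / 8) * w) = (Real.exp (w / 8))⁻¹ := by
    rw [← Real.exp_neg]; congr 1; ring
  have he := Real.exp_pos (w / 8)
  calc |EE n x| ≤ C₂ * x * Real.exp (-(1 / 8) * w) * v ^ 3 := h3
    _ = C₂ * x * (Real.exp (w / 8))⁻¹ * (v ^ 3 * L ^ 2) / L ^ 2 := by rw [e1]; field_simp
    _ ≤ C₂ * x * (Real.exp (w / 8))⁻¹ * (4 * (8 ^ 20 * (Nat.factorial 20 : ℕ) * Real.exp (w / 8))) / L ^ 2 := by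
        have : v ^ 3 * L ^ 2 ≤ 4 * (8 ^ 20 * (Nat.factorial 20 : ℕ) * Real.exp (w / 8)) := by linarith
        gcongr
    _ = (C₂ * (4 * 8 ^ 20 * (Nat.factorial 20 : ℕ))) * (x * l / L ^ 2) * (1 / l) := by
        generalize ((Nat.factorial 20 : ℕ) : ℝ) = F
        field_simp
    _ ≤ D * (x * l / L ^ 2) * (1 / l + hh (l / L)) := by
        gcongr
        linarith

open Classical in
lemma sum_eq_TT {x y : ℝ} (hy : 2 ≤ y) :
    ∑ n ∈ (Finset.Icc 1 ⌊x⌋₊).filter (fun n => n = 1 ∨ y < (n.minFac : ℝ)), (n.divisors.card : ℝ)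
      = TT ⌊y⌋₊ ⌊x⌋₊ := by
  unfold TT ft
  rw [Finset.sum_filter]
  refine Finset.sum_congr rfl fun k hk => ?_
  have : (k = 1 ∨ y < (k.minFac : ℝ)) ↔ Rough ⌊y⌋₊ k := by
    constructor
    · rintro (rfl | h) p hp hpk
      · exact absurd (Nat.dvd_one.1 hpk) hp.ne_one
      · rw [Nat.floor_lt (by linarith)]
        have : (k.minFac : ℝ) ≤ p := by exact_mod_cast Nat.minFac_le_of_dvd hp.two_le hpk
        linarith
    · intro h
      by_cases h1 : k = 1
      · exact Or.inl h1
      · right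
        have := h _ (Nat.minFac_prime h1) (Nat.minFac_dvd k)
        rwa [Nat.floor_lt (by linarith)] at this
  simp only [this]

lemma final_aux : ∃ C : ℝ, ∀ x y : ℝ, 2 ≤ y → y ≤ x →
    |TT ⌊y⌋₊ ⌊x⌋₊ - x * Real.log (x * y ^ 2) * (VV ⌊y⌋₊) ^ 2| ≤
      C * (x * Real.log (x * y ^ 2) * (VV ⌊y⌋₊) ^ 2) *
        (1 / Real.log x + (Real.log x / Real.log y) ^ (-(Real.log x / Real.log y))) := by
  obtain ⟨C₁, hC₁, hE⟩ := EE_final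
  obtain ⟨C₂, hC₂, hV⟩ := VV_lower
  obtain ⟨C₃, hC₃, hLL⟩ := LL_abs
  set G := |2 * Real.eulerMascheroniConstant - 1| with hG
  refine ⟨C₁ * C₂ ^ 2 + (G + 2 * (C₃ + 1)), fun x y hy hyx => ?_⟩
  set n := ⌊y⌋₊ with hn
  have hn2 : 2 ≤ n := Nat.le_floor (by exact_mod_cast hy)
  have hn' : (2 : ℝ) ≤ n := by exact_mod_cast hn2
  have hny : (n : ℝ) ≤ y := Nat.floor_le (by linarith)
  have hyn : y < n + 1 := Nat.lt_floor_add_one y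
  have hx0 : 0 < x := by linarith
  have hy0 : 0 < y := by linarith
  have e1 : Real.log (x * y ^ 2) = Real.log x + 2 * Real.log y := by
    rw [Real.log_mul hx0.ne' (by positivity), Real.log_pow]; norm_num
  rw [e1]
  have hLx : Real.log y ≤ Real.log x := Real.log_le_log hy0 hyx
  have hl2 : 0 < Real.log 2 := Real.log_pos (by norm_num)
  have hl2' := Real.log_two_lt_d9
  have hvL : Real.log n ≤ Real.log y := Real.log_le_log (by linarith) hny
  have h2v : Real.log 2 ≤ Real.log n := Real.log_le_log (by norm_num) hn'
  have hLv : Real.log y ≤ Real.log n + Real.log 2 := by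
    rw [← Real.log_mul (by linarith) (by norm_num)]
    exact Real.log_le_log hy0 (by linarith)
  have hEE := hE n hn2 x (Real.log y) (by linarith) hvL (by linarith) hLx
  have hVn := hV n hn2
  have hL := hLL n (by omega)
  set l := Real.log x with hl
  set L := Real.log y with hLdef
  have hL0 : 0 < L := by linarith
  have hl0 : 0 < l := by linarith
  have hu0 : 0 < l / L := by positivity
  have e2 : (l / L) ^ (-(l / L)) = hh (l / L) := by
    rw [Real.rpow_def_of_pos hu0]; unfold hh; congr 1; ring
  rw [e2]
  have hhp := hh_pos (l / L)
  have hVp := VV_pos n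
  set V := VV n with hVdef
  have hT : x * l * V ^ 2 ≤ x * (l + 2 * L) * V ^ 2 := by gcongr; linarith
  have hV1 : 1 / L ^ 2 ≤ C₂ ^ 2 * V ^ 2 := by
    have b1 : 1 ≤ C₂ * V * L := by
      have : V⁻¹ * V ≤ C₂ * Real.log n * V := mul_le_mul_of_nonneg_right hVn hVp.le
      rw [inv_mul_cancel₀ hVp.ne'] at this
      calc 1 ≤ C₂ * Real.log n * V := this
        _ ≤ C₂ * L * V := by gcongr
        _ = _ := by ring
    rw [div_le_iff₀ (by positivity)]
    calc (1 : ℝ) = 1 ^ 2 := by norm_num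
      _ ≤ (C₂ * V * L) ^ 2 := pow_le_pow_left₀ (by norm_num) b1 2
      _ = _ := by ring
  have hE2 : |EE n x| ≤ C₁ * C₂ ^ 2 * (x * (l + 2 * L) * V ^ 2) * (1 / l + hh (l / L)) := by
    refine hEE.trans ?_
    have : x * l / L ^ 2 ≤ C₂ ^ 2 * (x * (l + 2 * L) * V ^ 2) := by
      calc x * l / L ^ 2 = x * l * (1 / L ^ 2) := by ring
        _ ≤ x * l * (C₂ ^ 2 * V ^ 2) := by gcongr
        _ = C₂ ^ 2 * (x * l * V ^ 2) := by ring
        _ ≤ _ := by gcongr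
    calc C₁ * (x * l / L ^ 2) * (1 / l + hh (l / L))
        ≤ C₁ * (C₂ ^ 2 * (x * (l + 2 * L) * V ^ 2)) * (1 / l + hh (l / L)) := by gcongr
      _ = _ := by ring
  have hM : |MM n x - x * (l + 2 * L) * V ^ 2| ≤
      (G + 2 * (C₃ + 1)) * (x * (l + 2 * L) * V ^ 2) * (1 / l + hh (l / L)) := by
    have b0 : MM n x - x * (l + 2 * L) * V ^ 2 =
        x * V ^ 2 * ((2 * Real.eulerMascheroniConstant - 1) + 2 * (LL n - L)) := by
      unfold MM; rw [← hl, ← hVdef]; ring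
    rw [b0, abs_mul, abs_of_nonneg (by positivity : 0 ≤ x * V ^ 2)]
    have b1 : |(2 * Real.eulerMascheroniConstant - 1) + 2 * (LL n - L)| ≤ G + 2 * (C₃ + 1) := by
      have a1 := abs_le.1 hL
      have a4 := neg_abs_le (2 * Real.eulerMascheroniConstant - 1)
      have a5 := le_abs_self (2 * Real.eulerMascheroniConstant - 1)
      rw [← hG] at a4 a5
      rw [abs_le]
      constructor <;> linarith
    have hG0 : 0 ≤ G := abs_nonneg _
    calc x * V ^ 2 * |(2 * Real.eulerMascheroniConstant - 1) + 2 * (LL n - L)|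
        ≤ x * V ^ 2 * (G + 2 * (C₃ + 1)) := by gcongr
      _ = (G + 2 * (C₃ + 1)) * (x * l * V ^ 2) * (1 / l) := by field_simp
      _ ≤ _ := by
        gcongr
        linarith
  have e3 : TT n ⌊x⌋₊ - x * (l + 2 * L) * V ^ 2 = EE n x + (MM n x - x * (l + 2 * L) * V ^ 2) := by
    unfold EE; ring
  rw [e3]
  refine (abs_add_le _ _).trans ((add_le_add hE2 hM).trans (le_of_eq ?_))
  ring

theorem cor0_first_estimate :
    ∃ C : ℝ, ∀ x y : ℝ, 2 ≤ y → y ≤ x →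
      |S x y - x * Real.log (x * y ^ 2) * (primeProd y) ^ 2| ≤
        C * (x * Real.log (x * y ^ 2) * (primeProd y) ^ 2) *
          (1 / Real.log x +
            (Real.log x / Real.log y) ^ (-(Real.log x / Real.log y))) := by
  obtain ⟨C, hC⟩ := final_aux
  refine ⟨C, fun x y hy hyx => ?_⟩
  have h := hC x y hy hyx
  have e : S x y = TT ⌊y⌋₊ ⌊x⌋₊ := by
    rw [← sum_eq_TT hy]
    unfold S
    congr
  rw [e]
  exact h
end

section
/- The following three bounds hold: |ξ''(u)| < 2^u / (7 Γ(u+1)) for all u ≥ 3.5; |ξ'(u) − e^{−2γ}| < 2^u / (7 Γ(u+1)) for all u ≥ 2.5; and |ξ(u) − (u+2) e^{−2γ}| < 2^u / (7 Γ(u+1)) for all u ≥ 1.5. (Here ξ is continuously differentiable for u > 2 and twice continuously differentiable for u > 3, and Γ is the Gamma function.) -/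
open Real MeasureTheory

noncomputable def xiB (u : ℝ) : ℝ := (2:ℝ) ^ u / (7 * Real.Gamma (u + 1))

theorem xiB_pos {u : ℝ} (hu : 0 ≤ u) : 0 < xiB u := by
  have := Real.Gamma_pos_of_pos (show 0 < u + 1 by linarith)
  unfold xiB; positivity

theorem xiB_rec {u : ℝ} (hu : 1 ≤ u) : u * xiB u = 2 * xiB (u - 1) := by
  have h1 := Real.Gamma_add_one (show u ≠ 0 by linarith)
  have := Real.Gamma_pos_of_pos (show 0 < u by linarith)
  unfold xiB
  rw [h1, show u - 1 + 1 = u by ring, Real.rpow_sub_one (by norm_num)]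
  field_simp

theorem xiB_nat (n : ℕ) : xiB n = 2 ^ n / (7 * n.factorial) := by
  unfold xiB
  rw [Real.Gamma_nat_eq_factorial, Real.rpow_natCast]

theorem xiB_lower (n : ℕ) (x : ℝ) (hx : 0 ≤ x) (hx1 : x ≤ 1) :
    (2 ^ n / (7 * n.factorial)) * (2 / (n + 1) : ℝ) ^ x ≤ xiB (n + x) := by
  have hG : Real.Gamma (n + x + 1) ≤ n.factorial * ((n:ℝ) + 1) ^ x := by
    have h0 := Real.Gamma_pos_of_pos (show (0:ℝ) < n + 1 by positivity)
    have h2 : Real.Gamma ((n:ℝ) + 1 + 1) = (n + 1) * Real.Gamma (n + 1) :=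
      Real.Gamma_add_one (by positivity)
    rcases hx.eq_or_lt with rfl | hx
    · simp [Real.Gamma_nat_eq_factorial]
    rcases hx1.eq_or_lt with rfl | hx1
    · rw [Real.rpow_one, h2, Real.Gamma_nat_eq_factorial, mul_comm]
    have := Real.Gamma_mul_add_mul_le_rpow_Gamma_mul_rpow_Gamma
      (show (0:ℝ) < n + 1 by positivity) (show (0:ℝ) < n + 1 + 1 by positivity)
      (show 0 < 1 - x by linarith) hx (by ring)
    rw [h2, Real.mul_rpow (by positivity) h0.le] at this
    rw [show (1 - x) * ((n:ℝ) + 1) + x * (n + 1 + 1) = n + x + 1 by ring] at this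
    refine this.trans_eq ?_
    rw [mul_left_comm, ← Real.rpow_add h0, ← Real.Gamma_nat_eq_factorial]
    simp [mul_comm]
  have hp := Real.Gamma_pos_of_pos (show (0:ℝ) < n + x + 1 by positivity)
  unfold xiB
  rw [Real.rpow_add (by norm_num), Real.div_rpow (by norm_num) (by positivity), Real.rpow_natCast,
    div_mul_div_comm]
  refine div_le_div_of_nonneg_left (by positivity) (by positivity) ?_
  nlinarith

theorem xiB_anti {u v : ℝ} (hu : 2 ≤ u) (huv : u ≤ v) : xiB v ≤ xiB u := by
  rcases huv.eq_or_lt with rfl | huv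
  · rfl
  have hc := Real.convexOn_log_Gamma
  have g2 : Real.Gamma 2 = 1 := Real.Gamma_two
  have g3 : Real.Gamma 3 = 2 := by
    have := Real.Gamma_nat_eq_factorial 2
    norm_num at this
    simp
  have hlu : (u - 2) * Real.log 2 ≤ Real.log (Real.Gamma (u + 1)) - Real.log 2 := by
    rcases hu.eq_or_lt with rfl | hu
    · norm_num [g3]
    have := hc.slope_mono_adjacent (x := 2) (y := 3) (z := u + 1) (by simp) (by simp; linarith)
      (by norm_num) (by linarith)
    simp only [Function.comp, g2, g3, Real.log_one] at this
    rw [le_div_iff₀ (by linarith)] at this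
    linarith
  have h3 := hc.slope_mono_adjacent (x := 2) (y := u + 1) (z := v + 1) (by simp) (by simp; linarith)
      (by linarith) (by linarith)
  simp only [Function.comp, g2, Real.log_one] at h3
  have hl : Real.log 2 ≤ (Real.log (Real.Gamma (u + 1)) - 0) / (u + 1 - 2) := by
    rw [le_div_iff₀ (by linarith)]; linarith
  have h4 := hl.trans h3
  rw [le_div_iff₀ (by linarith)] at h4
  have gu := Real.Gamma_pos_of_pos (show 0 < u + 1 by linarith)
  have gv := Real.Gamma_pos_of_pos (show 0 < v + 1 by linarith)
  have h5 : (2:ℝ) ^ (v - u) * Real.Gamma (u + 1) ≤ Real.Gamma (v + 1) := by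
    rw [← Real.log_le_log_iff (by positivity) gv, Real.log_mul (by positivity) gu.ne',
      Real.log_rpow (by norm_num)]
    linarith
  unfold xiB
  rw [show v = u + (v - u) by ring, Real.rpow_add (by norm_num), show u + (v - u) = v by ring]
  rw [div_le_div_iff₀ (by positivity) (by positivity)]
  have : (0:ℝ) < 2 ^ u := by positivity
  nlinarith

theorem xiB_decay {u : ℝ} (hu : 5 ≤ u) : xiB u ≤ 5 / u ^ 3 := by
  have h1 := xiB_rec (show 1 ≤ u by linarith)
  have h2 := xiB_rec (show 1 ≤ u - 1 by linarith)
  have h3 := xiB_rec (show 1 ≤ u - 1 - 1 by linarith)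
  have h4 := xiB_anti le_rfl (show 2 ≤ u - 1 - 1 - 1 by linarith)
  have h5 : xiB 2 = 2 / 7 := by
    have := xiB_nat 2
    norm_num [Nat.factorial] at this; exact this
  rw [h5] at h4
  have hp := xiB_pos (show 0 ≤ u by linarith)
  have e : u * ((u - 1) * ((u - 1 - 1) * xiB u)) = 8 * xiB (u - 1 - 1 - 1) := by
    calc _ = (u - 1) * (u - 1 - 1) * (u * xiB u) := by ring
      _ = 2 * (u - 1 - 1) * ((u - 1) * xiB (u - 1)) := by rw [h1]; ring
      _ = 4 * ((u - 1 - 1) * xiB (u - 1 - 1)) := by rw [h2]; ring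
      _ = _ := by rw [h3]; ring
  rw [le_div_iff₀ (by positivity)]
  have k : u ^ 3 * (12 / 25) ≤ u * ((u - 1) * (u - 1 - 1)) := by
    have : (4 / 5 * u) * (3 / 5 * u) ≤ (u - 1) * (u - 1 - 1) := by
      apply mul_le_mul <;> linarith
    nlinarith
  have : xiB u * (u ^ 3 * (12 / 25)) ≤ 16 / 7 := by
    calc _ ≤ xiB u * (u * ((u - 1) * (u - 1 - 1))) := by gcongr
      _ = u * ((u - 1) * ((u - 1 - 1) * xiB u)) := by ring
      _ ≤ _ := by rw [e]; linarith
  linarith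

theorem xiB_12 {u : ℝ} (h1 : 1 ≤ u) (h2 : u ≤ 2) : 2 / 7 ≤ xiB u := by
  have := xiB_lower 1 (u - 1) (by linarith) (by linarith)
  norm_num at this
  convert this using 1

theorem rpow_lin {r L : ℝ} (hr : 0 < r) (hL : -L ≤ Real.log r) {x : ℝ} (hx : 0 ≤ x) :
    1 - L * x ≤ r ^ x := by
  rw [Real.rpow_def_of_pos hr]
  have := Real.add_one_le_exp (Real.log r * x)
  nlinarith

theorem log_15 : (0.4054:ℝ) < Real.log 1.5 ∧ Real.log 1.5 < 0.4055 := by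
  have h1 := Real.sum_range_le_log_div (x := 1/5) (by norm_num) (by norm_num) 4
  have h2 := Real.log_div_le_sum_range_add (x := 1/5) (by norm_num) (by norm_num) 4
  norm_num [Finset.sum_range_succ] at h1 h2 ⊢
  constructor <;> linarith

theorem log_125 : (0.2231:ℝ) < Real.log 1.25 ∧ Real.log 1.25 < 0.2232 := by
  have h1 := Real.sum_range_le_log_div (x := 1/9) (by norm_num) (by norm_num) 4
  have h2 := Real.log_div_le_sum_range_add (x := 1/9) (by norm_num) (by norm_num) 4
  norm_num [Finset.sum_range_succ] at h1 h2 ⊢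
  constructor <;> linarith

theorem log_175 : (0.5595:ℝ) < Real.log 1.75 ∧ Real.log 1.75 < 0.5597 := by
  have h1 := Real.sum_range_le_log_div (x := 3/11) (by norm_num) (by norm_num) 4
  have h2 := Real.log_div_le_sum_range_add (x := 3/11) (by norm_num) (by norm_num) 4
  norm_num [Finset.sum_range_succ] at h1 h2 ⊢
  constructor <;> linarith

theorem xiB_23 {u : ℝ} (h1 : 2 ≤ u) (h2 : u ≤ 3) : 2 / 7 * (1 - 0.4055 * (u - 2)) ≤ xiB u := by
  have := xiB_lower 2 (u - 2) (by linarith) (by linarith)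
  have h := rpow_lin (r := 2/3) (L := 0.4055) (by norm_num) (by
    rw [show (2/3:ℝ) = (1.5)⁻¹ by norm_num, Real.log_inv]; linarith [log_15.2]) (x := u - 2) (by linarith)
  norm_num [Nat.factorial] at this h ⊢
  linarith

theorem xiB_34 {u : ℝ} (h1 : 3 ≤ u) (h2 : u ≤ 4) : 4 / 21 * (1 - 0.6932 * (u - 3)) ≤ xiB u := by
  have := xiB_lower 3 (u - 3) (by linarith) (by linarith)
  have h := rpow_lin (r := 1/2) (L := 0.6932) (by norm_num) (by
    rw [show (1/2:ℝ) = (2)⁻¹ by norm_num, Real.log_inv]; linarith [Real.log_two_lt_d9])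
      (x := u - 3) (by linarith)
  norm_num [Nat.factorial] at this h ⊢
  linarith

theorem xiB_45 {u : ℝ} (h1 : 4 ≤ u) (h2 : u ≤ 5) : 2 / 21 * (1 - 0.9164 * (u - 4)) ≤ xiB u := by
  have := xiB_lower 4 (u - 4) (by linarith) (by linarith)
  have h := rpow_lin (r := 2/5) (L := 0.9164) (by norm_num) (by
    rw [show (2/5:ℝ) = (1.25)⁻¹ * 2⁻¹ by norm_num, Real.log_mul (by norm_num) (by norm_num), Real.log_inv, Real.log_inv]
    linarith [Real.log_two_lt_d9, log_125.2])
      (x := u - 4) (by linarith)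
  norm_num [Nat.factorial] at this h ⊢
  linarith

theorem xiB_three : xiB 3 = 4 / 21 := by
  have := xiB_nat 3
  norm_num [Nat.factorial] at this; exact this

theorem xiB_four : xiB 4 = 2 / 21 := by
  have := xiB_nat 4
  norm_num [Nat.factorial] at this; exact this

noncomputable def xiPhi : ℝ → ℝ := dslope (fun t => -Real.exp (-t)) 0

theorem xiPhi_cont : Continuous xiPhi := by
  rw [← continuousOn_univ]
  refine (continuousOn_dslope Filter.univ_mem).2 ⟨by fun_prop, by fun_prop⟩

theorem xiPhi_ne {t : ℝ} (ht : t ≠ 0) : xiPhi t = (1 - Real.exp (-t)) / t := by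
  unfold xiPhi
  rw [dslope_of_ne _ ht, slope_def_field]
  simp
  ring

noncomputable def xiEin (s : ℝ) : ℝ := ∫ t in (0:ℝ)..s, xiPhi t

theorem xiEin_deriv (s : ℝ) : HasDerivAt xiEin (xiPhi s) s :=
  intervalIntegral.integral_hasDerivAt_right (xiPhi_cont.intervalIntegrable _ _)
    (xiPhi_cont.stronglyMeasurableAtFilter _ _) xiPhi_cont.continuousAt

theorem xi_harm (n : ℕ) (hn : 0 < n) :
    ∫ t in (0:ℝ)..n, (1 / (n:ℝ)) * ∑ k ∈ Finset.range n, (1 - t / n) ^ k = (harmonic n : ℝ) := by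
  have hn' : (n:ℝ) ≠ 0 := by positivity
  rw [intervalIntegral.integral_const_mul, intervalIntegral.integral_finsetSum]
  · rw [Finset.mul_sum, harmonic]
    push_cast
    refine Finset.sum_congr rfl fun k _ => ?_
    have := intervalIntegral.integral_comp_sub_div (a := 0) (b := (n:ℝ)) (fun x => x ^ k) hn' 1
    rw [this, div_self hn']
    simp
    field_simp
  · intro k _
    apply Continuous.intervalIntegrable
    fun_prop

theorem xi_te (n : ℕ) : ∫ t in (0:ℝ)..n, t * Real.exp (-t) ≤ 1 := by
  have : ∀ t ∈ Set.uIcc (0:ℝ) n, HasDerivAt (fun t => -((t + 1) * Real.exp (-t))) (t * Real.exp (-t)) t := by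
    intro t _
    have h := (((hasDerivAt_id t).add_const 1).mul ((hasDerivAt_id t).neg.exp)).neg
    refine HasDerivAt.congr_deriv h ?_
    simp only [id, Pi.neg_apply]
    ring
  rw [intervalIntegral.integral_eq_sub_of_hasDerivAt this
    (Continuous.intervalIntegrable (by fun_prop) _ _)]
  simp
  positivity

theorem xi_exp_pow {n : ℕ} (hn : 0 < n) {t : ℝ} (h0 : 0 ≤ t) (h1 : t ≤ n) :
    Real.exp (-t) - (1 - t / n) ^ n ≤ t ^ 2 * Real.exp (-t) / n := by
  have hn' : (0:ℝ) < n := by positivity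
  have hx1 : t / n ≤ 1 := by rw [div_le_one hn']; exact h1
  have hx0 : 0 ≤ t / n := by positivity
  have e1 : (1 + t / n) ^ n ≤ Real.exp t := by
    have : Real.exp t = (Real.exp (t / n)) ^ n := by
      rw [← Real.exp_nat_mul]; congr 1; field_simp
    rw [this]
    gcongr
    linarith [Real.add_one_le_exp (t / n)]
  have e2 : 1 - t ^ 2 / n ≤ (1 - t / n) ^ n * (1 + t / n) ^ n := by
    rw [← mul_pow]
    have := one_add_mul_le_pow (a := -(t / n) ^ 2) (by nlinarith) n
    have h2 : (1 - t / n) * (1 + t / n) = 1 + -(t / n) ^ 2 := by ring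
    rw [h2]
    refine le_trans (le_of_eq ?_) this
    field_simp
    ring
  have e3 : 1 - t ^ 2 / n ≤ (1 - t / n) ^ n * Real.exp t :=
    e2.trans (mul_le_mul_of_nonneg_left e1 (pow_nonneg (by linarith) _))
  have e4 := mul_le_mul_of_nonneg_right e3 (Real.exp_pos (-t)).le
  rw [mul_assoc, ← Real.exp_add] at e4
  simp only [add_neg_cancel, Real.exp_zero, mul_one] at e4
  have : t ^ 2 * Real.exp (-t) / n = t ^ 2 / n * Real.exp (-t) := by ring
  linarith

theorem xiEin_near (n : ℕ) (hn : 0 < n) :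
    0 ≤ (harmonic n : ℝ) - xiEin n ∧ (harmonic n : ℝ) - xiEin n ≤ 1 / n := by
  have hn' : (0:ℝ) < n := by positivity
  rw [← xi_harm n hn]
  unfold xiEin
  have c1 : Continuous fun t : ℝ => (1 / (n:ℝ)) * ∑ k ∈ Finset.range n, (1 - t / n) ^ k := by fun_prop
  rw [← intervalIntegral.integral_sub (c1.intervalIntegrable _ _) (xiPhi_cont.intervalIntegrable _ _)]
  have key : ∀ t ∈ Set.Ioo (0:ℝ) n, (1 / (n:ℝ)) * ∑ k ∈ Finset.range n, (1 - t / n) ^ k - xiPhi t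
      = (Real.exp (-t) - (1 - t / n) ^ n) / t := by
    intro t ht
    have ht0 := ht.1
    rw [xiPhi_ne ht.1.ne']
    have hg := mul_neg_geom_sum (1 - t / n) n
    have hd : 1 - (1 - t / n) = t / n := by ring
    rw [hd] at hg
    have : (1 / (n:ℝ)) * ∑ k ∈ Finset.range n, (1 - t / n) ^ k = (1 - (1 - t / n) ^ n) / t := by
      rw [← hg]; field_simp
    rw [this]; ring
  constructor
  · have := intervalIntegral.integral_mono_on_of_le_Ioo (a := 0) (b := (n:ℝ)) (f := fun _ => 0)
      (g := fun t => (1 / (n:ℝ)) * ∑ k ∈ Finset.range n, (1 - t / n) ^ k - xiPhi t)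
      (μ := volume) hn'.le (by simp) ((c1.sub xiPhi_cont).intervalIntegrable _ _) (by
        intro t ht
        rw [key t ht]
        apply div_nonneg _ ht.1.le
        linarith [Real.one_sub_div_pow_le_exp_neg ht.2.le])
    simpa using this
  · have := intervalIntegral.integral_mono_on_of_le_Ioo (a := 0) (b := (n:ℝ))
      (g := fun t => (1 / (n:ℝ)) * (t * Real.exp (-t)))
      (f := fun t => (1 / (n:ℝ)) * ∑ k ∈ Finset.range n, (1 - t / n) ^ k - xiPhi t)
      (μ := volume) hn'.le  ((c1.sub xiPhi_cont).intervalIntegrable _ _)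
      (Continuous.intervalIntegrable (by fun_prop) _ _) (by
        intro t ht
        have ht0 := ht.1
        rw [key t ht, div_le_iff₀ ht.1]
        refine (xi_exp_pow hn ht.1.le ht.2.le).trans (le_of_eq ?_)
        ring)
    refine this.trans ?_
    rw [intervalIntegral.integral_const_mul]
    have := xi_te n
    have h3 : 0 ≤ 1 / (n:ℝ) := by positivity
    nlinarith

theorem xiEin_lim : Filter.Tendsto (fun n : ℕ => xiEin n - Real.log n) Filter.atTop
    (nhds Real.eulerMascheroniConstant) := by
  have h0 : Filter.Tendsto (fun n : ℕ => (harmonic n : ℝ) - xiEin n) Filter.atTop (nhds 0) := by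
    refine squeeze_zero' ?_ ?_ tendsto_one_div_atTop_nhds_zero_nat
    · filter_upwards [Filter.eventually_gt_atTop 0] with n hn using (xiEin_near n hn).1
    · filter_upwards [Filter.eventually_gt_atTop 0] with n hn using (xiEin_near n hn).2
  have := Real.tendsto_harmonic_sub_log.sub h0
  simp only [sub_zero] at this
  refine this.congr fun n => by ring

theorem xi_c_bounds : 0.305 < Real.exp (-2 * Real.eulerMascheroniConstant) ∧
    Real.exp (-2 * Real.eulerMascheroniConstant) < 0.319 := by
  have h1 := Real.eulerMascheroniSeq_lt_eulerMascheroniConstant 127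
  have h2 := Real.eulerMascheroniConstant_lt_eulerMascheroniSeq' 128
  have e1 : Real.log 128 = 7 * Real.log 2 := by
    rw [show (128:ℝ) = 2 ^ 7 by norm_num, Real.log_pow]; norm_num
  have l1 := Real.log_two_lt_d9
  have l2 := Real.log_two_gt_d9
  have g1 : 0.573 < Real.eulerMascheroniConstant := by
    refine lt_trans ?_ h1
    unfold Real.eulerMascheroniSeq
    norm_num [harmonic, Finset.sum_range_succ]
    rw [e1]
    norm_num at l1 l2 ⊢
    linarith
  have g2 : Real.eulerMascheroniConstant < 0.582 := by
    refine lt_trans h2 ?_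
    unfold Real.eulerMascheroniSeq'
    norm_num [harmonic, Finset.sum_range_succ]
    rw [e1]
    norm_num at l1 l2 ⊢
    linarith
  constructor
  · have : Real.exp (-1.164) < Real.exp (-2 * Real.eulerMascheroniConstant) :=
      Real.exp_lt_exp.2 (by linarith)
    refine lt_of_le_of_lt ?_ this
    have h3 := Real.exp_bound' (x := 0.582) (by norm_num) (by norm_num) (n := 6) (by norm_num)
    norm_num [Finset.sum_range_succ, Nat.factorial] at h3
    rw [show (-1.164:ℝ) = -(0.582 + 0.582) by norm_num, Real.exp_neg, Real.exp_add,
      le_inv_comm₀ (by norm_num) (by positivity)]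
    have h4 : Real.exp (0.582) ≤ 1.81 := by norm_num; linarith
    have := Real.exp_pos 0.582
    nlinarith
  · have : Real.exp (-2 * Real.eulerMascheroniConstant) < Real.exp (-1.146) :=
      Real.exp_lt_exp.2 (by linarith)
    refine this.trans_le ?_
    have h3 := Real.sum_le_exp_of_nonneg (x := 1.146) (by norm_num) 7
    norm_num [Finset.sum_range_succ, Nat.factorial] at h3
    rw [Real.exp_neg, inv_le_comm₀ (by positivity) (by norm_num)]
    norm_num
    linarith

noncomputable def xiD1 (ξ : ℝ → ℝ) (u : ℝ) : ℝ := (2 * ξ (u - 1) - ξ u) / u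
noncomputable def xiD2 (ξ : ℝ → ℝ) (u : ℝ) : ℝ := (2 * xiD1 ξ (u - 1) - 2 * xiD1 ξ u) / u

structure XiF (ξ : ℝ → ℝ) : Prop where
  h0 : ∀ u : ℝ, u < 1 → ξ u = 0
  h : ∀ u : ℝ, 1 ≤ u → u * ξ u = 2 + 2 * ∫ t in (1:ℝ)..(u - 1), ξ t

namespace XiF

variable {ξ : ℝ → ℝ}

theorem eq12 (H : XiF ξ) {u : ℝ} (h1 : 1 ≤ u) (h2 : u ≤ 2) : ξ u = 2 / u := by
  have h := H.h u h1
  have : ∫ t in (1:ℝ)..(u - 1), ξ t = 0 := by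
    rw [intervalIntegral.integral_symm, neg_eq_zero]
    rw [show (0:ℝ) = ∫ t in (u - 1)..(1:ℝ), (0:ℝ) by simp]
    refine intervalIntegral.integral_congr_ae ?_
    have : ∀ᵐ t : ℝ, t ≠ 1 := by simp [ae_iff]
    filter_upwards [this] with t ht ht2
    rw [Set.uIoc_of_le (by linarith)] at ht2
    exact H.h0 t (lt_of_le_of_ne ht2.2 ht)
  rw [this] at h
  rw [eq_div_iff (by linarith)]; linarith

theorem contN (H : XiF ξ) (n : ℕ) : ContinuousOn ξ (Set.Icc 1 (n + 2 : ℝ)) := by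
  induction n with
  | zero =>
    have : ContinuousOn (fun u : ℝ => 2 / u) (Set.Icc 1 ((0:ℕ) + 2 : ℝ)) := by
      refine continuousOn_const.div continuousOn_id ?_
      intro x hx; simp at hx ⊢; linarith
    refine this.congr fun u hu => ?_
    simp at hu
    exact H.eq12 hu.1 hu.2
  | succ n ih =>
    have hn : (0:ℝ) ≤ n := by positivity
    have hI : ContinuousOn (fun v => ∫ t in (1:ℝ)..v, ξ t) (Set.Icc 1 (n + 2 : ℝ)) := by
      have := intervalIntegral.continuousOn_primitive_interval (a := 1) (b := (n + 2 : ℝ)) (f := ξ)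
        (μ := volume) (by
          rw [Set.uIcc_of_le (by linarith)]
          exact ih.integrableOn_Icc)
      rwa [Set.uIcc_of_le (by linarith)] at this
    have h2 : ContinuousOn ξ (Set.Icc 2 (n + 3 : ℝ)) := by
      have : ContinuousOn (fun u => (2 + 2 * ∫ t in (1:ℝ)..(u - 1), ξ t) / u) (Set.Icc 2 (n + 3 : ℝ)) := by
        refine ContinuousOn.div ?_ continuousOn_id ?_
        · refine continuousOn_const.add (continuousOn_const.mul ?_)
          refine hI.comp (f := fun u : ℝ => u - 1) (by fun_prop) ?_
          intro x hx; simp at hx ⊢; constructor <;> linarith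
        · intro x hx; simp at hx ⊢; linarith
      refine this.congr fun u hu => ?_
      simp at hu
      rw [eq_div_iff (by linarith), ← H.h u (by linarith)]; ring
    have := ih.union_of_isClosed h2 isClosed_Icc isClosed_Icc
    refine this.mono ?_
    intro x hx
    simp at hx ⊢
    rcases le_total x 2 with h | h
    · left; constructor <;> linarith
    · right; constructor <;> linarith

theorem cont (H : XiF ξ) : ContinuousOn ξ (Set.Ici 1) := by
  intro u hu
  obtain ⟨n, hn⟩ := exists_nat_gt u
  simp at hu
  have := (H.contN n) u ⟨hu, by linarith⟩
  refine this.mono_of_mem_nhdsWithin ?_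
  have : Set.Iio (n + 2 : ℝ) ∈ nhds u := Iio_mem_nhds (by linarith)
  filter_upwards [self_mem_nhdsWithin, mem_nhdsWithin_of_mem_nhds this] with x h1 h2
  exact ⟨h1, le_of_lt h2⟩

theorem contAt (H : XiF ξ) {u : ℝ} (hu : 1 < u) : ContinuousAt ξ u :=
  H.cont.continuousAt (Ici_mem_nhds hu)

theorem intble (H : XiF ξ) {a b : ℝ} (ha : 1 ≤ a) (hb : 1 ≤ b) : IntervalIntegrable ξ volume a b := by
  apply ContinuousOn.intervalIntegrable
  refine H.cont.mono ?_
  intro x hx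
  have := hx.1
  simp at this ⊢
  rcases this with h | h <;> linarith

theorem dh (H : XiF ξ) {u : ℝ} (hu : 2 < u) : HasDerivAt ξ (xiD1 ξ u) u := by
  have hI : HasDerivAt (fun v => ∫ t in (1:ℝ)..v, ξ t) (ξ (u - 1)) (u - 1) := by
    refine intervalIntegral.integral_hasDerivAt_right (H.intble le_rfl (by linarith)) ?_
      (H.contAt (by linarith))
    exact H.cont.stronglyMeasurableAtFilter_nhdsWithin measurableSet_Ici (u - 1) |>.filter_mono
      (le_of_eq (nhdsWithin_eq_nhds.2 (Ici_mem_nhds (by linarith))).symm)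
  have hI2 : HasDerivAt (fun w => ∫ t in (1:ℝ)..(w - 1), ξ t) (ξ (u - 1)) u := by
    have := HasDerivAt.comp u (h := fun w : ℝ => w - 1) hI ((hasDerivAt_id u).sub_const 1)
    simpa [Function.comp_def] using this
  have h3 := ((hI2.const_mul 2).const_add 2).div (hasDerivAt_id u) (show id u ≠ 0 by simp; linarith)
  have h4 := h3.congr_of_eventuallyEq (f₁ := ξ) (by
    filter_upwards [Ioi_mem_nhds hu] with w hw
    simp at hw
    simp only [id, Pi.div_apply]
    rw [eq_div_iff (by linarith), ← H.h w (by linarith)]; ring)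
  refine h4.congr_deriv ?_
  simp only [id]
  rw [← H.h u (by linarith)]
  have : u ≠ 0 := by linarith
  unfold xiD1
  field_simp
  

theorem dl (H : XiF ξ) {u : ℝ} (h1 : 1 < u) (h2 : u < 2) : HasDerivAt ξ (xiD1 ξ u) u := by
  have hu : u ≠ 0 := by linarith
  have h3 := (hasDerivAt_const u (2:ℝ)).div (hasDerivAt_id u) (show id u ≠ 0 by simp; linarith)
  have h4 := h3.congr_of_eventuallyEq (f₁ := ξ) (by
    filter_upwards [Ioo_mem_nhds h1 h2] with w hw
    exact H.eq12 hw.1.le hw.2.le)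
  refine h4.congr_deriv ?_
  unfold xiD1
  rw [H.h0 (u - 1) (by linarith), H.eq12 h1.le h2.le]
  simp only [id]
  field_simp
  ring

theorem d1 (H : XiF ξ) {u : ℝ} (h1 : 1 < u) (h2 : u ≠ 2) : HasDerivAt ξ (xiD1 ξ u) u := by
  rcases lt_or_gt_of_ne h2 with h | h
  · exact H.dl h1 h
  · exact H.dh h

theorem d2 (H : XiF ξ) {u : ℝ} (h1 : 2 < u) (h2 : u ≠ 3) : HasDerivAt (xiD1 ξ) (xiD2 ξ u) u := by
  have hu : u ≠ 0 := by linarith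
  have ha : HasDerivAt (fun w => ξ (w - 1)) (xiD1 ξ (u - 1)) u :=
    (H.d1 (u := u - 1) (by linarith) (fun h => h2 (by linarith))).comp_sub_const u 1
  have := ((ha.const_mul 2).sub (H.dh h1)).div (hasDerivAt_id u) (show id u ≠ 0 by simpa using hu)
  refine HasDerivAt.congr_deriv this ?_
  simp only [id, Pi.sub_apply]
  have e : 2 * ξ (u - 1) - ξ u = u * xiD1 ξ u := by unfold xiD1; field_simp
  rw [e]
  unfold xiD2
  field_simp
  ring

theorem d3 (H : XiF ξ) {u : ℝ} (h1 : 3 < u) (h2 : u ≠ 4) :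
    HasDerivAt (fun u => u ^ 3 * xiD2 ξ u) (2 * u ^ 2 * xiD2 ξ (u - 1)) u := by
  have hu : u ≠ 0 := by linarith
  have ha : HasDerivAt (fun w => xiD1 ξ (w - 1)) (xiD2 ξ (u - 1)) u :=
    (H.d2 (u := u - 1) (by linarith) (fun h => h2 (by linarith))).comp_sub_const u 1
  have h3 := ((hasDerivAt_id u).pow 2).mul
    ((ha.const_mul 2).sub ((H.d2 (u := u) (by linarith) (by linarith)).const_mul 2))
  have h4 := HasDerivAt.congr_of_eventuallyEq (f₁ := fun u => u ^ 3 * xiD2 ξ u) h3 (by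
    filter_upwards [Ioi_mem_nhds h1] with w hw
    simp at hw
    have : w ≠ 0 := by linarith
    simp only [Pi.mul_apply, Pi.pow_apply, id, Pi.sub_apply]
    unfold xiD2
    field_simp)
  refine h4.congr_deriv ?_
  simp only [Pi.pow_apply, id, Pi.sub_apply]
  have e : 2 * xiD1 ξ (u - 1) - 2 * xiD1 ξ u = u * xiD2 ξ u := by unfold xiD2; field_simp
  rw [e]
  push_cast
  ring

theorem c1 (H : XiF ξ) : ContinuousOn (xiD1 ξ) (Set.Ici 2) := by
  unfold xiD1
  refine ContinuousOn.div ?_ continuousOn_id ?_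
  · refine (continuousOn_const.mul (H.cont.comp (f := fun u : ℝ => u - 1) (by fun_prop) ?_)).sub
      (H.cont.mono (Set.Ici_subset_Ici.2 (by norm_num)))
    intro x hx; simp at hx ⊢; linarith
  · intro x hx; simp at hx ⊢; linarith

theorem c2 (H : XiF ξ) : ContinuousOn (xiD2 ξ) (Set.Ici 3) := by
  unfold xiD2
  refine ContinuousOn.div ?_ continuousOn_id ?_
  · refine (continuousOn_const.mul (H.c1.comp (f := fun u : ℝ => u - 1) (by fun_prop) ?_)).sub
      (continuousOn_const.mul (H.c1.mono (Set.Ici_subset_Ici.2 (by norm_num))))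
    intro x hx; simp at hx ⊢; linarith
  · intro x hx; simp at hx ⊢; linarith

theorem d2' (H : XiF ξ) {u : ℝ} (h1 : 3 ≤ u) : HasDerivWithinAt (xiD1 ξ) (xiD2 ξ u) (Set.Ici u) u := by
  rcases h1.eq_or_lt with rfl | h
  · refine hasDerivWithinAt_Ici_of_tendsto_deriv (s := Set.Ioi 3) ?_ ?_ self_mem_nhdsWithin ?_
    · intro x hx; exact (H.d2 (by simp at hx; linarith) (by simp at hx; linarith)).differentiableAt.differentiableWithinAt
    · exact (H.c1 3 (by simp; norm_num)).mono (fun x hx => by simp at hx ⊢; linarith)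
    · have := (H.c2 3 (by simp)).mono (Set.Ioi_subset_Ici_self)
      refine Filter.Tendsto.congr' ?_ this
      filter_upwards [self_mem_nhdsWithin] with x hx
      exact (H.d2 (by simp at hx; linarith) (by simp at hx; linarith)).deriv.symm
  · exact (H.d2 (by linarith) (by linarith)).hasDerivWithinAt

theorem eq23 (H : XiF ξ) {u : ℝ} (h1 : 2 ≤ u) (h2 : u ≤ 3) : ξ u = (2 + 4 * Real.log (u - 1)) / u := by
  have h := H.h u (by linarith)
  have : ∫ t in (1:ℝ)..(u - 1), ξ t = 2 * Real.log (u - 1) := by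
    have e : ∫ t in (1:ℝ)..(u - 1), ξ t = ∫ t in (1:ℝ)..(u - 1), 2 * (1 / t) := by
      refine intervalIntegral.integral_congr ?_
      intro t ht
      rw [Set.uIcc_of_le (by linarith)] at ht
      have := H.eq12 (u := t) ht.1 (by linarith [ht.2])
      simp only [this]; ring
    rw [e, intervalIntegral.integral_const_mul, integral_one_div_of_pos (by norm_num) (by linarith)]
    simp
  rw [this] at h
  rw [eq_div_iff (by linarith)]; linarith

end XiF

theorem xi_chord {f g : ℝ → ℝ} {a b : ℝ} (hf : ContinuousOn f (Set.Icc a b))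
    (hd : ∀ x ∈ Set.Ioo a b, HasDerivAt f (g x) x) (hg : AntitoneOn g (Set.Ioo a b))
    {x y t : ℝ} (hx : a ≤ x) (hy : y ≤ b) (hxy : x < y) (ht : t ∈ Set.Icc x y) :
    f x * (y - t) + f y * (t - x) ≤ f t * (y - x) := by
  have hc : ConcaveOn ℝ (Set.Icc a b) f := by
    refine AntitoneOn.concaveOn_of_deriv (convex_Icc a b) hf ?_ ?_
    · rw [interior_Icc]
      intro x hx
      exact (hd x hx).differentiableAt.differentiableWithinAt
    · rw [interior_Icc]
      intro x hx y hy hxy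
      rw [(hd x hx).deriv, (hd y hy).deriv]
      exact hg hx hy hxy
  have hp : 0 < y - x := by linarith
  have hx' : x ∈ Set.Icc a b := ⟨hx, by linarith⟩
  have hy' : y ∈ Set.Icc a b := ⟨by linarith, hy⟩
  have := hc.2 hx' hy'
    (show 0 ≤ (y - t) / (y - x) from div_nonneg (by linarith [ht.2]) hp.le)
    (show 0 ≤ (t - x) / (y - x) from div_nonneg (by linarith [ht.1]) hp.le)
    (by field_simp; ring)
  simp only [smul_eq_mul] at this
  rw [show (y - t) / (y - x) * x + (t - x) / (y - x) * y = t by field_simp; ring] at this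
  have h2 := mul_le_mul_of_nonneg_right this hp.le
  refine le_trans (le_of_eq ?_) h2
  field_simp

namespace XiF
variable {ξ : ℝ → ℝ}

theorem x2 (H : XiF ξ) : ξ 2 = 1 := by rw [H.eq12 (by norm_num) le_rfl]; norm_num

theorem x3 (H : XiF ξ) : 1.5908 ≤ ξ 3 ∧ ξ 3 ≤ 1.5909 := by
  rw [H.eq23 (by norm_num) le_rfl]
  have l1 := Real.log_two_lt_d9
  have l2 := Real.log_two_gt_d9
  norm_num at l1 l2 ⊢
  constructor <;> linarith

theorem x25 (H : XiF ξ) : 1.4486 ≤ ξ 2.5 ∧ ξ 2.5 ≤ 1.4488 := by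
  rw [H.eq23 (by norm_num) (by norm_num)]
  have ⟨l1, l2⟩ := log_15
  norm_num at l1 l2 ⊢
  constructor <;> linarith

theorem x225 (H : XiF ξ) : 1.2855 ≤ ξ 2.25 := by
  rw [H.eq23 (by norm_num) (by norm_num)]
  have ⟨l1, l2⟩ := log_125
  norm_num at l1 l2 ⊢
  linarith

theorem x275 (H : XiF ξ) : 1.5410 ≤ ξ 2.75 := by
  rw [H.eq23 (by norm_num) (by norm_num)]
  have ⟨l1, l2⟩ := log_175
  norm_num at l1 l2 ⊢
  linarith

theorem D1pos (H : XiF ξ) {v : ℝ} (h1 : 2 ≤ v) (h2 : v ≤ 3) : 0 ≤ xiD1 ξ v := by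
  unfold xiD1
  rw [H.eq12 (by linarith) (by linarith), H.eq23 h1 h2]
  have hl : Real.log (v - 1) ≤ 0.7 := by
    have := Real.log_le_log (show 0 < v - 1 by linarith) (show v - 1 ≤ 2 by linarith)
    have l1 := Real.log_two_lt_d9
    norm_num at l1 ⊢
    linarith
  refine div_nonneg ?_ (by linarith)
  rw [sub_nonneg, ← mul_div_assoc, div_le_div_iff₀ (by linarith) (by linarith)]
  nlinarith

theorem D2neg (H : XiF ξ) {v : ℝ} (h1 : 2 < v) (h2 : v < 3) : xiD2 ξ v ≤ -(1 / 3) := by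
  have hD := H.D1pos h1.le h2.le
  have : xiD1 ξ (v - 1) ≤ -(1 / 2) := by
    unfold xiD1
    rw [H.h0 (v - 1 - 1) (by linarith), H.eq12 (by linarith) (by linarith), div_le_iff₀ (by linarith)]
    have : (v - 1) / 2 ≤ 2 / (v - 1) := by
      rw [div_le_div_iff₀ (by linarith) (by linarith)]; nlinarith
    linarith
  unfold xiD2
  rw [div_le_iff₀ (by linarith)]
  linarith

theorem D1anti (H : XiF ξ) : AntitoneOn (xiD1 ξ) (Set.Icc 2 3) := by
  refine antitoneOn_of_hasDerivWithinAt_nonpos (f' := xiD2 ξ) (convex_Icc _ _) (H.c1.mono (fun x hx => hx.1)) ?_ ?_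
  · rw [interior_Icc]; intro x hx; exact (H.d2 hx.1 hx.2.ne).hasDerivWithinAt
  · rw [interior_Icc]; intro x hx; linarith [H.D2neg hx.1 hx.2]

theorem ximono (H : XiF ξ) : MonotoneOn ξ (Set.Icc 2 3) := by
  refine monotoneOn_of_hasDerivWithinAt_nonneg (f' := xiD1 ξ) (convex_Icc _ _)
    (H.cont.mono (fun x hx => by have := hx.1; simp; linarith)) ?_ ?_
  · rw [interior_Icc]; intro x hx; exact (H.dh hx.1).hasDerivWithinAt
  · rw [interior_Icc]; intro x hx; exact H.D1pos hx.1.le hx.2.le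

theorem trap (H : XiF ξ) {a b : ℝ} (ha : 2 ≤ a) (hab : a < b) (hb : b ≤ 3) :
    (b - a) * (ξ a + ξ b) / 2 ≤ ∫ t in a..b, ξ t := by
  have hc : ∀ t ∈ Set.Icc a b, ξ a + (ξ b - ξ a) / (b - a) * (t - a) ≤ ξ t := by
    intro t ht
    have := xi_chord (f := ξ) (g := xiD1 ξ) (a := 2) (b := 3)
      (H.cont.mono (fun x hx => by have := hx.1; simp; linarith))
      (fun x hx => H.dh hx.1) (H.D1anti.mono Set.Ioo_subset_Icc_self) ha hb hab ht
    have hp : 0 < b - a := by linarith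
    rw [← mul_le_mul_iff_left₀ hp]
    refine le_trans (le_of_eq ?_) this
    field_simp
    ring
  have := intervalIntegral.integral_mono_on (μ := volume) hab.le
    (Continuous.intervalIntegrable (by fun_prop) _ _)
    (H.intble (by linarith) (by linarith)) hc
  refine le_trans (le_of_eq ?_) this
  rw [intervalIntegral.integral_add (by simp) (Continuous.intervalIntegrable (by fun_prop) _ _),
    intervalIntegral.integral_const_mul,
    intervalIntegral.integral_sub (by simp) (by simp)]
  have hp : b - a ≠ 0 := by linarith
  simp
  field_simp
  ring

theorem I12 (H : XiF ξ) : ∫ t in (1:ℝ)..2, ξ t = 2 * Real.log 2 := by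
  have h := H.h 3 (by norm_num)
  rw [H.eq23 (by norm_num) le_rfl] at h
  norm_num at h
  linarith

theorem x35 (H : XiF ξ) : 1.7221 ≤ ξ 3.5 ∧ ξ 3.5 ≤ 1.7565 := by
  have h := H.h 3.5 (by norm_num)
  have e := intervalIntegral.integral_add_adjacent_intervals (H.intble (a := 1) (b := 2) (by norm_num) (by norm_num))
    (H.intble (a := 2) (b := 2.5) (by norm_num) (by norm_num))
  have e2 := intervalIntegral.integral_add_adjacent_intervals (H.intble (a := 2) (b := 2.25) (by norm_num) (by norm_num))
    (H.intble (a := 2.25) (b := 2.5) (by norm_num) (by norm_num))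
  have t1 := H.trap (a := 2) (b := 2.25) (by norm_num) (by norm_num) (by norm_num)
  have t2 := H.trap (a := 2.25) (b := 2.5) (by norm_num) (by norm_num) (by norm_num)
  have up : ∫ t in (2:ℝ)..2.5, ξ t ≤ 0.6875 := by
    have := intervalIntegral.integral_mono_on (a := 2) (b := 2.5) (μ := volume) (f := ξ)
      (g := fun t => 1 + 1.5 * (t - 2)) (by norm_num)
      (H.intble (by norm_num) (by norm_num)) (Continuous.intervalIntegrable (by fun_prop) _ _) (by
        intro t ht
        have h1 := ht.1
        have h2 := ht.2
        rw [H.eq23 (by linarith) (by linarith), div_le_iff₀ (by linarith)]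
        have := Real.log_le_sub_one_of_pos (show 0 < t - 1 by linarith)
        nlinarith)
    refine this.trans (le_of_eq ?_)
    rw [intervalIntegral.integral_add (by simp) (Continuous.intervalIntegrable (by fun_prop) _ _),
      intervalIntegral.integral_const_mul,
      intervalIntegral.integral_sub (by simp) (by simp)]
    simp
    norm_num
  rw [H.I12] at e
  rw [show (3.5 - 1 : ℝ) = 2.5 by norm_num] at h
  have l1 := Real.log_two_lt_d9
  have l2 := Real.log_two_gt_d9
  have := H.x25
  have := H.x225
  have := H.x2
  constructor <;> linarith

theorem x4 (H : XiF ξ) : 1.8894 ≤ ξ 4 ∧ ξ 4 ≤ 1.935 := by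
  have h := H.h 4 (by norm_num)
  have h' := H.h 3.5 (by norm_num)
  have e := intervalIntegral.integral_add_adjacent_intervals (H.intble (a := 1) (b := 2.5) (by norm_num) (by norm_num))
    (H.intble (a := 2.5) (b := 3) (by norm_num) (by norm_num))
  have e1 := intervalIntegral.integral_add_adjacent_intervals (H.intble (a := 1) (b := 2) (by norm_num) (by norm_num))
    (H.intble (a := 2) (b := 2.5) (by norm_num) (by norm_num))
  have e2 := intervalIntegral.integral_add_adjacent_intervals (H.intble (a := 2) (b := 2.25) (by norm_num) (by norm_num))
    (H.intble (a := 2.25) (b := 2.5) (by norm_num) (by norm_num))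
  have e3 := intervalIntegral.integral_add_adjacent_intervals (H.intble (a := 2.5) (b := 2.75) (by norm_num) (by norm_num))
    (H.intble (a := 2.75) (b := 3) (by norm_num) (by norm_num))
  have t1 := H.trap (a := 2) (b := 2.25) (by norm_num) (by norm_num) (by norm_num)
  have t2 := H.trap (a := 2.25) (b := 2.5) (by norm_num) (by norm_num) (by norm_num)
  have t3 := H.trap (a := 2.5) (b := 2.75) (by norm_num) (by norm_num) (by norm_num)
  have t4 := H.trap (a := 2.75) (b := 3) (by norm_num) (by norm_num) (by norm_num)
  have up : ∫ t in (2.5:ℝ)..3, ξ t ≤ 0.5 * ξ 3 := by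
    have := intervalIntegral.integral_mono_on (a := 2.5) (b := 3) (μ := volume) (f := ξ)
      (g := fun t => ξ 3) (by norm_num)
      (H.intble (by norm_num) (by norm_num)) (by simp) (by
        intro t ht
        have h1 := ht.1
        have h2 := ht.2
        exact H.ximono ⟨by linarith, h2⟩ ⟨by norm_num, le_rfl⟩ h2)
    refine this.trans (le_of_eq ?_)
    simp
    left
    norm_num
  rw [H.I12] at e1
  rw [show (3.5 - 1 : ℝ) = 2.5 by norm_num] at h'
  rw [show (4 - 1 : ℝ) = 3 by norm_num] at h
  have l1 := Real.log_two_lt_d9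
  have l2 := Real.log_two_gt_d9
  have := H.x25
  have := H.x225
  have := H.x275
  have := H.x3
  have := H.x2
  have := H.x35
  constructor <;> linarith

theorem D1_25 (H : XiF ξ) : 0.4871 ≤ xiD1 ξ 2.5 ∧ xiD1 ξ 2.5 ≤ 0.4873 := by
  unfold xiD1
  have := H.x25
  rw [show (2.5 - 1 : ℝ) = 1.5 by norm_num, H.eq12 (u := 1.5) (by norm_num) (by norm_num)]
  norm_num at this ⊢
  constructor <;> linarith

theorem D1_3 (H : XiF ξ) : 0.1363 ≤ xiD1 ξ 3 ∧ xiD1 ξ 3 ≤ 0.1365 := by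
  unfold xiD1
  have := H.x3
  rw [show (3 - 1 : ℝ) = 2 by norm_num, H.x2]
  norm_num at this ⊢
  constructor <;> linarith

theorem D1_35 (H : XiF ξ) : 0.3259 ≤ xiD1 ξ 3.5 ∧ xiD1 ξ 3.5 ≤ 0.3359 := by
  unfold xiD1
  have := H.x25
  have := H.x35
  rw [show (3.5 - 1 : ℝ) = 2.5 by norm_num]
  constructor
  · rw [le_div_iff₀ (by norm_num)]; linarith
  · rw [div_le_iff₀ (by norm_num)]; linarith

theorem D1_4 (H : XiF ξ) : 0.311 ≤ xiD1 ξ 4 := by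
  unfold xiD1
  have := H.x3
  have := H.x4
  rw [show (4 - 1 : ℝ) = 3 by norm_num]
  rw [le_div_iff₀ (by norm_num)]; linarith

theorem D2_35 (H : XiF ξ) : 0.085 ≤ xiD2 ξ 3.5 ∧ xiD2 ξ 3.5 ≤ 0.095 := by
  unfold xiD2
  have := H.D1_25
  have := H.D1_35
  rw [show (3.5 - 1 : ℝ) = 2.5 by norm_num]
  constructor
  · rw [le_div_iff₀ (by norm_num)]; linarith
  · rw [div_le_iff₀ (by norm_num)]; linarith

theorem D2_4 (H : XiF ξ) : -0.0934 ≤ xiD2 ξ 4 := by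
  unfold xiD2 xiD1
  have := H.x3
  have := H.x4
  norm_num [H.x2] at *
  linarith

theorem hanti (H : XiF ξ) : AntitoneOn (fun u => u ^ 3 * xiD2 ξ u) (Set.Icc 3 4) := by
  refine antitoneOn_of_hasDerivWithinAt_nonpos (f' := fun u => 2 * u ^ 2 * xiD2 ξ (u - 1)) (convex_Icc _ _)
    (ContinuousOn.mul (by fun_prop) (H.c2.mono (fun x hx => hx.1))) ?_ ?_
  · rw [interior_Icc]; intro x hx; exact (H.d3 hx.1 hx.2.ne).hasDerivWithinAt
  · rw [interior_Icc]; intro x hx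
    have := H.D2neg (v := x - 1) (by linarith [hx.1]) (by linarith [hx.2])
    have : 0 ≤ x ^ 2 := by positivity
    nlinarith

theorem D2_lo (H : XiF ξ) {v : ℝ} (h1 : 3 ≤ v) (h2 : v ≤ 3.5) : 0.085 ≤ xiD2 ξ v := by
  have := H.hanti (a := v) (b := 3.5) ⟨h1, by linarith⟩ ⟨by norm_num, by norm_num⟩ h2
  simp only at this
  have h3 : v ^ 3 ≤ 3.5 ^ 3 := by gcongr
  have hp : 0 < v ^ 3 := by positivity
  have := H.D2_35.1
  by_contra hc
  push Not at hc
  nlinarith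

theorem D2_3544 (H : XiF ξ) {u : ℝ} (h1 : 3.5 ≤ u) (h2 : u ≤ 4) : |xiD2 ξ u| < xiB u := by
  have hB := xiB_anti (show 2 ≤ u by linarith) h2
  rw [xiB_four] at hB
  have hup : xiD2 ξ u ≤ 0.095 := by
    have := H.hanti (a := 3.5) (b := u) ⟨by norm_num, by norm_num⟩ ⟨by linarith, by linarith⟩ h1
    simp only at this
    have h3 : 3.5 ^ 3 ≤ u ^ 3 := by gcongr
    have := H.D2_35.2
    by_contra hc
    push Not at hc
    nlinarith
  have crude : ∀ w, 3.5 ≤ w → w ≤ 4 → -0.15 ≤ xiD2 ξ w := by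
    intro w h1 h2
    have := H.hanti (a := w) (b := 4) ⟨by linarith, by linarith⟩ ⟨by norm_num, by norm_num⟩ h2
    simp only at this
    have h3 : 3.5 ^ 3 ≤ w ^ 3 := by gcongr
    have := H.D2_4
    by_contra hc
    push Not at hc
    nlinarith
  have hmono : AntitoneOn (xiD2 ξ) (Set.Icc 3.5 4) := by
    refine antitoneOn_of_hasDerivWithinAt_nonpos (f' := fun u => (2 * xiD2 ξ (u - 1) - 3 * xiD2 ξ u) / u) (convex_Icc _ _)
      (H.c2.mono (fun x hx => by have := hx.1; simp; linarith)) ?_ ?_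
    · rw [interior_Icc]; intro x hx
      have hx3 : 3 < x := by linarith [hx.1]
      have hx0 : x ≠ 0 := by linarith
      have := (H.d3 hx3 hx.2.ne).div (hasDerivAt_pow 3 x) (by positivity)
      have h4 := HasDerivAt.congr_of_eventuallyEq (f₁ := xiD2 ξ) this (by
        filter_upwards [Ioi_mem_nhds hx3] with w hw
        simp at hw
        have : w ≠ 0 := by linarith
        simp only [Pi.div_apply]
        field_simp)
      refine (h4.congr_deriv ?_).hasDerivWithinAt
      push_cast
      field_simp
    · rw [interior_Icc]; intro x hx
      have := H.D2neg (v := x - 1) (by linarith [hx.1]) (by linarith [hx.2])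
      have := crude x hx.1.le hx.2.le
      exact div_nonpos_of_nonpos_of_nonneg (by linarith) (by linarith [hx.1])
  have hlo := hmono (a := u) (b := 4) ⟨h1, h2⟩ ⟨by norm_num, le_rfl⟩ h2
  have := H.D2_4
  rw [abs_lt]
  constructor <;> linarith

theorem D2_lo4 (H : XiF ξ) {u : ℝ} (h1 : 4 ≤ u) (h2 : u ≤ 4.5) : -xiB u < xiD2 ξ u := by
  have hm : MonotoneOn (fun u => u ^ 3 * xiD2 ξ u - 2.72 * u) (Set.Icc 4 4.5) := by
    refine monotoneOn_of_hasDerivWithinAt_nonneg (f' := fun u => 2 * u ^ 2 * xiD2 ξ (u - 1) - 2.72 * 1) (convex_Icc _ _)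
      ((ContinuousOn.mul (by fun_prop) (H.c2.mono (fun x hx => by have := hx.1; simp; linarith))).sub (by fun_prop)) ?_ ?_
    · rw [interior_Icc]; intro x hx
      exact ((H.d3 (by linarith [hx.1]) hx.1.ne').sub ((hasDerivAt_id x).const_mul 2.72)).hasDerivWithinAt
    · rw [interior_Icc]; intro x hx
      have := H.D2_lo (v := x - 1) (by linarith [hx.1]) (by linarith [hx.2])
      have h4 : 4 ^ 2 ≤ x ^ 2 := by have := hx.1; gcongr
      nlinarith
  have h3 := hm (a := 4) (b := u) ⟨le_rfl, by norm_num⟩ ⟨h1, h2⟩ h1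
  simp only at h3
  have h4 := H.D2_4
  have hB := xiB_45 h1 (by linarith)
  have hp : 0 < u ^ 3 := by positivity
  have key : 5.9776 - 2.72 * (u - 4) < u ^ 3 * (2 / 21 * (1 - 0.9164 * (u - 4))) := by
    obtain ⟨x, rfl⟩ : ∃ x, u = 4 + x := ⟨u - 4, by ring⟩
    have hx0 : 0 ≤ x := by linarith
    have hx1 : x ≤ 0.5 := by linarith
    ring_nf
    nlinarith [mul_nonneg hx0 (sub_nonneg.2 hx1), mul_nonneg (mul_nonneg hx0 hx0) (sub_nonneg.2 hx1), mul_nonneg (mul_nonneg (mul_nonneg hx0 hx0) hx0) (sub_nonneg.2 hx1)]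
  have h5 : u ^ 3 * (2 / 21 * (1 - 0.9164 * (u - 4))) ≤ u ^ 3 * xiB u := by gcongr
  by_contra hc
  push Not at hc
  have : u ^ 3 * xiD2 ξ u ≤ u ^ 3 * (-xiB u) := by gcongr
  linarith

theorem D2_base (H : XiF ξ) {u : ℝ} (h1 : 3.5 ≤ u) (h2 : u ≤ 4.5) : |xiD2 ξ u| < xiB u := by
  rcases le_total u 4 with h4 | h4
  · exact H.D2_3544 h1 h4
  refine abs_lt.2 ⟨H.D2_lo4 h4 h2, ?_⟩
  have hB := xiB_45 h4 (by linarith)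
  have a1 : xiD1 ξ (u - 1) ≤ xiD1 ξ 3.5 := by
    have : MonotoneOn (xiD1 ξ) (Set.Icc 3 3.5) := by
      refine monotoneOn_of_hasDerivWithinAt_nonneg (f' := xiD2 ξ) (convex_Icc _ _)
        (H.c1.mono (fun x hx => by have := hx.1; simp; linarith)) ?_ ?_
      · rw [interior_Icc]; intro x hx; exact (H.d2 (by linarith [hx.1]) hx.1.ne').hasDerivWithinAt
      · rw [interior_Icc]; intro x hx; linarith [H.D2_lo hx.1.le hx.2.le]
    exact this ⟨by linarith, by linarith⟩ ⟨by norm_num, le_rfl⟩ (by linarith)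
  have a2 : xiD1 ξ 4 - 0.05 ≤ xiD1 ξ u := by
    have : MonotoneOn (fun u => xiD1 ξ u + 0.1 * u) (Set.Icc 4 4.5) := by
      refine monotoneOn_of_hasDerivWithinAt_nonneg (f' := fun u => xiD2 ξ u + 0.1 * 1) (convex_Icc _ _)
        ((H.c1.mono (fun x hx => by have := hx.1; simp; linarith)).add (by fun_prop)) ?_ ?_
      · rw [interior_Icc]; intro x hx
        exact ((H.d2 (by linarith [hx.1]) (by linarith [hx.1])).add ((hasDerivAt_id x).const_mul 0.1)).hasDerivWithinAt
      · rw [interior_Icc]; intro x hx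
        have := H.D2_lo4 hx.1.le hx.2.le
        have h5 := xiB_anti (show (2:ℝ) ≤ 4 by norm_num) hx.1.le
        rw [xiB_four] at h5
        linarith
    have := this (a := 4) (b := u) ⟨le_rfl, by norm_num⟩ ⟨h4, h2⟩ h4
    simp only at this
    linarith
  have := H.D1_35
  have := H.D1_4
  refine lt_of_lt_of_le ?_ hB
  unfold xiD2
  rw [div_lt_iff₀ (by linarith)]
  nlinarith

theorem D1_base (H : XiF ξ) {u c : ℝ} (hc1 : 0.305 < c) (hc2 : c < 0.319)
    (h1 : 2.5 ≤ u) (h2 : u ≤ 3.5) : |xiD1 ξ u - c| < xiB u := by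
  have := H.D1_3
  have := H.D1_25
  have := H.D1_35
  rw [abs_lt]
  rcases le_total u 3 with h3 | h3
  · have hB := xiB_anti (show 2 ≤ u by linarith) h3
    rw [xiB_three] at hB
    have a1 := H.D1anti (a := 2.5) (b := u) ⟨by norm_num, by norm_num⟩ ⟨by linarith, h3⟩ h1
    have a2 := H.D1anti (a := u) (b := 3) ⟨by linarith, h3⟩ ⟨by norm_num, by norm_num⟩ h3
    constructor <;> linarith
  · have hB := xiB_34 h3 (by linarith)
    have a1 : xiD1 ξ u ≤ xiD1 ξ 3.5 := by
      have : MonotoneOn (xiD1 ξ) (Set.Icc 3 3.5) := by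
        refine monotoneOn_of_hasDerivWithinAt_nonneg (f' := xiD2 ξ) (convex_Icc _ _)
          (H.c1.mono (fun x hx => by have := hx.1; simp; linarith)) ?_ ?_
        · rw [interior_Icc]; intro x hx; exact (H.d2 (by linarith [hx.1]) hx.1.ne').hasDerivWithinAt
        · rw [interior_Icc]; intro x hx; linarith [H.D2_lo hx.1.le hx.2.le]
      exact this ⟨by linarith, by linarith⟩ ⟨by norm_num, le_rfl⟩ (by linarith)
    have a2 := xi_chord (f := xiD1 ξ) (g := xiD2 ξ) (a := 3) (b := 3.5)
      (H.c1.mono (fun x hx => by have := hx.1; simp; linarith))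
      (fun x hx => H.d2 (by linarith [hx.1]) hx.1.ne') (by
        intro v hv w hw hvw
        have := H.hanti (a := v) (b := w) ⟨hv.1.le, by linarith [hv.2]⟩ ⟨hw.1.le, by linarith [hw.2]⟩ hvw
        simp only at this
        have h3 := hv.1
        have h4 : v ^ 3 ≤ w ^ 3 := by gcongr
        have h5 : 0 < v ^ 3 := by positivity
        have h6 := H.D2_lo hw.1.le hw.2.le
        by_contra hc
        push Not at hc
        nlinarith) le_rfl le_rfl (by norm_num) (t := u) ⟨h3, h2⟩
    constructor <;> nlinarith

theorem x_base (H : XiF ξ) {u c : ℝ} (hc1 : 0.305 < c) (hc2 : c < 0.319)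
    (h1 : 1.5 ≤ u) (h2 : u ≤ 2.5) : |ξ u - (u + 2) * c| < xiB u := by
  rw [abs_lt]
  rcases le_total u 2 with h3 | h3
  · have hB := xiB_12 (by linarith) h3
    rw [H.eq12 (by linarith) h3]
    have a1 : 2 / u ≤ 4 / 3 := by rw [div_le_div_iff₀ (by linarith) (by norm_num)]; linarith
    have a2 : 1 ≤ 2 / u := by rw [le_div_iff₀ (by linarith)]; linarith
    constructor <;> nlinarith
  · have hB := xiB_23 h3 (by linarith)
    rw [H.eq23 h3 (by linarith)]
    have l1 := log_15.2
    have l2 : Real.log (u - 1) ≤ Real.log 1.5 + ((u - 1) / 1.5 - 1) := by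
      have := Real.log_le_sub_one_of_pos (show 0 < (u - 1) / 1.5 by apply div_pos <;> linarith)
      rw [Real.log_div (by linarith) (by norm_num)] at this
      linarith
    have l3 : 2 * (u - 2) / u ≤ Real.log (u - 1) := by
      have := Real.le_log_one_add_of_nonneg (x := u - 2) (by linarith)
      rw [show 1 + (u - 2) = u - 1 by ring, show u - 2 + 2 = u by ring] at this
      exact this
    have hu0 : 0 < u := by linarith
    constructor
    · have a1 : 1 + 0.8 * (u - 2) ≤ (2 + 4 * Real.log (u - 1)) / u := by
        rw [le_div_iff₀ hu0]
        have : (1 + 0.8 * (u - 2)) * u ≤ 2 + 4 * (2 * (u - 2) / u) := by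
          rw [← mul_le_mul_iff_left₀ hu0]
          have : (2 + 4 * (2 * (u - 2) / u)) * u = 2 * u + 8 * (u - 2) := by field_simp; ring
          rw [this]
          nlinarith [mul_nonneg (sub_nonneg.2 h3) (sub_nonneg.2 h2), mul_nonneg (mul_nonneg (sub_nonneg.2 h3) (sub_nonneg.2 h2)) (sub_nonneg.2 h3)]
        linarith
      nlinarith
    · have a1 : (2 + 4 * Real.log (u - 1)) / u < (u + 2) * 0.305 + 2 / 7 * (1 - 0.4055 * (u - 2)) := by
        rw [div_lt_iff₀ hu0]
        have : (2 + 4 * Real.log (u - 1)) ≤ 2 + 4 * (0.4055 + ((u - 1) / 1.5 - 1)) := by linarith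
        refine this.trans_lt ?_
        rw [show (u - 1) / 1.5 = (u - 1) * (2 / 3) by ring]
        nlinarith [sq_nonneg (u - 2.5)]
      nlinarith

end XiF

theorem xi_induct {f : ℝ → ℝ} {a b : ℝ} (hc : ContinuousOn f (Set.Ici a))
    (h0 : ∀ t ∈ Set.Icc a b, 0 < f t)
    (hs : ∀ t, b < t → (∀ s, a ≤ s → s < t → 0 < f s) → 0 < f t) : ∀ t, a ≤ t → 0 < f t := by
  intro t0 ht0
  by_contra hcon
  push Not at hcon
  have hK : IsCompact (Set.Icc a t0 ∩ f ⁻¹' Set.Iic 0) := by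
    refine isCompact_Icc.of_isClosed_subset ?_ Set.inter_subset_left
    exact (hc.mono (fun x hx => hx.1)).preimage_isClosed_of_isClosed isClosed_Icc isClosed_Iic
  obtain ⟨t, ht, hmin⟩ := hK.exists_isLeast ⟨t0, ⟨ht0, le_rfl⟩, hcon⟩
  have hft : f t ≤ 0 := ht.2
  have hall : ∀ s, a ≤ s → s < t → 0 < f s := by
    intro s h1 h2
    by_contra h3
    push Not at h3
    exact absurd (hmin ⟨⟨h1, h2.le.trans ht.1.2⟩, h3⟩) (not_le.2 h2)
  rcases le_or_gt t b with h | h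
  · exact absurd (h0 t ⟨ht.1.1, h⟩) (not_lt.2 hft)
  · exact absurd (hs t h hall) (not_lt.2 hft)

theorem xiB_cont : ContinuousOn xiB (Set.Ici 1) := by
  intro u hu
  simp at hu
  have hg : ContinuousAt Real.Gamma (u + 1) := by
    refine (Real.differentiableAt_Gamma ?_).continuousAt
    intro m
    have : (0:ℝ) ≤ m := by positivity
    intro h
    linarith
  have hp := Real.Gamma_pos_of_pos (show 0 < u + 1 by linarith)
  refine ContinuousAt.continuousWithinAt ?_
  unfold xiB
  refine ContinuousAt.div ?_ ?_ (by positivity)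
  · exact (Real.continuous_const_rpow (by norm_num)).continuousAt
  · refine continuousAt_const.mul ?_
    exact ContinuousAt.comp (f := fun u : ℝ => u + 1) hg (by fun_prop)

theorem xi_W1 {f g : ℝ → ℝ} {a : ℝ} (ha : 1 ≤ a) (hc : ContinuousOn f (Set.Ici a))
    (hd : ∀ t, a + 1 < t → HasDerivAt f (g t) t)
    (he : ∀ t, a + 1 ≤ t → t * g t = 2 * f (t - 1) - f t)
    (hl : Filter.Tendsto f Filter.atTop (nhds 0)) : ¬ ∀ t ∈ Set.Icc a (a + 1), 0 < f t := by
  intro hpos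
  obtain ⟨x, hx, hmin⟩ := isCompact_Icc.exists_isMinOn (s := Set.Icc a (a + 1)) ⟨a, le_rfl, by linarith⟩
    (hc.mono (fun x hx => hx.1))
  have hm := hpos x hx
  obtain ⟨m, hmd⟩ : ∃ m, m = f x / 2 := ⟨_, rfl⟩
  have hm0 : 0 < m := by linarith
  have hall : ∀ t, a ≤ t → 0 < f t - m := by
    refine xi_induct (b := a + 1) (hc.sub continuousOn_const) ?_ ?_
    · intro t ht
      have : f x ≤ f t := hmin ht
      linarith
    · intro t ht hs
      have hmono : MonotoneOn (fun s => s * f s - m * s) (Set.Icc (a + 1) t) := by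
        refine monotoneOn_of_hasDerivWithinAt_nonneg (f' := fun s => 1 * f s + s * g s - m * 1) (convex_Icc _ _)
          ((continuousOn_id.mul (hc.mono (fun x hx => by have := hx.1; simp; linarith))).sub (by fun_prop)) ?_ ?_
        · rw [interior_Icc]; intro s hs
          exact (((hasDerivAt_id s).mul (hd s hs.1)).sub ((hasDerivAt_id s).const_mul m)).hasDerivWithinAt
        · rw [interior_Icc]; intro s hs'
          have h1 := he s hs'.1.le
          have h2 := hs (s - 1) (by linarith [hs'.1]) (by linarith [hs'.2])
          linarith
      have h1 := hmono (a := a + 1) (b := t) ⟨le_rfl, ht.le⟩ ⟨ht.le, le_rfl⟩ ht.le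
      simp only at h1
      have h2 := hs (a + 1) (by linarith) ht
      have h3 : 0 < (a + 1) * (f (a + 1) - m) := by apply mul_pos <;> linarith
      have h4 : 0 < t * (f t - m) := by nlinarith
      exact (pos_iff_pos_of_mul_pos h4).1 (by linarith)
  have := ge_of_tendsto hl (b := m) (by
    filter_upwards [Filter.eventually_ge_atTop a] with t ht
    linarith [hall t ht])
  linarith

theorem xi_W2 {f g k : ℝ → ℝ} {a : ℝ} (ha : 1 ≤ a) (hcf : ContinuousOn f (Set.Ici a))
    (hc : ContinuousOn g (Set.Ici a))
    (hdf : ∀ t, a < t → HasDerivAt f (g t) t)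
    (hd : ∀ t, a + 1 < t → HasDerivAt g (k t) t)
    (he : ∀ t, a + 1 ≤ t → t * g t = 2 * f (t - 1) - f t)
    (hk : ∀ t, a + 1 ≤ t → t * k t = 2 * g (t - 1) - 2 * g t)
    (hl : Filter.Tendsto f Filter.atTop (nhds 0)) : ¬ ∀ t ∈ Set.Icc a (a + 1), 0 < g t := by
  intro hpos
  have hall : ∀ t, a ≤ t → 0 < g t := by
    refine xi_induct (b := a + 1) hc hpos ?_
    intro t ht hs
    have hmono : MonotoneOn (fun s => s ^ 2 * g s) (Set.Icc (a + 1) t) := by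
      refine monotoneOn_of_hasDerivWithinAt_nonneg (f' := fun s => (2 * s) * g s + s ^ 2 * k s) (convex_Icc _ _)
        (ContinuousOn.mul (by fun_prop) (hc.mono (fun x hx => by have := hx.1; simp; linarith))) ?_ ?_
      · rw [interior_Icc]; intro s hs
        have h2 : HasDerivAt (fun s : ℝ => s ^ 2) (2 * s) s := by simpa using hasDerivAt_pow 2 s
        exact (h2.mul (hd s hs.1)).hasDerivWithinAt
      · rw [interior_Icc]; intro s hs'
        have h1 := hk s hs'.1.le
        have h2 := hs (s - 1) (by linarith [hs'.1]) (by linarith [hs'.2])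
        have : 2 * s * g s + s ^ 2 * k s = s * (2 * g (s - 1)) := by
          rw [pow_two, mul_assoc s s, h1]; ring
        rw [this]
        have : 0 < s := by linarith [hs'.1]
        positivity
    have h1 := hmono (a := a + 1) (b := t) ⟨le_rfl, ht.le⟩ ⟨ht.le, le_rfl⟩ ht.le
    simp only at h1
    have h2 := hs (a + 1) (by linarith) ht
    have h3 : 0 < (a + 1) ^ 2 * g (a + 1) := by positivity
    exact (pos_iff_pos_of_mul_pos (h3.trans_le h1)).1 (by have : 0 < t := by linarith
                                                          positivity)
  have hm : StrictMonoOn f (Set.Ici a) := by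
    refine strictMonoOn_of_hasDerivWithinAt_pos (f' := g) (convex_Ici _) hcf ?_ ?_
    · rw [interior_Ici]; intro s hs; exact (hdf s hs).hasDerivWithinAt
    · rw [interior_Ici]; intro s hs; exact hall s (le_of_lt hs)
  have h1 : f a ≤ 0 := ge_of_tendsto hl (by
    filter_upwards [Filter.eventually_ge_atTop a] with t ht
    exact hm.monotoneOn (Set.mem_Ici.2 le_rfl) ht ht)
  have h2 := hm (a := a) (b := a + 1) (Set.mem_Ici.2 le_rfl) (by simp) (by linarith)
  have h3 := he (a + 1) le_rfl
  rw [show a + 1 - 1 = a by ring] at h3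
  have h4 : 0 < (a + 1) * g (a + 1) := mul_pos (by linarith) (hall _ (by linarith))
  linarith

theorem xi_zero {h : ℝ → ℝ} {a b : ℝ} (hc : ContinuousOn h (Set.Icc a b))
    (h1 : ¬ ∀ t ∈ Set.Icc a b, 0 < h t) (h2 : ¬ ∀ t ∈ Set.Icc a b, 0 < -h t) :
    ∃ z ∈ Set.Icc a b, h z = 0 := by
  push Not at h1 h2
  obtain ⟨x, hx, hx0⟩ := h1
  obtain ⟨y, hy, hy0⟩ := h2
  have hsub : Set.uIcc x y ⊆ Set.Icc a b := Set.uIcc_subset_Icc hx hy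
  obtain ⟨z, hz, hz0⟩ := intermediate_value_uIcc (hc.mono hsub)
    (show (0:ℝ) ∈ Set.uIcc (h x) (h y) from Set.mem_uIcc.2 (Or.inl ⟨hx0, by linarith⟩))
  exact ⟨z, hsub hz, hz0⟩

namespace XiF
variable {ξ : ℝ → ℝ}

theorem D2_all (H : XiF ξ) {u : ℝ} (hu : 3.5 ≤ u) : |xiD2 ξ u| < xiB u := by
  have := xi_induct (f := fun u => xiB u - |xiD2 ξ u|) (a := 3.5) (b := 4.5)
    ((xiB_cont.mono (Set.Ici_subset_Ici.2 (by norm_num))).sub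
      (H.c2.mono (Set.Ici_subset_Ici.2 (by norm_num))).abs)
    (fun t ht => sub_pos.2 (H.D2_base ht.1 ht.2)) (by
      intro t ht hs
      obtain ⟨s, hs1, hs2⟩ := exists_hasDerivAt_eq_slope (xiD1 ξ) (xiD2 ξ) (a := t - 1) (b := t) (by linarith)
        (H.c1.mono (fun x hx => by have := hx.1; simp; linarith))
        (fun x hx => H.d2 (by linarith [hx.1]) (by linarith [hx.1]))
      have h1 := hs s (by linarith [hs1.1]) hs1.2
      have h2 := xiB_anti (u := t - 1) (v := s) (by linarith) hs1.1.le
      have h3 := xiB_rec (u := t) (by linarith)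
      have ht0 : 0 < t := by linarith
      have e : t * xiD2 ξ t = -2 * xiD2 ξ s := by
        rw [hs2]; unfold xiD2; field_simp; ring
      have e2 : t * |xiD2 ξ t| = 2 * |xiD2 ξ s| := by
        rw [← abs_of_pos ht0, ← abs_mul, abs_of_pos ht0, e, abs_mul]; norm_num
      have : 0 < t * (xiB t - |xiD2 ξ t|) := by
        rw [mul_sub, e2, h3]; linarith
      exact (pos_iff_pos_of_mul_pos this).1 ht0) u hu
  linarith

theorem exC (H : XiF ξ) : ∃ C : ℝ, ∀ u, 5 ≤ u → |xiD1 ξ u - C| ≤ 2.5 / u ^ 2 := by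
  have hd : ∀ x : ℝ, 0 < x → HasDerivAt (fun u : ℝ => 2.5 / u ^ 2) (-(5 / x ^ 3)) x := by
    intro x hx
    have := (hasDerivAt_const x (2.5:ℝ)).div (hasDerivAt_pow 2 x) (by positivity)
    refine this.congr_deriv ?_
    field_simp
    norm_num
    ring
  have hco : ContinuousOn (fun u : ℝ => 2.5 / u ^ 2) (Set.Ici 5) := fun x hx =>
    (hd x (by simp at hx; linarith)).continuousAt.continuousWithinAt
  have hb : ∀ x : ℝ, 5 < x → |xiD2 ξ x| ≤ 5 / x ^ 3 := fun x hx =>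
    (H.D2_all (by linarith)).le.trans (xiB_decay hx.le)
  have m1 : MonotoneOn (fun u => xiD1 ξ u - 2.5 / u ^ 2) (Set.Ici 5) := by
    refine monotoneOn_of_hasDerivWithinAt_nonneg (f' := fun u => xiD2 ξ u - -(5 / u ^ 3)) (convex_Ici _)
      ((H.c1.mono (Set.Ici_subset_Ici.2 (by norm_num))).sub hco) ?_ ?_
    · rw [interior_Ici]; intro x hx
      simp at hx
      exact ((H.d2 (by linarith) (by linarith)).sub (hd x (by linarith))).hasDerivWithinAt
    · rw [interior_Ici]; intro x hx
      linarith [(abs_le.1 (hb x hx)).1]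
  have m2 : AntitoneOn (fun u => xiD1 ξ u + 2.5 / u ^ 2) (Set.Ici 5) := by
    refine antitoneOn_of_hasDerivWithinAt_nonpos (f' := fun u => xiD2 ξ u + -(5 / u ^ 3)) (convex_Ici _)
      ((H.c1.mono (Set.Ici_subset_Ici.2 (by norm_num))).add hco) ?_ ?_
    · rw [interior_Ici]; intro x hx
      simp at hx
      exact ((H.d2 (by linarith) (by linarith)).add (hd x (by linarith))).hasDerivWithinAt
    · rw [interior_Ici]; intro x hx
      linarith [(abs_le.1 (hb x hx)).2]
  have key : ∀ u v, 5 ≤ u → 5 ≤ v → xiD1 ξ v - 2.5 / v ^ 2 ≤ xiD1 ξ u + 2.5 / u ^ 2 := by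
    intro u v hu hv
    have hw : 5 ≤ max u v := hu.trans (le_max_left _ _)
    have a1 := m1 (a := v) (b := max u v) hv hw (le_max_right _ _)
    have a2 := m2 (a := u) (b := max u v) hu hw (le_max_left _ _)
    simp only at a1 a2
    have : 0 ≤ 2.5 / (max u v) ^ 2 := by positivity
    linarith
  refine ⟨sSup ((fun u => xiD1 ξ u - 2.5 / u ^ 2) '' Set.Ici 5), fun u hu => ?_⟩
  have b1 : xiD1 ξ u - 2.5 / u ^ 2 ≤ sSup ((fun u => xiD1 ξ u - 2.5 / u ^ 2) '' Set.Ici 5) := by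
    refine le_csSup ⟨xiD1 ξ u + 2.5 / u ^ 2, ?_⟩ ⟨u, hu, rfl⟩
    rintro _ ⟨v, hv, rfl⟩
    exact key u v hu hv
  have b2 : sSup ((fun u => xiD1 ξ u - 2.5 / u ^ 2) '' Set.Ici 5) ≤ xiD1 ξ u + 2.5 / u ^ 2 := by
    refine csSup_le ⟨_, u, hu, rfl⟩ ?_
    rintro _ ⟨v, hv, rfl⟩
    exact key u v hu hv
  rw [abs_le]
  constructor <;> linarith

theorem exC2 (H : XiF ξ) : ∃ C : ℝ, ∀ u, 6 ≤ u → |ξ u - (u + 2) * C| ≤ 10 / u := by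
  obtain ⟨C, hC⟩ := H.exC
  refine ⟨C, fun u hu => ?_⟩
  have hu0 : 0 < u := by linarith
  obtain ⟨s, hs1, hs2⟩ := exists_hasDerivAt_eq_slope ξ (xiD1 ξ) (a := u - 1) (b := u) (by linarith)
        (H.cont.mono (fun x hx => by have := hx.1; simp; linarith))
        (fun x hx => H.dh (by linarith [hx.1]))
  rw [show u - (u - 1) = 1 by ring, div_one] at hs2
  have h1 := hC u (by linarith)
  have h2 := hC s (by linarith [hs1.1])
  have e : u * xiD1 ξ u = 2 * ξ (u - 1) - ξ u := by unfold xiD1; field_simp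
  have e2 : ξ u - (u + 2) * C = u * (xiD1 ξ u - C) + 2 * (xiD1 ξ s - C) := by
    rw [mul_sub, e, hs2]; ring
  have h3 : u * |xiD1 ξ u - C| ≤ 2.5 / u := by
    calc _ ≤ u * (2.5 / u ^ 2) := by gcongr
      _ = _ := by field_simp
  have h4 : 2.5 / s ^ 2 ≤ 2.5 / u := by
    gcongr
    have := hs1.1
    nlinarith
  rw [e2]
  calc _ ≤ |u * (xiD1 ξ u - C)| + |2 * (xiD1 ξ s - C)| := abs_add_le _ _
    _ = u * |xiD1 ξ u - C| + 2 * |xiD1 ξ s - C| := by rw [abs_mul, abs_mul, abs_of_pos hu0]; norm_num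
    _ ≤ 2.5 / u + 2 * (2.5 / u) := by linarith
    _ = 7.5 / u := by ring
    _ ≤ 10 / u := by gcongr; norm_num

theorem delta_lim {c : ℝ} (hC : ∀ u, 6 ≤ u → |ξ u - (u + 2) * c| ≤ 10 / u) :
    Filter.Tendsto (fun u => ξ u - (u + 2) * c) Filter.atTop (nhds 0) := by
  refine squeeze_zero_norm' (a := fun u => 10 / u) ?_ (Filter.Tendsto.const_div_atTop Filter.tendsto_id 10)
  filter_upwards [Filter.eventually_ge_atTop 6] with u hu
  exact hC u hu

theorem D1_all (H : XiF ξ) {c : ℝ} (hc1 : 0.305 < c) (hc2 : c < 0.319)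
    (hC : ∀ u, 6 ≤ u → |ξ u - (u + 2) * c| ≤ 10 / u) {u : ℝ} (hu : 2.5 ≤ u) :
    |xiD1 ξ u - c| < xiB u := by
  rcases le_total u 3.5 with h | h
  · exact H.D1_base hc1 hc2 hu h
  have cf : ContinuousOn (fun u => ξ u - (u + 2) * c) (Set.Ici u) :=
    (H.cont.mono (Set.Ici_subset_Ici.2 (by linarith))).sub (by fun_prop)
  have cg : ContinuousOn (fun u => xiD1 ξ u - c) (Set.Ici u) :=
    (H.c1.mono (Set.Ici_subset_Ici.2 (by linarith))).sub (by fun_prop)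
  have df : ∀ t, u < t → HasDerivAt (fun u => ξ u - (u + 2) * c) (xiD1 ξ t - c) t := by
    intro t ht
    refine ((H.dh (u := t) (by linarith)).sub (((hasDerivAt_id t).add_const 2).mul_const c)).congr_deriv ?_
    ring
  have dg : ∀ t, u + 1 < t → HasDerivAt (fun u => xiD1 ξ u - c) (xiD2 ξ t) t := fun t ht =>
    (H.d2 (u := t) (by linarith) (by linarith)).sub_const c
  have e1 : ∀ t, u + 1 ≤ t → t * (xiD1 ξ t - c) = 2 * (ξ (t - 1) - (t - 1 + 2) * c) - (ξ t - (t + 2) * c) := by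
    intro t ht
    have : t ≠ 0 := by linarith
    unfold xiD1; field_simp; ring
  have e2 : ∀ t, u + 1 ≤ t → t * xiD2 ξ t = 2 * (xiD1 ξ (t - 1) - c) - 2 * (xiD1 ξ t - c) := by
    intro t ht
    have : t ≠ 0 := by linarith
    unfold xiD2; field_simp; ring
  have w1 := xi_W2 (by linarith) cf cg df dg e1 e2 (delta_lim hC)
  have w2 := xi_W2 (by linarith) cf.neg cg.neg (fun t ht => (df t ht).neg) (fun t ht => (dg t ht).neg)
    (fun t ht => by have := e1 t ht; simp only [Pi.neg_apply]; linarith)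
    (fun t ht => by have := e2 t ht; simp only [Pi.neg_apply]; linarith)
    (by have := (delta_lim hC).neg; rw [neg_zero] at this; exact this)
  obtain ⟨z, hz, hz0⟩ := xi_zero (cg.mono (fun x hx => hx.1)) w1 w2
  rcases hz.1.eq_or_lt with rfl | hlt
  · rw [hz0, abs_zero]; exact xiB_pos (by linarith)
  obtain ⟨s, hs1, hs2⟩ := exists_hasDerivAt_eq_slope (xiD1 ξ) (xiD2 ξ) (a := u) (b := z) hlt
        (H.c1.mono (fun x hx => by have := hx.1; simp; linarith))
        (fun x hx => H.d2 (by linarith [hx.1]) (by linarith [hx.1]))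
  have b1 := H.D2_all (u := s) (by linarith [hs1.1])
  have b2 := xiB_anti (show 2 ≤ u by linarith) hs1.1.le
  have e : xiD1 ξ u - c = -((z - u) * xiD2 ξ s) := by
    have : z - u ≠ 0 := by linarith
    rw [hs2]; field_simp; linarith
  rw [e, abs_neg, abs_mul, abs_of_pos (by linarith)]
  have : z - u ≤ 1 := by linarith [hz.2]
  nlinarith [abs_nonneg (xiD2 ξ s)]

theorem x_all (H : XiF ξ) {c : ℝ} (hc1 : 0.305 < c) (hc2 : c < 0.319)
    (hC : ∀ u, 6 ≤ u → |ξ u - (u + 2) * c| ≤ 10 / u) {u : ℝ} (hu : 1.5 ≤ u) :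
    |ξ u - (u + 2) * c| < xiB u := by
  rcases le_total u 2.5 with h | h
  · exact H.x_base hc1 hc2 hu h
  have cf : ContinuousOn (fun u => ξ u - (u + 2) * c) (Set.Ici u) :=
    (H.cont.mono (Set.Ici_subset_Ici.2 (by linarith))).sub (by fun_prop)
  have df : ∀ t, u < t → HasDerivAt (fun u => ξ u - (u + 2) * c) (xiD1 ξ t - c) t := by
    intro t ht
    refine ((H.dh (u := t) (by linarith)).sub (((hasDerivAt_id t).add_const 2).mul_const c)).congr_deriv ?_
    ring
  have e1 : ∀ t, u + 1 ≤ t → t * (xiD1 ξ t - c) = 2 * (ξ (t - 1) - (t - 1 + 2) * c) - (ξ t - (t + 2) * c) := by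
    intro t ht
    have : t ≠ 0 := by linarith
    unfold xiD1; field_simp; ring
  have w1 := xi_W1 (by linarith) cf (fun t ht => df t (by linarith)) e1 (delta_lim hC)
  have w2 := xi_W1 (by linarith) cf.neg (fun t ht => (df t (by linarith)).neg)
    (fun t ht => by have := e1 t ht; simp only [Pi.neg_apply]; linarith)
    (by have := (delta_lim hC).neg; rw [neg_zero] at this; exact this)
  obtain ⟨z, hz, hz0⟩ := xi_zero (cf.mono (fun x hx => hx.1)) w1 w2
  rcases hz.1.eq_or_lt with rfl | hlt
  · rw [hz0, abs_zero]; exact xiB_pos (by linarith)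
  obtain ⟨s, hs1, hs2⟩ := exists_hasDerivAt_eq_slope (fun u => ξ u - (u + 2) * c) (fun t => xiD1 ξ t - c) (a := u) (b := z) hlt
        (cf.mono (fun x hx => hx.1))
        (fun x hx => df x hx.1)
  have b1 := H.D1_all hc1 hc2 hC (u := s) (by linarith [hs1.1])
  have b2 := xiB_anti (show 2 ≤ u by linarith) hs1.1.le
  have e : ξ u - (u + 2) * c = -((z - u) * (xiD1 ξ s - c)) := by
    have : z - u ≠ 0 := by linarith
    rw [hs2]; field_simp; linarith
  rw [e, abs_neg, abs_mul, abs_of_pos (by linarith)]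
  have : z - u ≤ 1 := by linarith [hz.2]
  nlinarith [abs_nonneg (xiD1 ξ s - c)]

end XiF

theorem xi_pow_int (n : ℕ) {s : ℝ} (hs : 0 < s) :
    IntegrableOn (fun u : ℝ => u ^ n * Real.exp (-(s * u))) (Set.Ioi 1) := by
  have h := integrableOn_rpow_mul_exp_neg_mul_rpow (p := 1) (s := (n:ℝ)) (b := s)
    (by have : (0:ℝ) ≤ n := Nat.cast_nonneg n
        linarith) one_pos hs
  refine (h.mono_set (Set.Ioi_subset_Ioi zero_le_one)).congr_fun ?_ measurableSet_Ioi
  intro u _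
  simp [Real.rpow_natCast]

theorem xi_exp_int {s : ℝ} (hs : 0 < s) (c : ℝ) :
    ∫ u in Set.Ioi c, Real.exp (-(s * u)) = Real.exp (-(s * c)) / s := by
  have := integral_exp_mul_Ioi (a := -s) (by linarith) c
  simp only [neg_mul] at this
  rw [this]; field_simp

theorem xi_one_int {s : ℝ} (hs : 0 < s) :
    ∫ u in Set.Ioi (1:ℝ), u * Real.exp (-(s * u)) = Real.exp (-s) * (1 / s + 1 / s ^ 2) := by
  have hi := xi_pow_int 1 hs
  simp only [pow_one] at hi
  have hd : ∀ x : ℝ, HasDerivAt (fun u : ℝ => -(u / s + 1 / s ^ 2) * Real.exp (-(s * u)))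
      (x * Real.exp (-(s * x))) x := by
    intro x
    have h1 : HasDerivAt (fun u : ℝ => -(u / s + 1 / s ^ 2)) (-(1 / s)) x :=
      (((hasDerivAt_id x).div_const s).add_const _).neg
    have h2 : HasDerivAt (fun u : ℝ => Real.exp (-(s * u))) (Real.exp (-(s * x)) * (-(s * 1))) x :=
      (((hasDerivAt_id x).const_mul s).neg).exp
    refine (h1.mul h2).congr_deriv ?_
    field_simp; ring
  have hl : Filter.Tendsto (fun u : ℝ => -(u / s + 1 / s ^ 2) * Real.exp (-(s * u))) Filter.atTop (nhds 0) := by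
    have t1 := Real.tendsto_pow_mul_exp_neg_atTop_nhds_zero 1
    have t0 := Real.tendsto_pow_mul_exp_neg_atTop_nhds_zero 0
    have ts : Filter.Tendsto (fun u : ℝ => s * u) Filter.atTop Filter.atTop :=
      Filter.tendsto_id.const_mul_atTop hs
    have := ((t1.comp ts).const_mul (-(1 / s ^ 2))).add ((t0.comp ts).const_mul (-(1 / s ^ 2)))
    simp only [mul_zero, add_zero] at this
    refine this.congr ?_
    intro u
    simp only [Function.comp]
    field_simp; ring
  rw [integral_Ioi_of_hasDerivAt_of_tendsto (hd 1).continuousAt.continuousWithinAt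
    (fun x _ => hd x) hi hl]
  rw [mul_one]; ring

noncomputable def xiL (ξ : ℝ → ℝ) (s : ℝ) : ℝ := ∫ u in Set.Ioi (1:ℝ), ξ u * Real.exp (-(s * u))

namespace XiF
variable {ξ : ℝ → ℝ}

theorem bddK (H : XiF ξ) {C : ℝ} (hC : ∀ u, 6 ≤ u → |ξ u - (u+2)*C| ≤ 10/u) :
    ∃ K : ℝ, 0 < K ∧ ∀ u, 1 ≤ u → |ξ u - C * u| ≤ K := by
  have hc : ContinuousOn (fun u => ξ u - C * u) (Set.Icc 1 6) :=
    (H.cont.mono (fun x hx => hx.1)).sub (by fun_prop)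
  obtain ⟨K, hK⟩ := isCompact_Icc.exists_bound_of_continuousOn hc
  refine ⟨|K| + 2 * |C| + 2, by positivity, fun u hu => ?_⟩
  rcases le_total u 6 with h | h
  · have := hK u ⟨hu, h⟩
    rw [Real.norm_eq_abs] at this
    have := le_abs_self K
    have := abs_nonneg C
    linarith
  · have h1 := hC u h
    have h2 : 10 / u ≤ 2 := by
      rw [div_le_iff₀ (by linarith)]; linarith
    have h3 : ξ u - C * u = (ξ u - (u+2)*C) + 2 * C := by ring
    have h4 := abs_add_le (ξ u - (u+2)*C) (2 * C)
    rw [← h3, abs_mul, abs_two] at h4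
    have := abs_nonneg K
    linarith

theorem bddK2 {C K : ℝ} (hK0 : 0 < K) (hK : ∀ u, 1 ≤ u → |ξ u - C * u| ≤ K) :
    ∀ u, 1 ≤ u → |ξ u| ≤ (K + |C|) * u := by
  intro u hu
  have h1 := hK u hu
  have h4 := abs_add_le (ξ u - C * u) (C * u)
  rw [sub_add_cancel, abs_mul, abs_of_pos (by linarith : 0 < u)] at h4
  nlinarith

theorem meas (H : XiF ξ) : AEStronglyMeasurable ξ (volume.restrict (Set.Ioi 1)) :=
  (H.cont.mono Set.Ioi_subset_Ici_self).aestronglyMeasurable measurableSet_Ioi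

theorem measE (H : XiF ξ) (n : ℕ) (s : ℝ) :
    AEStronglyMeasurable (fun u => u ^ n * ξ u * Real.exp (-(s * u))) (volume.restrict (Set.Ioi 1)) := by
  have := H.meas
  have h1 : AEStronglyMeasurable (fun u : ℝ => u ^ n) (volume.restrict (Set.Ioi 1)) :=
    (by fun_prop : Continuous fun u : ℝ => u ^ n).aestronglyMeasurable
  have h2 : AEStronglyMeasurable (fun u : ℝ => Real.exp (-(s * u))) (volume.restrict (Set.Ioi 1)) :=
    (by fun_prop : Continuous fun u : ℝ => Real.exp (-(s * u))).aestronglyMeasurable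
  exact (h1.mul this).mul h2

theorem intE (H : XiF ξ) {K : ℝ} (hK : ∀ u, 1 ≤ u → |ξ u| ≤ K * u) (n : ℕ) {s : ℝ} (hs : 0 < s) :
    IntegrableOn (fun u => u ^ n * ξ u * Real.exp (-(s * u))) (Set.Ioi 1) := by
  refine Integrable.mono' ((xi_pow_int (n + 1) hs).const_mul K) (H.measE n s) ?_
  refine (ae_restrict_iff' measurableSet_Ioi).2 (ae_of_all _ fun u hu => ?_)
  have hu : 1 < u := hu
  have h0 : 0 < u := by linarith
  rw [Real.norm_eq_abs, abs_mul, abs_mul, abs_of_pos (pow_pos h0 n), abs_of_pos (Real.exp_pos _)]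
  calc u ^ n * |ξ u| * Real.exp (-(s * u)) ≤ u ^ n * (K * u) * Real.exp (-(s * u)) := by
        gcongr; exact hK u hu.le
    _ = K * (u ^ (n + 1) * Real.exp (-(s * u))) := by ring

theorem L_deriv (H : XiF ξ) {K : ℝ} (hK : ∀ u, 1 ≤ u → |ξ u| ≤ K * u) {s : ℝ} (hs : 0 < s) :
    HasDerivAt (xiL ξ) (-∫ u in Set.Ioi (1:ℝ), u * ξ u * Real.exp (-(s * u))) s := by
  have key := hasDerivAt_integral_of_dominated_loc_of_deriv_le (μ := volume.restrict (Set.Ioi (1:ℝ)))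
    (F := fun s u => ξ u * Real.exp (-(s * u)))
    (F' := fun s u => -(u * ξ u * Real.exp (-(s * u)))) (x₀ := s) (s := Set.Ioi (s / 2))
    (bound := fun u => K * (u ^ 2 * Real.exp (-(s / 2 * u))))
    (Ioi_mem_nhds (by linarith))
    (Filter.Eventually.of_forall fun x => by simpa using H.measE 0 x)
    (by simpa [IntegrableOn] using H.intE hK 0 hs)
    (by have := (H.measE 1 s).neg; simp only [pow_one] at this; exact this)
    ?_ ((xi_pow_int 2 (by linarith : 0 < s / 2)).const_mul K) ?_
  · have := key.2
    rw [integral_neg] at this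
    exact this
  · refine (ae_restrict_iff' measurableSet_Ioi).2 (ae_of_all _ fun u hu x hx => ?_)
    have hu : 1 < u := hu
    have hx : s / 2 < x := hx
    have h0 : 0 < u := by linarith
    rw [norm_neg, Real.norm_eq_abs, abs_mul, abs_mul, abs_of_pos h0, abs_of_pos (Real.exp_pos _)]
    have hk := hK u hu.le
    calc u * |ξ u| * Real.exp (-(x * u)) ≤ u * (K * u) * Real.exp (-(s / 2 * u)) := by
          have : Real.exp (-(x * u)) ≤ Real.exp (-(s / 2 * u)) := by
            apply Real.exp_le_exp.2; nlinarith
          have := (abs_nonneg (ξ u)).trans hk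
          gcongr
      _ = K * (u ^ 2 * Real.exp (-(s / 2 * u))) := by ring
  · refine ae_of_all _ fun u x _ => ?_
    have h2 : HasDerivAt (fun x : ℝ => Real.exp (-(x * u))) (Real.exp (-(x * u)) * (-(1 * u))) x :=
      (((hasDerivAt_id x).mul_const u).neg).exp
    refine (h2.const_mul (ξ u)).congr_deriv ?_
    ring

theorem L_eq (H : XiF ξ) {K : ℝ} (hK : ∀ u, 1 ≤ u → |ξ u| ≤ K * u) {s : ℝ} (hs : 0 < s) :
    s * (∫ u in Set.Ioi (1:ℝ), u * ξ u * Real.exp (-(s * u))) = 2 * Real.exp (-s) * (1 + xiL ξ s) := by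
  have hi0 : IntegrableOn (fun u => ξ u * Real.exp (-(s * u))) (Set.Ioi 1) := by
    simpa using H.intE hK 0 hs
  have hi1 : IntegrableOn (fun u => u * ξ u * Real.exp (-(s * u))) (Set.Ioi 1) := by
    simpa using H.intE hK 1 hs
  have hu : Set.Ioc (1:ℝ) 2 ∪ Set.Ioi 2 = Set.Ioi 1 := Set.Ioc_union_Ioi_eq_Ioi one_le_two
  have hdj : Disjoint (Set.Ioc (1:ℝ) 2) (Set.Ioi 2) := Set.Ioc_disjoint_Ioi le_rfl
  have hi12 := hi1.mono_set (Set.Ioi_subset_Ioi one_le_two)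
  have sp : ∫ u in Set.Ioi (1:ℝ), u * ξ u * Real.exp (-(s * u)) =
      (∫ u in Set.Ioc (1:ℝ) 2, u * ξ u * Real.exp (-(s * u))) + ∫ u in Set.Ioi (2:ℝ), u * ξ u * Real.exp (-(s * u)) := by
    rw [← hu]
    exact setIntegral_union hdj measurableSet_Ioi (hi1.mono_set (fun x hx => hx.1)) hi12
  have hex : IntegrableOn (fun u : ℝ => Real.exp (-(s * u))) (Set.Ioi 1) := by
    simpa using xi_pow_int 0 hs
  have sp2 : ∫ u in Set.Ioi (1:ℝ), Real.exp (-(s * u)) =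
      (∫ u in Set.Ioc (1:ℝ) 2, Real.exp (-(s * u))) + ∫ u in Set.Ioi (2:ℝ), Real.exp (-(s * u)) := by
    rw [← hu]
    exact setIntegral_union hdj measurableSet_Ioi (hex.mono_set (fun x hx => hx.1))
      (hex.mono_set (Set.Ioi_subset_Ioi one_le_two))
  rw [xi_exp_int hs, xi_exp_int hs] at sp2
  have e1 : ∫ u in Set.Ioc (1:ℝ) 2, u * ξ u * Real.exp (-(s * u)) = 2 * ∫ u in Set.Ioc (1:ℝ) 2, Real.exp (-(s * u)) := by
    rw [← integral_const_mul]
    refine setIntegral_congr_fun measurableSet_Ioc fun u hu => ?_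
    have : u ≠ 0 := by have := hu.1; linarith
    rw [H.eq12 hu.1.le hu.2]; field_simp
  have hsh : ∀ u : ℝ, ξ (u - 1) * Real.exp (-(s * u)) = Real.exp (-s) * (ξ (u - 1) * Real.exp (-(s * (u - 1)))) := by
    intro u
    rw [mul_left_comm, ← Real.exp_add]; congr 2; ring
  have emb : MeasurableEmbedding (fun u : ℝ => u - 1) := (Homeomorph.subRight (1:ℝ)).measurableEmbedding
  have mp : MeasurePreserving (fun u : ℝ => u - 1) volume volume := measurePreserving_sub_right volume 1
  have pre : (fun u : ℝ => u - 1) ⁻¹' Set.Ioi 1 = Set.Ioi 2 := by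
    ext x; simp; constructor <;> intro h <;> linarith
  have i3 : IntegrableOn (fun u => ξ (u - 1) * Real.exp (-(s * u))) (Set.Ioi 2) := by
    have := (mp.integrableOn_comp_preimage emb).2 hi0
    rw [pre] at this
    refine IntegrableOn.congr_fun (this.const_mul (Real.exp (-s))) ?_ measurableSet_Ioi
    intro u _
    exact (hsh u).symm
  have e3 : ∫ u in Set.Ioi (2:ℝ), ξ (u - 1) * Real.exp (-(s * u)) = Real.exp (-s) * xiL ξ s := by
    simp_rw [hsh]
    rw [integral_const_mul, ← pre, xiL]
    congr 1
    exact mp.setIntegral_preimage_emb emb (fun u => ξ u * Real.exp (-(s * u))) (Set.Ioi 1)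
  have hd : ∀ x ∈ Set.Ioi (2:ℝ), HasDerivAt (fun u => u * ξ u * Real.exp (-(s * u)))
      (2 * (ξ (x - 1) * Real.exp (-(s * x))) - s * (x * ξ x * Real.exp (-(s * x)))) x := by
    intro x hx
    have hx : 2 < x := hx
    have h2 : HasDerivAt (fun u : ℝ => Real.exp (-(s * u))) (Real.exp (-(s * x)) * (-(s * 1))) x :=
      (((hasDerivAt_id x).const_mul s).neg).exp
    refine (((hasDerivAt_id x).mul (H.dh hx)).mul h2).congr_deriv ?_
    have : x ≠ 0 := by linarith
    simp only [id, Pi.mul_apply]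
    unfold xiD1; field_simp; ring
  have hl : Filter.Tendsto (fun u => u * ξ u * Real.exp (-(s * u))) Filter.atTop (nhds 0) := by
    have t1 := Real.tendsto_pow_mul_exp_neg_atTop_nhds_zero 2
    have ts : Filter.Tendsto (fun u : ℝ => s * u) Filter.atTop Filter.atTop :=
      Filter.tendsto_id.const_mul_atTop hs
    have := ((t1.comp ts).const_mul (K / s ^ 2))
    rw [mul_zero] at this
    refine squeeze_zero_norm' ?_ this
    filter_upwards [Filter.eventually_ge_atTop 1] with u hu
    have h0 : 0 < u := by linarith
    rw [Real.norm_eq_abs, abs_mul, abs_mul, abs_of_pos h0, abs_of_pos (Real.exp_pos _)]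
    calc u * |ξ u| * Real.exp (-(s * u)) ≤ u * (K * u) * Real.exp (-(s * u)) := by
          gcongr; exact hK u hu
      _ = _ := by simp only [Function.comp]; field_simp
  have hcw : ContinuousWithinAt (fun u => u * ξ u * Real.exp (-(s * u))) (Set.Ici 2) 2 := by
    have := (H.contAt (by norm_num : (1:ℝ) < 2))
    have h3 : ContinuousAt (fun u => u * ξ u * Real.exp (-(s * u))) 2 :=
      (continuousAt_id.mul this).mul (by fun_prop)
    exact h3.continuousWithinAt
  have ib := integral_Ioi_of_hasDerivAt_of_tendsto hcw hd
    ((i3.const_mul 2).sub (hi12.const_mul s)) hl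
  rw [integral_sub (i3.const_mul 2) (hi12.const_mul s), integral_const_mul, integral_const_mul, e3,
    H.eq12 one_le_two le_rfl] at ib
  rw [sp, e1, mul_add]
  have : ∫ u in Set.Ioc (1:ℝ) 2, Real.exp (-(s * u)) = (Real.exp (-(s * 1)) - Real.exp (-(s * 2))) / s := by
    rw [sub_div]; linarith
  rw [this]
  have h5 : s * (2 * ((Real.exp (-(s * 1)) - Real.exp (-(s * 2))) / s)) = 2 * (Real.exp (-(s * 1)) - Real.exp (-(s * 2))) := by
    field_simp
  rw [h5, mul_one]
  linarith

theorem L_err (H : XiF ξ) {C K : ℝ} (hK0 : 0 < K) (hK : ∀ u, 1 ≤ u → |ξ u - C * u| ≤ K) {s : ℝ} (hs : 0 < s) :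
    |xiL ξ s - C * (Real.exp (-s) * (1 / s + 1 / s ^ 2))| ≤ K * (Real.exp (-s) / s) := by
  have hi0 : IntegrableOn (fun u => ξ u * Real.exp (-(s * u))) (Set.Ioi 1) := by
    simpa using H.intE (bddK2 hK0 hK) 0 hs
  have hex : IntegrableOn (fun u : ℝ => Real.exp (-(s * u))) (Set.Ioi 1) := by
    simpa using xi_pow_int 0 hs
  have hi := xi_pow_int 1 hs
  simp only [pow_one] at hi
  have e1 := xi_exp_int hs 1
  rw [mul_one] at e1
  rw [← xi_one_int hs, ← e1, xiL, ← integral_const_mul, ← integral_const_mul, ← integral_sub hi0 (hi.const_mul C),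
    ← Real.norm_eq_abs]
  refine norm_integral_le_of_norm_le (hex.const_mul K) ?_
  refine (ae_restrict_iff' measurableSet_Ioi).2 (ae_of_all _ fun u hu => ?_)
  have hu : 1 < u := hu
  have : ξ u * Real.exp (-(s * u)) - C * (u * Real.exp (-(s * u))) = (ξ u - C * u) * Real.exp (-(s * u)) := by ring
  rw [this, Real.norm_eq_abs, abs_mul, abs_of_pos (Real.exp_pos _)]
  gcongr
  exact hK u hu.le

theorem G_const (H : XiF ξ) {K : ℝ} (hK : ∀ u, 1 ≤ u → |ξ u| ≤ K * u) {a b : ℝ} (ha : 0 < a) (hb : 0 < b) :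
    a ^ 2 * (1 + xiL ξ a) * Real.exp (-2 * xiEin a) = b ^ 2 * (1 + xiL ξ b) * Real.exp (-2 * xiEin b) := by
  have hd : ∀ s : ℝ, 0 < s → HasDerivAt (fun s => s ^ 2 * (1 + xiL ξ s) * Real.exp (-2 * xiEin s)) 0 s := by
    intro s hs
    have h1 := (H.L_deriv hK hs).const_add 1
    have h2 := ((xiEin_deriv s).const_mul (-2)).exp
    refine (((hasDerivAt_pow 2 s).mul h1).mul h2).congr_deriv ?_
    have h3 := H.L_eq hK hs
    rw [xiPhi_ne hs.ne']
    have h4 : (∫ u in Set.Ioi (1:ℝ), u * ξ u * Real.exp (-(s * u))) = 2 * Real.exp (-s) * (1 + xiL ξ s) / s := by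
      rw [eq_div_iff hs.ne', ← h3]; ring
    rw [h4]
    simp only [Pi.mul_apply, Nat.cast_ofNat, show (2:ℕ) - 1 = 1 from rfl, pow_one]
    field_simp
    ring
  have := (convex_Ioi (0:ℝ)).is_const_of_fderivWithin_eq_zero (𝕜 := ℝ)
    (f := fun s => s ^ 2 * (1 + xiL ξ s) * Real.exp (-2 * xiEin s))
    (fun s hs => (hd s hs).differentiableAt.differentiableWithinAt)
    (fun s hs => by
      rw [fderivWithin_of_isOpen isOpen_Ioi hs, (hd s hs).hasFDerivAt.fderiv]
      ext; simp) (show a ∈ Set.Ioi 0 from ha) (show b ∈ Set.Ioi 0 from hb)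
  exact this

theorem C_eq (H : XiF ξ) {C : ℝ} (hC : ∀ u, 6 ≤ u → |ξ u - (u+2)*C| ≤ 10/u) :
    C = Real.exp (-2 * Real.eulerMascheroniConstant) := by
  obtain ⟨K, hK0, hK⟩ := H.bddK hC
  have hK2 := bddK2 hK0 hK
  have hz : xiEin 0 = 0 := by simp [xiEin]
  have lim0 : Filter.Tendsto (fun s => s ^ 2 * (1 + xiL ξ s) * Real.exp (-2 * xiEin s))
      (nhdsWithin 0 (Set.Ioi 0)) (nhds C) := by
    have hE : Filter.Tendsto (fun s => Real.exp (-2 * xiEin s)) (nhdsWithin 0 (Set.Ioi 0)) (nhds 1) := by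
      have : ContinuousAt (fun s => Real.exp (-2 * xiEin s)) 0 :=
        ((xiEin_deriv 0).continuousAt.const_mul (-2)).rexp
      have h2 := this.tendsto
      simp only [hz, mul_zero, Real.exp_zero] at h2
      exact h2.mono_left nhdsWithin_le_nhds
    have hP : Filter.Tendsto (fun s : ℝ => s ^ 2 + C * (Real.exp (-s) * (s + 1))) (nhdsWithin 0 (Set.Ioi 0)) (nhds C) := by
      have : Continuous (fun s : ℝ => s ^ 2 + C * (Real.exp (-s) * (s + 1))) := by fun_prop
      have h2 := this.tendsto 0
      simp only [neg_zero, Real.exp_zero] at h2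
      norm_num at h2
      exact h2.mono_left nhdsWithin_le_nhds
    have hQ : Filter.Tendsto (fun s : ℝ => s ^ 2 * (1 + xiL ξ s) - (s ^ 2 + C * (Real.exp (-s) * (s + 1)))) (nhdsWithin 0 (Set.Ioi 0)) (nhds 0) := by
      have hb : Filter.Tendsto (fun s : ℝ => K * (s * Real.exp (-s))) (nhdsWithin 0 (Set.Ioi 0)) (nhds 0) := by
        have : Continuous (fun s : ℝ => K * (s * Real.exp (-s))) := by fun_prop
        have h2 := this.tendsto 0
        simp only [zero_mul, mul_zero] at h2
        exact h2.mono_left nhdsWithin_le_nhds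
      refine squeeze_zero_norm' ?_ hb
      filter_upwards [self_mem_nhdsWithin] with s hs
      have hs : 0 < s := hs
      have h1 := H.L_err hK0 hK hs
      have h2 : s ^ 2 * (1 + xiL ξ s) - (s ^ 2 + C * (Real.exp (-s) * (s + 1)))
          = s ^ 2 * (xiL ξ s - C * (Real.exp (-s) * (1 / s + 1 / s ^ 2))) := by
        field_simp; ring
      rw [h2, Real.norm_eq_abs, abs_mul, abs_of_pos (by positivity : 0 < s ^ 2)]
      calc s ^ 2 * |xiL ξ s - C * (Real.exp (-s) * (1 / s + 1 / s ^ 2))| ≤ s ^ 2 * (K * (Real.exp (-s) / s)) := by gcongr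
        _ = _ := by field_simp
    have := (hQ.add hP).mul hE
    simpa using this
  have hG : ∀ a : ℝ, 0 < a → a ^ 2 * (1 + xiL ξ a) * Real.exp (-2 * xiEin a) = C := by
    intro a ha
    refine tendsto_nhds_unique (f := fun _ : ℝ => a ^ 2 * (1 + xiL ξ a) * Real.exp (-2 * xiEin a))
      (l := nhdsWithin (0:ℝ) (Set.Ioi 0)) tendsto_const_nhds (lim0.congr' ?_)
    filter_upwards [self_mem_nhdsWithin] with s hs
    exact H.G_const hK2 hs ha
  have hL : Filter.Tendsto (xiL ξ) Filter.atTop (nhds 0) := by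
    have hb : Filter.Tendsto (fun s : ℝ => (K + 2 * |C|) * Real.exp (-s)) Filter.atTop (nhds 0) := by
      have := Real.tendsto_exp_neg_atTop_nhds_zero.const_mul (K + 2 * |C|)
      rwa [mul_zero] at this
    refine squeeze_zero_norm' ?_ hb
    filter_upwards [Filter.eventually_ge_atTop 1] with s hs
    have h0 : 0 < s := by linarith
    have h1 := H.L_err hK0 hK h0
    have h2 := abs_add_le (xiL ξ s - C * (Real.exp (-s) * (1 / s + 1 / s ^ 2))) (C * (Real.exp (-s) * (1 / s + 1 / s ^ 2)))
    rw [sub_add_cancel] at h2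
    have i1 : 1 / s ≤ 1 := by rw [div_le_one h0]; exact hs
    have i2 : 1 / s ^ 2 ≤ 1 := by rw [div_le_one (by positivity)]; nlinarith
    have hep := Real.exp_pos (-s)
    have h3 : |C * (Real.exp (-s) * (1 / s + 1 / s ^ 2))| ≤ |C| * (Real.exp (-s) * 2) := by
      rw [abs_mul, abs_of_nonneg (by positivity : 0 ≤ Real.exp (-s) * (1 / s + 1 / s ^ 2))]
      gcongr; linarith
    have h4 : K * (Real.exp (-s) / s) ≤ K * Real.exp (-s) := by
      gcongr; exact div_le_self hep.le hs
    rw [Real.norm_eq_abs]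
    linarith
  have l1 : Filter.Tendsto (fun n : ℕ => (1 + xiL ξ n) * Real.exp (-2 * (xiEin n - Real.log n))) Filter.atTop
      (nhds ((1 + 0) * Real.exp (-2 * Real.eulerMascheroniConstant))) :=
    ((hL.comp tendsto_natCast_atTop_atTop).const_add 1).mul ((xiEin_lim.const_mul (-2)).rexp)
  rw [add_zero, one_mul] at l1
  refine tendsto_nhds_unique (f := fun _ : ℕ => C) tendsto_const_nhds (l1.congr' ?_)
  filter_upwards [Filter.eventually_gt_atTop 0] with n hn
  have hn : (0:ℝ) < n := by exact_mod_cast hn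
  rw [← hG n hn]
  have : Real.exp (-2 * (xiEin n - Real.log n)) = (n:ℝ) ^ 2 * Real.exp (-2 * xiEin n) := by
    rw [show -2 * (xiEin n - Real.log n) = Real.log n + Real.log n + -2 * xiEin n by ring, Real.exp_add, Real.exp_add,
      Real.exp_log hn]
    ring
  rw [this]; ring

end XiF

theorem xi_derivative_bounds (ξ : ℝ → ℝ)
    (hξ0 : ∀ u : ℝ, u < 1 → ξ u = 0)
    (hξ : ∀ u : ℝ, 1 ≤ u → u * ξ u = 2 + 2 * ∫ t in (1:ℝ)..(u - 1), ξ t) :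
    (∀ u : ℝ, 2 < u → DifferentiableAt ℝ ξ u) ∧
    ContinuousOn (deriv ξ) (Set.Ioi (2:ℝ)) ∧
    (∀ u : ℝ, 3 < u → DifferentiableAt ℝ (deriv ξ) u) ∧
    ContinuousOn (deriv (deriv ξ)) (Set.Ioi (3:ℝ)) ∧
    (∀ u : ℝ, 3.5 ≤ u →
      |deriv (deriv ξ) u| < (2:ℝ) ^ u / (7 * Real.Gamma (u + 1))) ∧
    (∀ u : ℝ, 2.5 ≤ u →
      |deriv ξ u - Real.exp (-2 * Real.eulerMascheroniConstant)| <
        (2:ℝ) ^ u / (7 * Real.Gamma (u + 1))) ∧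
    (∀ u : ℝ, 1.5 ≤ u →
      |ξ u - (u + 2) * Real.exp (-2 * Real.eulerMascheroniConstant)| <
        (2:ℝ) ^ u / (7 * Real.Gamma (u + 1))) := by
  have H : XiF ξ := ⟨hξ0, hξ⟩
  obtain ⟨C, hC⟩ := H.exC2
  have hCe := H.C_eq hC
  rw [hCe] at hC
  obtain ⟨hc1, hc2⟩ := xi_c_bounds
  have e1 : Set.EqOn (deriv ξ) (xiD1 ξ) (Set.Ioi 2) := fun u hu => (H.dh hu).deriv
  have d2 : ∀ u, 3 < u → HasDerivAt (deriv ξ) (xiD2 ξ u) u := fun u hu =>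
    (H.d2 (by linarith) hu.ne').congr_of_eventuallyEq
      (e1.eventuallyEq_of_mem (Ioi_mem_nhds (by linarith)))
  have e2 : Set.EqOn (deriv (deriv ξ)) (xiD2 ξ) (Set.Ioi 3) := fun u hu => (d2 u hu).deriv
  refine ⟨fun u hu => (H.dh hu).differentiableAt,
    (H.c1.mono Set.Ioi_subset_Ici_self).congr e1,
    fun u hu => (d2 u hu).differentiableAt,
    (H.c2.mono Set.Ioi_subset_Ici_self).congr e2, ?_, ?_, ?_⟩
  · intro u hu
    rw [e2 (show (3:ℝ) < u by norm_num at hu; linarith)]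
    exact H.D2_all hu
  · intro u hu
    rw [e1 (show (2:ℝ) < u by norm_num at hu; linarith)]
    exact H.D1_all hc1 hc2 hC hu
  · intro u hu
    exact H.x_all hc1 hc2 hC hu
end
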